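/- arXiv:2007.05744 — 2 statements merged into one kernel-verified Lean document; each statement's English description precedes it below -/
import Mathlib

section
/- If M is sequentially Cohen–Macaulay with respect to Q, then M has maximal depth with respect to Q. -/
open CategoryTheory MvPolynomial

noncomputable section

/-- The standard bigraded polynomial ring `S = K[x_1,…,x_m, y_1,…,y_n]`. -/
abbrev BGS (K : Type) [Field K] (m n : ℕ) : Type := MvPolynomial (Fin m ⊕ Fin n) K

/-- The bigrading weights: `deg x_i = (1,0)`, `deg y_j = (0,1)`. -/
def bwt (m n : ℕ) : Fin m ⊕ Fin n → ℕ × ℕ := Sum.elim (fun _ => (1, 0)) (fun _ => (0, 1))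

/-- `P = (x_1, …, x_m)`. -/
def idealP (K : Type) [Field K] (m n : ℕ) : Ideal (BGS K m n) :=
  Ideal.span (Set.range fun i : Fin m => (X (Sum.inl i) : BGS K m n))

/-- `Q = (y_1, …, y_n)`. -/
def idealQ (K : Type) [Field K] (m n : ℕ) : Ideal (BGS K m n) :=
  Ideal.span (Set.range fun j : Fin n => (X (Sum.inr j) : BGS K m n))

/-- `cd(J, M)`: the cohomological dimension, i.e. the largest `i` such that the local
cohomology module `H^i_J(M)` is nonzero. -/
def cohDim (R : Type) [CommRing R] (J : Ideal R) (M : Type) [AddCommGroup M] [Module R M] : ℕ :=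
  sSup {i : ℕ | Nontrivial ((localCohomology J i).obj (ModuleCat.of R M))}

/-- `grade(J, M)`: the least `i` with `Ext^i(R/J, M) ≠ 0`. -/
def extGrade (R : Type) [CommRing R] (J : Ideal R) (M : Type) [AddCommGroup M] [Module R M] : ℕ :=
  sInf {i : ℕ | Nontrivial
    (((Ext R (ModuleCat R) i).obj (Opposite.op (ModuleCat.of R (R ⧸ J)))).obj (ModuleCat.of R M))}

/-- `mgrade(J, M) = min {cd(J, R/p) : p ∈ Ass(M)}`. -/
def mCohDim (R : Type) [CommRing R] (J : Ideal R) (M : Type) [AddCommGroup M] [Module R M] : ℕ :=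
  sInf ((fun p => cohDim R J (R ⧸ p)) '' associatedPrimes R M)

/-- `M` has maximal depth with respect to `J` if `grade(J, M) = mgrade(J, M)`. -/
def HasMaximalDepth (R : Type) [CommRing R] (J : Ideal R) (M : Type) [AddCommGroup M]
    [Module R M] : Prop :=
  extGrade R J M = mCohDim R J M

/-- A bigrading on an `S`-module `M`: an internal direct sum decomposition indexed by `ℕ × ℕ`
compatible with the bigrading of `S`. -/
structure IsBigrading (K : Type) [Field K] (m n : ℕ) (M : Type) [AddCommGroup M]
    [Module (BGS K m n) M] (ℳ : ℕ × ℕ → AddSubgroup M) : Prop where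
  internal : DirectSum.IsInternal ℳ
  smul_mem : ∀ (d e : ℕ × ℕ) (s : BGS K m n) (x : M),
    IsWeightedHomogeneous (bwt m n) s d → x ∈ ℳ e → s • x ∈ ℳ (d + e)

/-- A submodule is bigraded if it is generated by bihomogeneous elements. -/
def IsBigradedSubmodule (K : Type) [Field K] (m n : ℕ) {M : Type} [AddCommGroup M]
    [Module (BGS K m n) M] (ℳ : ℕ × ℕ → AddSubgroup M) (N : Submodule (BGS K m n) M) : Prop :=
  N = Submodule.span (BGS K m n) {x : M | x ∈ N ∧ ∃ d, x ∈ ℳ d}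
/-- `M` is Cohen–Macaulay with respect to `J` if `grade(J, M) = cd(J, M)`. -/
def IsCMWrt (R : Type) [CommRing R] (J : Ideal R) (M : Type) [AddCommGroup M]
    [Module R M] : Prop :=
  extGrade R J M = cohDim R J M

/-- `M` is sequentially Cohen–Macaulay with respect to `Q`: there is a finite filtration
`0 = M_0 ⊊ M_1 ⊊ … ⊊ M_r = M` by bigraded submodules whose successive quotients are
Cohen–Macaulay with respect to `Q` with strictly increasing cohomological dimensions. -/
def IsSeqCMWrtQ (K : Type) [Field K] (m n : ℕ) (M : Type) [AddCommGroup M]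
    [Module (BGS K m n) M] (ℳ : ℕ × ℕ → AddSubgroup M) : Prop :=
  ∃ (r : ℕ) (F : Fin (r + 1) → Submodule (BGS K m n) M),
    StrictMono F ∧ F 0 = ⊥ ∧ F (Fin.last r) = ⊤ ∧
    (∀ i, IsBigradedSubmodule K m n ℳ (F i)) ∧
    (∀ i : Fin r, IsCMWrt (BGS K m n) (idealQ K m n)
      (↥(F i.succ) ⧸ (Submodule.comap (F i.succ).subtype (F i.castSucc)))) ∧
    (∀ i j : Fin r, i < j →
      cohDim (BGS K m n) (idealQ K m n)
          (↥(F i.succ) ⧸ (Submodule.comap (F i.succ).subtype (F i.castSucc))) <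
      cohDim (BGS K m n) (idealQ K m n)
          (↥(F j.succ) ⧸ (Submodule.comap (F j.succ).subtype (F j.castSucc))))

open Limits

namespace SeqCM
noncomputable section Bridge

variable {R : Type} [CommRing R]

/-- The functor `Hom(-, B)` to the opposite category of modules. -/
abbrev homF (B : ModuleCat.{0} R) : ModuleCat.{0} R ⥤ (ModuleCat.{0} R)ᵒᵖ :=
  ((linearYoneda R (ModuleCat.{0} R)).obj B).rightOp

def homK (A B : ModuleCat.{0} R) : ChainComplex (ModuleCat.{0} R)ᵒᵖ ℕ :=
  ((homF B).mapHomologicalComplex _).obj (projectiveResolution A).complex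

def clIso (A B : ModuleCat.{0} R) (n : ℕ) :
    ((homF B).leftDerived n).obj A ≅ (homK A B).homology n :=
  (projectiveResolution A).isoLeftDerivedObj (homF B) n

def clMap (A B : ModuleCat.{0} R) (n : ℕ) :
    ((homK A B).opcycles n).unop ⟶
      ((_root_.Ext R (ModuleCat.{0} R) n).obj (Opposite.op A)).obj B :=
  ((homK A B).homologyι n).unop ≫
    (clIso A B n).hom.unop

def inclMap (A B : ModuleCat.{0} R) (n : ℕ) :
    ((homK A B).opcycles n).unop ⟶
      ModuleCat.of R ((projectiveResolution A).complex.X n ⟶ B) :=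
  ((homK A B).pOpcycles n).unop

def Rep {A B : ModuleCat.{0} R} {n : ℕ} (f : (projectiveResolution A).complex.X n ⟶ B)
    (x : ((_root_.Ext R (ModuleCat.{0} R) n).obj (Opposite.op A)).obj B) : Prop :=
  ∃ z, inclMap A B n z = f ∧ clMap A B n z = x

lemma rep_exists_f {A B : ModuleCat.{0} R} {n : ℕ}
    (x : ((_root_.Ext R (ModuleCat.{0} R) n).obj (Opposite.op A)).obj B) :
    ∃ f, Rep f x := by
  have : Epi (clMap A B n) := by
    have e1 : Epi ((clIso A B n).hom ≫ (homK A B).homologyι n).unop := unop_epi_of_mono _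
    exact e1
  obtain ⟨z, hz⟩ := (ModuleCat.epi_iff_surjective _).1 this x
  exact ⟨_, z, rfl, hz⟩

lemma rep_cocycle {A B : ModuleCat.{0} R} {n : ℕ} {f : (projectiveResolution A).complex.X n ⟶ B}
    {x : ((_root_.Ext R (ModuleCat.{0} R) n).obj (Opposite.op A)).obj B} (h : Rep f x) (m : ℕ) :
    (projectiveResolution A).complex.d m n ≫ f = 0 := by
  obtain ⟨z, rfl, -⟩ := h
  have h1 : (homK A B).d m n ≫ (homK A B).pOpcycles n = 0 := HomologicalComplex.d_pOpcycles _ _ _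
  have h2 := congrArg (fun φ => φ.unop z) h1
  exact h2

lemma rep_exists_x {A B : ModuleCat.{0} R} {n : ℕ} (f : (projectiveResolution A).complex.X n ⟶ B)
    (h : (projectiveResolution A).complex.d (n+1) n ≫ f = 0) :
    ∃ x : ((_root_.Ext R (ModuleCat.{0} R) n).obj (Opposite.op A)).obj B, Rep f x := by
  let S : ShortComplex (ModuleCat.{0} R)ᵒᵖ :=
    ShortComplex.mk ((homK A B).d (n+1) n) ((homK A B).pOpcycles n) (HomologicalComplex.d_pOpcycles _ _ _)
  have hS : S.Exact :=
    S.exact_of_g_is_cokernel ((homK A B).opcyclesIsCokernel (n+1) n (by simp))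
  have h2 := (ShortComplex.moduleCat_exact_iff _).1 hS.unop
  obtain ⟨z, hz⟩ := h2 f h
  exact ⟨_, z, hz, rfl⟩

lemma incl_inj (A B : ModuleCat.{0} R) (n : ℕ) : Function.Injective (inclMap A B n) := by
  have : Mono (inclMap A B n) := by
    unfold inclMap
    exact unop_mono_of_epi _
  exact (ModuleCat.mono_iff_injective _).1 this

lemma rep_zero_iff {A B : ModuleCat.{0} R} {n : ℕ} {f : (projectiveResolution A).complex.X (n+1) ⟶ B}
    {x : ((_root_.Ext R (ModuleCat.{0} R) (n+1)).obj (Opposite.op A)).obj B} (h : Rep f x) :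
    x = 0 ↔ ∃ g, (projectiveResolution A).complex.d (n+1) n ≫ g = f := by
  obtain ⟨z, rfl, rfl⟩ := h
  let S : ShortComplex (ModuleCat.{0} R)ᵒᵖ :=
    ShortComplex.mk ((homK A B).homologyι (n+1)) ((homK A B).fromOpcycles (n+1) n) (by simp)
  have hS : S.Exact :=
    S.exact_of_f_is_kernel ((homK A B).homologyIsKernel (n+1) n (by simp))
  have h2 := (ShortComplex.moduleCat_exact_iff _).1 hS.unop
  have hcl : clMap A B (n+1) z = 0 ↔ ((homK A B).homologyι (n+1)).unop z = 0 := by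
    have : Mono ((clIso A B (n+1)).hom.unop) :=
      inferInstance
    have hi := (ModuleCat.mono_iff_injective _).1 this
    constructor
    · intro h
      apply hi
      exact h.trans (map_zero (clIso A B (n+1)).hom.unop.hom).symm
    · intro h
      have h3 : clMap A B (n+1) z = (clIso A B (n+1)).hom.unop
        (((homK A B).homologyι (n+1)).unop z) := rfl
      rw [h3, h]
      exact map_zero (clIso A B (n+1)).hom.unop.hom
  rw [hcl]
  have key : ∀ g : (projectiveResolution A).complex.X n ⟶ B,
      inclMap A B (n+1) (((homK A B).fromOpcycles (n+1) n).unop g) =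
      (projectiveResolution A).complex.d (n+1) n ≫ g := by
    intro g
    have h1 : (homK A B).pOpcycles (n+1) ≫ (homK A B).fromOpcycles (n+1) n = (homK A B).d (n+1) n :=
      HomologicalComplex.p_fromOpcycles _ _ _
    exact congrArg (fun φ => φ.unop g) h1
  constructor
  · intro h
    obtain ⟨g, hg⟩ := h2 z h
    refine ⟨g, ?_⟩
    exact (key g).symm.trans (congrArg _ hg)
  · rintro ⟨g, hg⟩
    rw [← incl_inj _ _ _ ((key g).trans hg)]
    exact congrArg (fun φ => φ.unop g) S.zero

lemma rep_zero_iff' {A B : ModuleCat.{0} R} {f : (projectiveResolution A).complex.X 0 ⟶ B}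
    {x : ((_root_.Ext R (ModuleCat.{0} R) 0).obj (Opposite.op A)).obj B} (h : Rep f x) :
    x = 0 ↔ f = 0 := by
  obtain ⟨z, rfl, rfl⟩ := h
  have h1 : IsIso ((homK A B).homologyι 0) := by
    exact ((ChainComplex.isoHomologyι₀ (homK A B)).isIso_hom)
  have : IsIso (clMap A B 0) := by
    have e1 : IsIso ((clIso A B 0).hom ≫ (homK A B).homologyι 0).unop := inferInstance
    exact e1
  have hi := (ModuleCat.mono_iff_injective (clMap A B 0)).1 inferInstance
  have hj := incl_inj A B 0
  rw [map_eq_zero_iff _ hi]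
  exact (map_eq_zero_iff (inclMap A B 0).hom hj).symm

lemma rep_map {A A' B : ModuleCat.{0} R} {n : ℕ} {f : (projectiveResolution A).complex.X n ⟶ B}
    {x : ((_root_.Ext R (ModuleCat.{0} R) n).obj (Opposite.op A)).obj B} (h : Rep f x) (g : A' ⟶ A)
    (φ : ProjectiveResolution.Hom (projectiveResolution A') (projectiveResolution A) g) :
    Rep (φ.hom.f n ≫ f) (((_root_.Ext R (ModuleCat.{0} R) n).map g.op).app B x) := by
  obtain ⟨z, rfl, rfl⟩ := h
  let ψ : homK A' B ⟶ homK A B := ((homF B).mapHomologicalComplex _).map φ.hom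
  refine ⟨(HomologicalComplex.opcyclesMap ψ n).unop z, ?_, ?_⟩
  · have h1 := HomologicalComplex.p_opcyclesMap ψ n
    exact congrArg (fun φ => φ.unop z) h1
  · have h1 := HomologicalComplex.homologyι_naturality ψ n
    have h2 : ((homF B).leftDerived n).map g ≫ (clIso A B n).hom =
      (clIso A' B n).hom ≫ HomologicalComplex.homologyMap ψ n := ProjectiveResolution.isoLeftDerivedObj_hom_naturality g (projectiveResolution A')
      (projectiveResolution A) φ.hom (by simpa using φ.hom_f_zero_comp_π_f_zero) (homF B) n
    have h3 : ((homF B).leftDerived n).map g ≫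
      ((clIso A B n).hom ≫ (homK A B).homologyι n) =
       ((clIso A' B n).hom ≫ (homK A' B).homologyι n) ≫
         HomologicalComplex.opcyclesMap ψ n := by
      rw [Category.assoc, ← h1, reassoc_of% h2]
    exact (congrArg (fun φ => φ.unop z) h3).symm

end Bridge
end SeqCM


namespace SeqCM
noncomputable section Bridge2

variable {R : Type} [CommRing R]

lemma extMk_zero_iff_zero {A B : ModuleCat.{0} R} (P : ProjectiveResolution A)
    (f : P.complex.X 0 ⟶ B) (hf : P.complex.d 1 0 ≫ f = 0) :
    P.extMk f 1 rfl hf = 0 ↔ f = 0 := by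
  constructor
  · intro h
    rw [← P.extEquivCohomologyClass.apply_eq_iff_eq, P.extEquivCohomologyClass_extMk,
      P.extEquivCohomologyClass_zero, CochainComplex.HomComplex.CohomologyClass.mk_eq_zero_iff] at h
    rw [CochainComplex.HomComplex.Cocycle.toSingleMk_mem_coboundaries_iff _ _ _ _ _ 1 (by simp)] at h
    obtain ⟨g, hg⟩ := h
    have hg0 : g = 0 := by
      apply IsZero.eq_of_src
      exact P.cochainComplex.isZero_of_isStrictlyLE 0 1 (by lia)
    rw [hg0, comp_zero] at hg
    rw [← cancel_epi (P.cochainComplexXIso (-((0:ℕ):ℤ)) 0 rfl).hom, ← hg, comp_zero]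
  · rintro rfl
    simp

/-- compatibility between the two models of Ext -/
def Agree {A B : ModuleCat.{0} R} {n : ℕ}
    (x : ((_root_.Ext R (ModuleCat.{0} R) n).obj (Opposite.op A)).obj B)
    (e : Abelian.Ext.{0} A B n) : Prop :=
  ∃ f hf, Rep f x ∧ (projectiveResolution A).extMk f (n+1) rfl hf = e

lemma agree_left {A B : ModuleCat.{0} R} {n : ℕ}
    (x : ((_root_.Ext R (ModuleCat.{0} R) n).obj (Opposite.op A)).obj B) : ∃ e, Agree x e := by
  obtain ⟨f, hf⟩ := rep_exists_f x
  exact ⟨_, f, rep_cocycle hf _, hf, rfl⟩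

lemma agree_right {A B : ModuleCat.{0} R} {n : ℕ}
    (e : Abelian.Ext.{0} A B n) : ∃ x, Agree x e := by
  obtain ⟨f, hf, h⟩ := (projectiveResolution A).extMk_surjective e (n+1) rfl
  obtain ⟨x, hx⟩ := rep_exists_x f hf
  exact ⟨x, f, hf, hx, h⟩

lemma agree_zero {A B : ModuleCat.{0} R} {n : ℕ}
    {x : ((_root_.Ext R (ModuleCat.{0} R) n).obj (Opposite.op A)).obj B}
    {e : Abelian.Ext.{0} A B n} (h : Agree x e) : x = 0 ↔ e = 0 := by
  obtain ⟨f, hf, hx, rfl⟩ := h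
  cases n with
  | zero => rw [rep_zero_iff' hx, extMk_zero_iff_zero]
  | succ n => rw [rep_zero_iff hx, ProjectiveResolution.extMk_eq_zero_iff _ _ _ _ _ n rfl]

lemma agree_map {A A' B : ModuleCat.{0} R} {n : ℕ}
    {x : ((_root_.Ext R (ModuleCat.{0} R) n).obj (Opposite.op A)).obj B}
    {e : Abelian.Ext.{0} A B n} (h : Agree x e) (g : A' ⟶ A) :
    Agree (((_root_.Ext R (ModuleCat.{0} R) n).map g.op).app B x)
      ((Abelian.Ext.mk₀ g).comp e (zero_add n)) := by
  obtain ⟨f, hf, hx, rfl⟩ := h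
  let φ : ProjectiveResolution.Hom (projectiveResolution A') (projectiveResolution A) g :=
    ⟨ProjectiveResolution.lift g _ _, by
      have := congrArg (fun φ => φ.f 0)
        (ProjectiveResolution.lift_commutes g (projectiveResolution A') (projectiveResolution A))
      exact this⟩
  refine ⟨φ.hom.f n ≫ f, ?_, rep_map hx g φ, ?_⟩
  · rw [← Category.assoc, ← φ.hom.comm, Category.assoc, hf, comp_zero]
  · rw [ProjectiveResolution.mk₀_comp_extMk _ _ _ _ φ]

lemma old_ext_nontrivial {A B : ModuleCat.{0} R} {n : ℕ} :
    Nontrivial (((_root_.Ext R (ModuleCat.{0} R) n).obj (Opposite.op A)).obj B) ↔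
    ∃ e : Abelian.Ext.{0} A B n, e ≠ 0 := by
  constructor
  · intro h
    obtain ⟨x, hx⟩ := exists_ne (0 : (((_root_.Ext R (ModuleCat.{0} R) n).obj (Opposite.op A)).obj B))
    obtain ⟨e, he⟩ := agree_left x
    exact ⟨e, fun h => hx ((agree_zero he).2 h)⟩
  · rintro ⟨e, he⟩
    obtain ⟨x, hx⟩ := agree_right e
    exact ⟨x, 0, fun h => he ((agree_zero hx).1 h)⟩

/-- transition maps `R/I → R/J`. -/
def trans {I J : Ideal R} (h : I ≤ J) : ModuleCat.of R (R ⧸ I) ⟶ ModuleCat.of R (R ⧸ J) :=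
  ModuleCat.ofHom (Submodule.mapQ I J LinearMap.id h)

/-- vanishing of local cohomology in terms of Ext. -/
def HZ (Q : Ideal R) (i : ℕ) (X : ModuleCat.{0} R) : Prop :=
  ∀ (l : ℕ) (e : Abelian.Ext.{0} (ModuleCat.of R (R ⧸ Q ^ l)) X i), ∃ (l' : ℕ) (h : l ≤ l'),
    (Abelian.Ext.mk₀ (trans (Ideal.pow_le_pow_right h))).comp e (zero_add i) = 0

open localCohomology in
lemma localCohomology_subsingleton (J : Ideal R) (i : ℕ) (X : ModuleCat.{0} R) :
    ¬ Nontrivial ((localCohomology J i).obj X) ↔ HZ J i X := by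
  rw [not_nontrivial_iff_subsingleton]
  have hc : IsColimit (((evaluation _ _).obj X).mapCocone
    (colimit.cocone (diagram (idealPowersDiagram J) i))) :=
    isColimitOfPreserves _ (colimit.isColimit _)
  constructor
  · intro hs l e
    obtain ⟨x, hx⟩ := agree_right e
    have h0 := (Concrete.isColimit_rep_eq_iff_exists _ hc (i := Opposite.op (Opposite.op l)) (j := Opposite.op (Opposite.op l)) x 0).1
       (hs.elim _ _)
    obtain ⟨k, f, g, h⟩ := h0
    have hh : l ≤ k.unop.unop := f.unop.unop.down.down
    refine ⟨k.unop.unop, hh, ?_⟩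
    have := agree_map hx (trans (Ideal.pow_le_pow_right hh))
    rw [← agree_zero this]
    refine Eq.trans h ?_
    exact map_zero _
  · intro h
    have : ∀ x : ((localCohomology J i).obj X), x = 0 := by
      intro x
      obtain ⟨l, y, hy⟩ := Concrete.isColimit_exists_rep _ hc x
      obtain ⟨e, he⟩ := agree_left y
      obtain ⟨l', hl, h0⟩ := h _ e
      have hm := agree_map he (trans (Ideal.pow_le_pow_right hl))
      replace h0 := (agree_zero hm).2 h0
      rw [← hy]
      have h3 : (colimit.cocone (diagram (idealPowersDiagram J) i)).ι.app l =
         (diagram (idealPowersDiagram J) i).map (homOfLE hl).op.op ≫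
           (colimit.cocone (diagram (idealPowersDiagram J) i)).ι.app (Opposite.op (Opposite.op l')) :=
           ((colimit.cocone (diagram (idealPowersDiagram J) i)).w (homOfLE hl).op.op).symm
      have h4 := congrArg (fun φ => (φ.app X) y) h3
      refine Eq.trans h4 ?_
      refine Eq.trans (congrArg (((colimit.cocone (diagram (idealPowersDiagram J) i)).ι.app (Opposite.op (Opposite.op l'))).app X) h0) ?_
      exact map_zero _
    exact ⟨fun a b => (this a).trans (this b).symm⟩

end Bridge2
end SeqCM


namespace SeqCM
noncomputable section Exactness

open Abelian Abelian.Ext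

variable {R : Type} [CommRing R]

/-- pull back -/
def pb {Q : Ideal R} {l l' : ℕ} (h : l ≤ l') {X : ModuleCat.{0} R} {i : ℕ}
    (e : Abelian.Ext.{0} (ModuleCat.of R (R ⧸ Q ^ l)) X i) :
    Abelian.Ext.{0} (ModuleCat.of R (R ⧸ Q ^ l')) X i :=
  (Abelian.Ext.mk₀ (trans (Ideal.pow_le_pow_right h))).comp e (zero_add i)

lemma trans_comp {I J K : Ideal R} (h : I ≤ J) (h' : J ≤ K) :
    trans h ≫ trans h' = trans (h.trans h') := by
  unfold trans
  rw [← ModuleCat.ofHom_comp]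
  congr 1
  apply Submodule.linearMap_qext
  ext
  rfl

lemma pb_pb {Q : Ideal R} {l l' l'' : ℕ} (h : l ≤ l') (h' : l' ≤ l'') {X : ModuleCat.{0} R} {i : ℕ}
    (e : Abelian.Ext.{0} (ModuleCat.of R (R ⧸ Q ^ l)) X i) :
    pb h' (pb h e) = pb (h.trans h') e := by
  unfold pb
  rw [Abelian.Ext.mk₀_comp_mk₀_assoc, trans_comp]

lemma pb_comp {Q : Ideal R} {l l' : ℕ} (h : l ≤ l') {X Y : ModuleCat.{0} R} {i j k : ℕ}
    (e : Abelian.Ext.{0} (ModuleCat.of R (R ⧸ Q ^ l)) X i) (f : Abelian.Ext.{0} X Y j)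
    (hk : i + j = k) : pb h (e.comp f hk) = (pb h e).comp f hk := by
  unfold pb
  rw [Abelian.Ext.comp_assoc]
  lia

lemma pb_zero {Q : Ideal R} {l l' : ℕ} (h : l ≤ l') {X : ModuleCat.{0} R} {i : ℕ} :
    pb (Q := Q) h (0 : Abelian.Ext.{0} (ModuleCat.of R (R ⧸ Q ^ l)) X i) = 0 := by
  simp [pb]

/-- vanishing in the limit -/
def DZ {Q : Ideal R} {l : ℕ} {X : ModuleCat.{0} R} {i : ℕ}
    (e : Abelian.Ext.{0} (ModuleCat.of R (R ⧸ Q ^ l)) X i) : Prop :=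
  ∃ (l' : ℕ) (h : l ≤ l'), pb h e = 0

lemma hz_iff {Q : Ideal R} {i : ℕ} {X : ModuleCat.{0} R} : HZ Q i X ↔
   ∀ (l : ℕ) (e : Abelian.Ext.{0} (ModuleCat.of R (R ⧸ Q ^ l)) X i), DZ e := Iff.rfl

lemma DZ.of_pb {Q : Ideal R} {l l' : ℕ} {X : ModuleCat.{0} R} {i : ℕ}
    {e : Abelian.Ext.{0} (ModuleCat.of R (R ⧸ Q ^ l)) X i} (h : l ≤ l') (H : DZ (pb h e)) : DZ e := by
  obtain ⟨l'', h', h0⟩ := H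
  exact ⟨l'', h.trans h', by rw [← pb_pb h h', h0]⟩

lemma DZ.comp {Q : Ideal R} {l : ℕ} {X Y : ModuleCat.{0} R} {i j k : ℕ}
    {e : Abelian.Ext.{0} (ModuleCat.of R (R ⧸ Q ^ l)) X i} (H : DZ e) (f : Abelian.Ext.{0} X Y j)
    (hk : i + j = k) : DZ (e.comp f hk) := by
  obtain ⟨l', h, h0⟩ := H
  exact ⟨l', h, by rw [pb_comp, h0, Abelian.Ext.zero_comp]⟩

/-- vanishing of the map induced by `φ` on local cohomology -/
def HZm (Q : Ideal R) (i : ℕ) {X Y : ModuleCat.{0} R} (φ : X ⟶ Y) : Prop :=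
   ∀ (l : ℕ) (e : Abelian.Ext.{0} (ModuleCat.of R (R ⧸ Q ^ l)) X i),
     DZ (e.comp (mk₀ φ) (add_zero i))

variable {S : ShortComplex (ModuleCat.{0} R)} {Q : Ideal R} {i : ℕ}

lemma dz_exact₂ (hS : S.ShortExact) {l : ℕ} (e : Abelian.Ext.{0} (ModuleCat.of R (R ⧸ Q ^ l)) S.X₂ i)
    (h : DZ (e.comp (mk₀ S.g) (add_zero i))) :
    ∃ (l' : ℕ) (h : l ≤ l') (e' : Abelian.Ext.{0} (ModuleCat.of R (R ⧸ Q ^ l')) S.X₁ i),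
      pb h e = e'.comp (mk₀ S.f) (add_zero i) := by
  obtain ⟨l', h, h0⟩ := h
  rw [pb_comp] at h0
  obtain ⟨e', he⟩ := covariant_sequence_exact₂ _ hS _ h0
  exact ⟨l', h, e', he.symm⟩

lemma dz_exact₃ (hS : S.ShortExact) {l : ℕ} (e : Abelian.Ext.{0} (ModuleCat.of R (R ⧸ Q ^ l)) S.X₃ i)
    (h : DZ (e.comp hS.extClass rfl)) :
    ∃ (l' : ℕ) (h : l ≤ l') (e' : Abelian.Ext.{0} (ModuleCat.of R (R ⧸ Q ^ l')) S.X₂ i),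
      pb h e = e'.comp (mk₀ S.g) (add_zero i) := by
  obtain ⟨l', h, h0⟩ := h
  rw [pb_comp] at h0
  obtain ⟨e', he⟩ := covariant_sequence_exact₃ _ hS _ _ h0
  exact ⟨l', h, e', he.symm⟩

lemma hz₂ (hS : S.ShortExact) (h1 : HZ Q i S.X₁) (h3 : HZ Q i S.X₃) : HZ Q i S.X₂ := by
  intro l e
  obtain ⟨l', h, e', he⟩ := dz_exact₂ hS e (h3 _ _)
  refine DZ.of_pb h ?_
  rw [he]
  exact DZ.comp (h1 _ _) _ _

lemma hz₃ (hS : S.ShortExact) (h1 : HZ Q (i+1) S.X₁) (h2 : HZ Q i S.X₂) : HZ Q i S.X₃ := by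
  intro l e
  obtain ⟨l', h, e', he⟩ := dz_exact₃ hS e (h1 _ _)
  refine DZ.of_pb h ?_
  rw [he]
  exact DZ.comp (h2 _ _) _ _

lemma hz_iso {X Y : ModuleCat.{0} R} (φ : X ≅ Y) (h : HZ Q i X) : HZ Q i Y := by
  intro l e
  have h0 := h l (e.comp (mk₀ φ.inv) (add_zero i))
  have := DZ.comp h0 (mk₀ φ.hom) (add_zero i)
  rw [comp_assoc_of_third_deg_zero, mk₀_comp_mk₀, φ.inv_hom_id, comp_mk₀_id] at this
  exact this

lemma hz_zero {X : ModuleCat.{0} R} (h : IsZero X) : HZ Q i X := by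
  intro l e
  refine ⟨l, le_rfl, ?_⟩
  have : e = e.comp (mk₀ (𝟙 X)) (add_zero i) := by simp
  rw [this, h.eq_of_src (𝟙 X) 0]
  simp

/-- vanishing of Ext -/
def EZ (A B : ModuleCat.{0} R) (i : ℕ) : Prop := ∀ e : Abelian.Ext.{0} A B i, e = 0

lemma ez_cov₂ (hS : S.ShortExact) {A : ModuleCat.{0} R} (h1 : EZ A S.X₁ i) (h3 : EZ A S.X₃ i) : EZ A S.X₂ i := by
  intro e
  obtain ⟨e', rfl⟩ := covariant_sequence_exact₂ _ hS e (h3 _)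
  rw [h1 e', Abelian.Ext.zero_comp]

lemma ez_cov₁ (hS : S.ShortExact) {A : ModuleCat.{0} R} (h3 : EZ A S.X₃ i) (h2 : EZ A S.X₂ (i+1)) :
    EZ A S.X₁ (i+1) := by
  intro e
  obtain ⟨e', rfl⟩ := covariant_sequence_exact₁ _ hS e (h2 _) rfl
  rw [h3 e', Abelian.Ext.zero_comp]

lemma ez_con₂ (hS : S.ShortExact) {B : ModuleCat.{0} R} (h1 : EZ S.X₁ B i) (h3 : EZ S.X₃ B i) : EZ S.X₂ B i := by
  intro e
  obtain ⟨e', rfl⟩ := contravariant_sequence_exact₂ hS _ e (h1 _)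
  rw [h3 e', Abelian.Ext.comp_zero]

lemma ez_con₃ (hS : S.ShortExact) {B : ModuleCat.{0} R} (h1 : EZ S.X₁ B i) (h2 : EZ S.X₂ B (i+1)) :
    EZ S.X₃ B (i+1) := by
  intro e
  obtain ⟨e', rfl⟩ := contravariant_sequence_exact₃ hS _ e (h2 _) (add_comm 1 i)
  rw [h1 e', Abelian.Ext.comp_zero]

lemma ez_of_epi_zero {A A' B : ModuleCat.{0} R} (f : A' ⟶ A) [Epi f] (h : EZ A' B 0) : EZ A B 0 := by
  intro e
  obtain ⟨g, rfl⟩ := (mk₀_bijective _ _).2 e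
  have := h (mk₀ (f ≫ g))
  rw [mk₀_eq_zero_iff] at this ⊢
  rwa [← cancel_epi f, Limits.comp_zero]

lemma ez_iso₁ {A A' B : ModuleCat.{0} R} (φ : A ≅ A') (h : EZ A B i) : EZ A' B i := by
  intro e
  have h0 := h ((mk₀ φ.hom).comp e (zero_add i))
  have := congrArg (fun z => (mk₀ φ.inv).comp z (zero_add i)) h0
  simpa using this

lemma ez_iso₂ {A B B' : ModuleCat.{0} R} (φ : B ≅ B') (h : EZ A B i) : EZ A B' i := by
  intro e
  have h0 := h (e.comp (mk₀ φ.inv) (add_zero i))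
  have := congrArg (fun z => z.comp (mk₀ φ.hom) (add_zero i)) h0
  rw [comp_assoc_of_third_deg_zero, mk₀_comp_mk₀, φ.inv_hom_id, comp_mk₀_id, Abelian.Ext.zero_comp] at this
  exact this

lemma ez_proj {A B : ModuleCat.{0} R} [Projective A] : EZ A B (i+1) :=
  fun e => e.eq_zero_of_projective

/-- short complexes from linear maps -/
abbrev ses {A B C : Type} [AddCommGroup A] [AddCommGroup B] [AddCommGroup C]
    [Module R A] [Module R B] [Module R C] (f : A →ₗ[R] B) (g : B →ₗ[R] C)
    (h : Function.Exact f g) : ShortComplex (ModuleCat.{0} R) :=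
  ShortComplex.mk (ModuleCat.ofHom f) (ModuleCat.ofHom g) (by
    rw [← ModuleCat.ofHom_comp, h.linearMap_comp_eq_zero]; rfl)

lemma ses_exact {A B C : Type} [AddCommGroup A] [AddCommGroup B] [AddCommGroup C]
    [Module R A] [Module R B] [Module R C] (f : A →ₗ[R] B) (g : B →ₗ[R] C)
    (h : Function.Exact f g) (hf : Function.Injective f) (hg : Function.Surjective g) :
    (ses f g h).ShortExact where
  exact := (ShortComplex.ShortExact.moduleCat_exact_iff_function_exact _).2 h
  mono_f := (ModuleCat.mono_iff_injective _).2 hf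
  epi_g := (ModuleCat.epi_iff_surjective _).2 hg

end Exactness
end SeqCM


namespace SeqCM
noncomputable section Devissage

open Abelian Abelian.Ext

variable {R : Type} [CommRing R]

lemma ses_sub {N : Type} [AddCommGroup N] [Module R N] (U : Submodule R N) :
    (ses U.subtype U.mkQ (LinearMap.exact_subtype_mkQ U)).ShortExact :=
  ses_exact _ _ _ U.injective_subtype U.mkQ_surjective

lemma ses_ker {N L : Type} [AddCommGroup N] [Module R N] [AddCommGroup L] [Module R L]
    (f : N →ₗ[R] L) (hf : Function.Surjective f) :
    (ses f.ker.subtype f (LinearMap.exact_subtype_ker_map f)).ShortExact :=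
  ses_exact _ _ _ f.ker.injective_subtype hf

lemma isZero_of_subsingleton (N : Type) [AddCommGroup N] [Module R N] [Subsingleton N] :
    IsZero (ModuleCat.of R N) := ModuleCat.isZero_of_subsingleton _

lemma devissage [IsNoetherianRing R] (I : Ideal R) (P : ModuleCat.{0} R → Prop)
    (hzero : ∀ N, IsZero N → P N)
    (hiso : ∀ N L : ModuleCat.{0} R, (N ≅ L) → P N → P L)
    (hses : ∀ S : ShortComplex (ModuleCat.{0} R), S.ShortExact → P S.X₁ → P S.X₃ → P S.X₂)
    (hprime : ∀ p : Ideal R, p.IsPrime → I ≤ p → P (ModuleCat.of R (R ⧸ p)))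
    (T : Type) [AddCommGroup T] [Module R T] [Module.Finite R T] (hT : I ≤ Module.annihilator R T) :
    P (ModuleCat.of R T) := by
  have := IsNoetherianRing.induction_on_isQuotientEquivQuotientPrime (A := R) (M := T) inferInstance
    (motive := fun N _ _ _ => I ≤ Module.annihilator R N → P (ModuleCat.of R N))
    (fun N _ _ _ _ _ => hzero _ (isZero_of_subsingleton N))
    (fun N _ _ _ p f h => hiso _ _ f.symm.toModuleIso (hprime _ p.2 (by
      rw [f.annihilator_eq, Ideal.annihilator_quotient] at h; exact h)))
    (fun N₁ _ _ _ N₂ _ _ _ N₃ _ _ _ f g hf hg hfg h1 h3 h =>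
       hses _ (ses_exact f g hfg hf hg) (h1 (h.trans (f.annihilator_le_of_injective hf)))
         (h3 (h.trans (g.annihilator_le_of_surjective hg))))
  exact this hT

lemma ez_zero {A B : ModuleCat.{0} R} (h : IsZero A) (i : ℕ) : EZ A B i := by
  intro e
  have : e = (mk₀ (𝟙 A)).comp e (zero_add i) := by simp
  rw [this, h.eq_of_src (𝟙 A) 0]
  simp

lemma ann_pow {Q p : Ideal R} [hp : p.IsPrime] {k : ℕ} (h : Q ^ k ≤ p) : Q ≤ p := hp.le_of_pow_le h

/-- (d) -/
lemma ez_of_pow [IsNoetherianRing R] (Q : Ideal R) (M : ModuleCat.{0} R) (g : ℕ)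
    (h : ∀ i < g, EZ (ModuleCat.of R (R ⧸ Q)) M i) (i : ℕ) (hi : i < g) (k : ℕ)
    (T : Type) [AddCommGroup T] [Module R T] [Module.Finite R T] (hT : Q ^ k ≤ Module.annihilator R T) :
    EZ (ModuleCat.of R T) M i := by
  induction i generalizing k T with
  | zero =>
    refine devissage (Q ^ k) (fun N => EZ N M 0) (fun N hN => ez_zero hN 0) (fun N L f h => ez_iso₁ f h)
      (fun S hS h1 h3 => ez_con₂ hS h1 h3) (fun p hp hk => ?_) T hT
    have hQ := ann_pow hk
    have : Epi (trans hQ) := (ModuleCat.epi_iff_surjective _).2 (by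
      intro x
      obtain ⟨x, rfl⟩ := Submodule.Quotient.mk_surjective _ x
      exact ⟨Submodule.Quotient.mk x, rfl⟩)
    exact ez_of_epi_zero (trans hQ) (h 0 hi)
  | succ i ih =>
    refine devissage (Q ^ k) (fun N => EZ N M (i+1)) (fun N hN => ez_zero hN _) (fun N L f h => ez_iso₁ f h)
      (fun S hS h1 h3 => ez_con₂ hS h1 h3) (fun p hp hk => ?_) T hT
    have hQ := ann_pow hk
    have hs := ses_ker (Submodule.mapQ Q p LinearMap.id hQ) (by
      intro x
      obtain ⟨x, rfl⟩ := Submodule.Quotient.mk_surjective _ x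
      exact ⟨Submodule.Quotient.mk x, rfl⟩)
    refine ez_con₃ hs (ih (by lia) 1 _ ?_) (h _ hi)
    rw [pow_one]
    refine le_trans ?_ (LinearMap.annihilator_le_of_injective (Submodule.subtype _) (Submodule.injective_subtype _))
    rw [Ideal.annihilator_quotient]

lemma ext_restrict {F T F' T' K K' X : Type} [AddCommGroup F] [AddCommGroup T] [AddCommGroup F']
    [AddCommGroup T'] [AddCommGroup K] [AddCommGroup K'] [AddCommGroup X] [Module R F] [Module R T]
    [Module R F'] [Module R T'] [Module R K] [Module R K'] [Module R X]
    {a : K →ₗ[R] F} {b : F →ₗ[R] T} {ex : Function.Exact a b} (hS : (ses a b ex).ShortExact)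
    {a' : K' →ₗ[R] F'} {b' : F' →ₗ[R] T'} {ex' : Function.Exact a' b'} (hS' : (ses a' b' ex').ShortExact)
    (w : K' →ₗ[R] K) (u : F' →ₗ[R] F) (v : T' →ₗ[R] T) (h1 : a ∘ₗ w = u ∘ₗ a') (h2 : b ∘ₗ u = v ∘ₗ b')
    {j j' : ℕ} (e : Abelian.Ext.{0} (ModuleCat.of R K) (ModuleCat.of R X) j) (hj : 1 + j = j')
    (h : (mk₀ (ModuleCat.ofHom w)).comp e (zero_add j) = 0) :
    (mk₀ (ModuleCat.ofHom v)).comp (hS.extClass.comp e hj) (zero_add j') = 0 := by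
  let φ : ses a' b' ex' ⟶ ses a b ex :=
    { τ₁ := ModuleCat.ofHom w
      τ₂ := ModuleCat.ofHom u
      τ₃ := ModuleCat.ofHom v
      comm₁₂ := by
        dsimp
        rw [← ModuleCat.ofHom_comp, ← ModuleCat.ofHom_comp, h1]
      comm₂₃ := by
        dsimp
        rw [← ModuleCat.ofHom_comp, ← ModuleCat.ofHom_comp, h2] }
  have := ShortComplex.ShortExact.extClass_naturality hS' hS φ
  have h3 : (mk₀ (ModuleCat.ofHom v)).comp (hS.extClass.comp e hj) (zero_add j') =
    ((mk₀ (ModuleCat.ofHom v)).comp hS.extClass (zero_add 1)).comp e hj :=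
    (comp_assoc _ _ _ _ _ (by lia)).symm
  rw [h3]
  refine (congrArg (fun z => z.comp e hj) this.symm).trans ?_
  dsimp only
  rw [comp_assoc_of_second_deg_zero]
  refine (congrArg (fun z => hS'.extClass.comp z hj) h).trans ?_
  rw [Abelian.Ext.comp_zero]

lemma ext_factor {K K' : Type} [AddCommGroup K] [AddCommGroup K'] [Module R K] [Module R K']
    (w : K' →ₗ[R] K) (V : Submodule R K) (hw : ∀ x, w x ∈ V) {X : ModuleCat.{0} R} {j : ℕ}
    (e : Abelian.Ext.{0} (ModuleCat.of R K) X j)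
    (h : (mk₀ (ModuleCat.ofHom V.subtype)).comp e (zero_add j) = 0) :
    (mk₀ (ModuleCat.ofHom w)).comp e (zero_add j) = 0 := by
  have hw3 : w = V.subtype ∘ₗ LinearMap.codRestrict _ w hw := rfl
  rw [hw3, ModuleCat.ofHom_comp, ← mk₀_comp_mk₀_assoc, h, Abelian.Ext.comp_zero]

/-- Artin-Rees for Ext classes. -/
lemma ext_artin_rees [IsNoetherianRing R] (Q : Ideal R) (X : Type) [AddCommGroup X] [Module R X] (k : ℕ)
    (hX : Q ^ k ≤ Module.annihilator R X) (j : ℕ)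
    (T : Type) [AddCommGroup T] [Module R T] [Module.Finite R T]
    (e : Abelian.Ext.{0} (ModuleCat.of R T) (ModuleCat.of R X) j) :
    ∃ l : ℕ, (mk₀ (ModuleCat.ofHom (Q ^ l • (⊤ : Submodule R T)).subtype)).comp e (zero_add j) = 0 := by
  induction j generalizing T with
  | zero =>
    refine ⟨k, ?_⟩
    obtain ⟨g, rfl⟩ := (mk₀_bijective _ _).2 e
    rw [mk₀_comp_mk₀, mk₀_eq_zero_iff]
    ext ⟨x, hx⟩
    change g x = 0
    induction hx using Submodule.smul_induction_on' with
    | smul r hr n hn =>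
      refine (map_smul g.hom r n).trans ?_
      exact Module.mem_annihilator.1 (hX hr) _
    | add x hx y hy h1 h2 =>
      refine (map_add g.hom x y).trans ?_
      rw [show g.hom x = 0 from h1, show g.hom y = 0 from h2, add_zero]
  | succ j ih =>
    obtain ⟨r, π, hπ⟩ := Module.Finite.exists_fin' R T
    have hs := ses_ker π hπ
    have : Projective (ModuleCat.of R (Fin r → R)) :=
      ModuleCat.projective_of_free (Pi.basisFun R (Fin r))
    obtain ⟨e', rfl⟩ := contravariant_sequence_exact₃ hs _ e (eq_zero_of_projective _) (add_comm 1 j)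
    obtain ⟨l0, hl0⟩ := ih _ e'
    obtain ⟨a, ha⟩ := Ideal.exists_pow_inf_eq_pow_smul Q π.ker
    refine ⟨l0 + a, ?_⟩
    set U : Submodule R (Fin r → R) := Q ^ (l0 + a) • ⊤ with hU
    have hV : ∀ x ∈ U, π x ∈ (Q ^ (l0 + a) • ⊤ : Submodule R T) := by
      intro x hx
      have : π x ∈ U.map π := ⟨x, hx, rfl⟩
      rw [hU, Submodule.map_smul''] at this
      exact Submodule.smul_mono le_rfl le_top this
    have hV' : Function.Surjective (π.restrict hV) := by
      rintro ⟨y, hy⟩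
      have h1 : (Q ^ (l0 + a) • ⊤ : Submodule R T) = U.map π := by
        rw [hU, Submodule.map_smul'', Submodule.map_top, LinearMap.range_eq_top.2 hπ]
      rw [h1] at hy
      obtain ⟨x, hx, rfl⟩ := hy
      exact ⟨⟨x, hx⟩, rfl⟩
    have hw : ∀ x : (π.restrict hV).ker, (x : U).1 ∈ π.ker := by
      rintro ⟨x, hx⟩
      exact congrArg Subtype.val hx
    let w : (π.restrict hV).ker →ₗ[R] π.ker :=
      LinearMap.codRestrict _ (U.subtype ∘ₗ Submodule.subtype _) hw
    have hwc : π.ker.subtype ∘ₗ w = U.subtype ∘ₗ (π.restrict hV).ker.subtype := rfl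
    have hw2 : ∀ x, w x ∈ (Q ^ l0 • ⊤ : Submodule R π.ker) := by
      intro x
      have h1 : (w x).1 ∈ U ⊓ π.ker := ⟨x.1.2, (w x).2⟩
      have h4 : U ⊓ π.ker = Q ^ l0 • (Q ^ a • ⊤ ⊓ π.ker) := by
        rw [hU, ha _ (by lia), Nat.add_sub_cancel]
      replace h1 := h4.le h1
      have h2 := Submodule.smul_mono (le_refl (Q ^ l0)) (inf_le_right : Q ^ a • ⊤ ⊓ π.ker ≤ π.ker) h1
      have h3 : Q ^ l0 • π.ker = (Q ^ l0 • ⊤ : Submodule R π.ker).map π.ker.subtype := by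
        rw [Submodule.map_smul'', Submodule.map_top, Submodule.range_subtype]
      replace h2 := h3.le h2
      obtain ⟨y, hy, hy2⟩ := h2
      have : y = w x := Subtype.ext hy2
      rwa [← this]
    have hfac := ext_factor (K := π.ker) (K' := (π.restrict hV).ker) w (Q ^ l0 • ⊤) hw2 e' hl0
    clear_value w
    exact ext_restrict hs (ses_ker _ hV') w U.subtype
      (Q ^ (l0 + a) • (⊤ : Submodule R T)).subtype hwc (by ext; rfl) e' (add_comm 1 j) hfac

/-- (b) -/
lemma hz_of_ann [IsNoetherianRing R] (Q : Ideal R) (X : Type) [AddCommGroup X] [Module R X] (k : ℕ)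
    (hX : Q ^ k ≤ Module.annihilator R X) (i : ℕ) : HZ Q (i+1) (ModuleCat.of R X) := by
  intro l e
  have hs := ses_sub (Q ^ l)
  have : Projective (ModuleCat.of R R) :=
      ModuleCat.projective_of_free (Module.Basis.singleton Unit R)
  obtain ⟨e', rfl⟩ := contravariant_sequence_exact₃ hs _ e (eq_zero_of_projective _) (add_comm 1 i)
  obtain ⟨l0, hl0⟩ := ext_artin_rees Q X k hX i _ e'
  refine ⟨l0 + l, by lia, ?_⟩
  have hle : Q ^ (l0 + l) ≤ Q ^ l := Ideal.pow_le_pow_right (by lia)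
  let w : ↥(Q ^ (l0 + l)) →ₗ[R] ↥(Q ^ l) := Submodule.inclusion hle
  have hw2 : ∀ x, w x ∈ (Q ^ l0 • ⊤ : Submodule R ↥(Q ^ l)) := by
    intro x
    have h1 : (w x).1 ∈ Q ^ (l0 + l) := x.2
    have h3 : Q ^ (l0 + l) = (Q ^ l0 • ⊤ : Submodule R ↥(Q ^ l)).map (Submodule.subtype (Q ^ l)) := by
      rw [Submodule.map_smul'', Submodule.map_top, Submodule.range_subtype, pow_add]; rfl
    obtain ⟨y, hy, hy2⟩ := h3.le h1
    have : y = w x := Subtype.ext hy2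
    rwa [← this]
  refine ext_restrict hs (ses_sub (Q ^ (l0 + l))) w LinearMap.id _ rfl rfl e' _ (ext_factor w _ hw2 e' hl0)

/-- killing a nonzerodivisor -/
lemma ez_reg (I J : Ideal R) (y : R) (hy : ∀ a, y * a ∈ I → a ∈ I) (hJ : J = I ⊔ Ideal.span {y})
    (B : ModuleCat.{0} R) (i : ℕ) (h0 : EZ (ModuleCat.of R (R ⧸ I)) B i)
    (h1 : EZ (ModuleCat.of R (R ⧸ I)) B (i+1)) : EZ (ModuleCat.of R (R ⧸ J)) B (i+1) := by
  have hIJ : I ≤ J := hJ ▸ le_sup_left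
  let f : (R ⧸ I) →ₗ[R] (R ⧸ I) := LinearMap.lsmul R (R ⧸ I) y
  let g : (R ⧸ I) →ₗ[R] (R ⧸ J) := Submodule.mapQ I J LinearMap.id hIJ
  have hf : Function.Injective f := by
    rw [← LinearMap.ker_eq_bot, LinearMap.ker_eq_bot']
    intro x hx
    obtain ⟨x, rfl⟩ := Submodule.Quotient.mk_surjective _ x
    have : (Submodule.Quotient.mk (y * x) : R ⧸ I) = 0 := hx
    rw [Submodule.Quotient.mk_eq_zero] at this ⊢
    exact hy _ this
  have hg : Function.Surjective g := by
    intro x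
    obtain ⟨x, rfl⟩ := Submodule.Quotient.mk_surjective _ x
    exact ⟨Submodule.Quotient.mk x, rfl⟩
  have hfg : Function.Exact f g := by
    intro x
    obtain ⟨x, rfl⟩ := Submodule.Quotient.mk_surjective _ x
    have h2 : g (Submodule.Quotient.mk x) = Submodule.Quotient.mk x := rfl
    rw [h2, Submodule.Quotient.mk_eq_zero, hJ, Submodule.mem_sup]
    constructor
    · rintro ⟨a, ha, b, hb, rfl⟩
      obtain ⟨c, rfl⟩ := Ideal.mem_span_singleton'.1 hb
      refine ⟨Submodule.Quotient.mk c, ?_⟩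
      have h3 : f (Submodule.Quotient.mk c) = Submodule.Quotient.mk (y * c) := rfl
      rw [h3, Submodule.Quotient.eq]
      have : y * c - (a + c * y) = - a := by ring
      rw [this]
      exact neg_mem ha
    · rintro ⟨z, hz⟩
      obtain ⟨c, rfl⟩ := Submodule.Quotient.mk_surjective _ z
      have h3 : f (Submodule.Quotient.mk c) = Submodule.Quotient.mk (y * c) := rfl
      rw [h3, Submodule.Quotient.eq] at hz
      exact ⟨-(y * c - x), neg_mem hz, c * y, Ideal.mem_span_singleton'.2 ⟨c, rfl⟩, by ring⟩
  exact ez_con₃ (ses_exact f g hfg hf hg) h0 h1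

end Devissage
end SeqCM


namespace SeqCM
noncomputable section Cd

open Abelian Abelian.Ext

variable (K : Type) [Field K] (m n : ℕ)

/-- `(y_1^k, …, y_j^k)` -/
def yI (k j : ℕ) : Ideal (BGS K m n) :=
  Ideal.span ((fun s => MvPolynomial.monomial s (1 : K)) ''
    {s | ∃ t : Fin n, t.1 < j ∧ s = Finsupp.single (Sum.inr t) k})

lemma yI_reg (k : ℕ) (j : Fin n) (a : BGS K m n)
    (h : (MvPolynomial.monomial (Finsupp.single (Sum.inr j) k) (1:K)) * a ∈ yI K m n k j.1) :
    a ∈ yI K m n k j.1 := by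
  unfold yI at *
  rw [MvPolynomial.mem_ideal_span_monomial_image] at *
  intro s hs
  obtain ⟨_, ⟨t, ht, rfl⟩, hle⟩ := h (Finsupp.single (Sum.inr j) k + s) (by
    rw [MvPolynomial.mem_support_iff, MvPolynomial.coeff_monomial_mul, one_mul]
    exact MvPolynomial.mem_support_iff.1 hs)
  refine ⟨_, ⟨t, ht, rfl⟩, ?_⟩
  rw [Finsupp.single_le_iff] at hle ⊢
  have : (Sum.inr j : Fin m ⊕ Fin n) ≠ Sum.inr t := by
    intro h; rw [Sum.inr.inj h] at ht; exact lt_irrefl _ ht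
  simpa [Finsupp.single_apply, this] using hle

lemma yI_succ (k : ℕ) (j : Fin n) : yI K m n k (j.1+1) =
    yI K m n k j.1 ⊔ Ideal.span {(MvPolynomial.monomial (Finsupp.single (Sum.inr j) k) (1:K))} := by
  unfold yI
  rw [← Ideal.span_union]
  congr 1
  ext x
  constructor
  · rintro ⟨_, ⟨t, ht, rfl⟩, rfl⟩
    rcases Nat.lt_succ_iff_lt_or_eq.1 ht with h | h
    · exact Or.inl ⟨_, ⟨t, h, rfl⟩, rfl⟩
    · right
      rw [Fin.ext h]; rfl
  · rintro (⟨_, ⟨t, ht, rfl⟩, rfl⟩ | h)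
    · exact ⟨_, ⟨t, by lia, rfl⟩, rfl⟩
    · exact ⟨_, ⟨j, by lia, rfl⟩, h.symm⟩

lemma yI_zero (k : ℕ) : yI K m n k 0 = ⊥ := by
  unfold yI; simp

lemma ez_yI (B : ModuleCat.{0} (BGS K m n)) (k j : ℕ) (hj : j ≤ n) (i : ℕ) (hi : j < i) :
    EZ (ModuleCat.of _ (BGS K m n ⧸ yI K m n k j)) B i := by
  induction j generalizing i with
  | zero =>
    obtain ⟨i, rfl⟩ : ∃ i', i = i' + 1 := ⟨i - 1, by lia⟩
    have : Projective (ModuleCat.of (BGS K m n) (BGS K m n)) :=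
      ModuleCat.projective_of_free (Module.Basis.singleton Unit _)
    rw [yI_zero]
    exact ez_iso₁ (Submodule.quotEquivOfEqBot (⊥ : Ideal (BGS K m n)) rfl).symm.toModuleIso ez_proj
  | succ j ih =>
    obtain ⟨i, rfl⟩ : ∃ i', i = i' + 1 := ⟨i - 1, by lia⟩
    exact ez_reg _ _ _ (yI_reg K m n k ⟨j, hj⟩) (yI_succ K m n k ⟨j, hj⟩) B i (ih (by lia) _ (by lia))
      (ih (by lia) _ (by lia))

lemma yI_le (k : ℕ) : yI K m n k n ≤ idealQ K m n ^ k := by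
  unfold yI
  rw [Ideal.span_le]
  rintro _ ⟨_, ⟨t, ht, rfl⟩, rfl⟩
  dsimp only
  have : (MvPolynomial.monomial (Finsupp.single (Sum.inr t : Fin m ⊕ Fin n) k) (1:K)) =
    (MvPolynomial.X (Sum.inr t)) ^ k := by
    rw [MvPolynomial.X_pow_eq_monomial]
  rw [this]
  have h2 : (MvPolynomial.X (Sum.inr t) : BGS K m n) ∈ idealQ K m n :=
    Ideal.subset_span (Set.mem_range_self t)
  exact Ideal.pow_mem_pow h2 k

lemma le_yI (k : ℕ) : ∃ N, idealQ K m n ^ N ≤ yI K m n k n := by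
  apply Ideal.exists_pow_le_of_le_radical_of_fg
  · unfold idealQ
    rw [Ideal.span_le]
    rintro _ ⟨t, rfl⟩
    refine ⟨k, ?_⟩
    dsimp only
    rw [MvPolynomial.X_pow_eq_monomial]
    exact Ideal.subset_span ⟨_, ⟨t, t.2, rfl⟩, rfl⟩
  · exact IsNoetherian.noetherian _

lemma hz_gt (X : ModuleCat.{0} (BGS K m n)) (i : ℕ) (hi : n < i) : HZ (idealQ K m n) i X := by
  intro l e
  obtain ⟨N, hN⟩ := le_yI K m n l
  have h1 : idealQ K m n ^ (N + l) ≤ yI K m n l n := (Ideal.pow_le_pow_right (by lia)).trans hN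
  refine ⟨N + l, by lia, ?_⟩
  rw [← trans_comp h1 (yI_le K m n l), ← mk₀_comp_mk₀_assoc,
    ez_yI K m n X l n le_rfl i hi ((mk₀ (trans (yI_le K m n l))).comp e (zero_add i)), Abelian.Ext.comp_zero]

end Cd

section Support
open Abelian Abelian.Ext
variable {R : Type} [CommRing R]

lemma exists_ne_zero_map [IsNoetherianRing R] (N : Type) [AddCommGroup N] [Module R N] [Module.Finite R N]
    (p : Ideal R) [p.IsPrime] (hp : Module.annihilator R N ≤ p) :
    ∃ φ : N →ₗ[R] (R ⧸ p), φ ≠ 0 := by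
  have h1 : (⟨p, inferInstance⟩ : PrimeSpectrum R) ∈ Module.support R N := by
    rw [Module.mem_support_iff_of_finite]
    exact hp
  rw [Module.mem_support_iff_nontrivial_residueField_tensorProduct] at h1
  change Nontrivial (TensorProduct R p.ResidueField N) at h1
  obtain ⟨z, hz⟩ := exists_ne (0 : TensorProduct R p.ResidueField N)
  obtain ⟨f, hf⟩ : ∃ f : TensorProduct R p.ResidueField N →ₗ[p.ResidueField] p.ResidueField, f z ≠ 0 := by
    by_contra hcon
    push Not at hcon
    exact hz ((Module.forall_dual_apply_eq_zero_iff p.ResidueField z).1 hcon)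
  let ψ : N →ₗ[R] p.ResidueField := (f.restrictScalars R).comp (TensorProduct.mk R p.ResidueField N 1)
  have hψ : ∃ x, ψ x ≠ 0 := by
    by_contra hcon
    push Not at hcon
    apply hf
    induction z using TensorProduct.induction_on with
    | zero => simp
    | tmul a b =>
      have : a ⊗ₜ[R] b = a • ((1 : p.ResidueField) ⊗ₜ[R] b) := by
        rw [TensorProduct.smul_tmul', smul_eq_mul, mul_one]
      rw [this, map_smul]
      have h3 : f (1 ⊗ₜ[R] b) = 0 := hcon b
      rw [h3, smul_zero]
    | add a b ha hb =>
      by_cases h4 : f a = 0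
      · by_cases h5 : f b = 0
        · rw [map_add, h4, h5, add_zero]
        · exact absurd (hb (fun h => h5 (by rw [h, map_zero])) h5) h5
      · exact absurd (ha (fun h => h4 (by rw [h, map_zero])) h4) h4
  obtain ⟨G, hG⟩ := (Module.Finite.fg_top : (⊤ : Submodule R N).FG)
  classical
  obtain ⟨b, hb⟩ := IsLocalization.exist_integer_multiples_of_finset (nonZeroDivisors (R ⧸ p)) (G.image ψ)
  obtain ⟨b, hb0⟩ := b
  obtain ⟨s, rfl⟩ := Ideal.Quotient.mk_surjective b
  let ι : (R ⧸ p) →ₗ[R] p.ResidueField := (IsScalarTower.toAlgHom R (R ⧸ p) p.ResidueField).toLinearMap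
  have hι : Function.Injective ι := IsFractionRing.injective (R ⧸ p) p.ResidueField
  have hsm : ∀ x : p.ResidueField, (Ideal.Quotient.mk p s) • x = s • x := fun x => by
    rw [Algebra.smul_def, Algebra.smul_def, IsScalarTower.algebraMap_apply R (R ⧸ p) p.ResidueField]; rfl
  have hr : ∀ x, (s • ψ) x ∈ LinearMap.range ι := by
    intro x
    have : (⊤ : Submodule R N) ≤ (LinearMap.range ι).comap (s • ψ) := by
      rw [← hG, Submodule.span_le]
      intro y hy
      obtain ⟨c, hc⟩ := hb (ψ y) (Finset.mem_image_of_mem _ hy)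
      exact ⟨c, by rw [LinearMap.smul_apply, ← hsm]; exact hc⟩
    exact this trivial
  refine ⟨(LinearEquiv.ofInjective ι hι).symm.toLinearMap.comp ((s • ψ).codRestrict _ hr), ?_⟩
  intro h0
  obtain ⟨x, hx⟩ := hψ
  have h6 := LinearMap.congr_fun h0 x
  simp only [LinearMap.comp_apply, LinearMap.zero_apply, LinearEquiv.coe_coe, LinearEquiv.map_eq_zero_iff] at h6
  have h7 : s • ψ x = 0 := congrArg Subtype.val h6
  rw [← hsm, Algebra.smul_def, mul_eq_zero] at h7
  rcases h7 with h7 | h7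
  · exact nonZeroDivisors.ne_zero hb0 (hι (h7.trans (map_zero ι).symm))
  · exact hx h7

/-- (2) -/
lemma hz_ann [IsNoetherianRing R] (Q : Ideal R) (n c : ℕ)
    (hn : ∀ X : ModuleCat.{0} R, ∀ i, n < i → HZ Q i X)
    (N : Type) [AddCommGroup N] [Module R N] [Module.Finite R N]
    (hN : ∀ i, c < i → HZ Q i (ModuleCat.of R N)) (i : ℕ) (hi : c < i)
    (L : Type) [AddCommGroup L] [Module R L] [Module.Finite R L]
    (hL : Module.annihilator R N ≤ Module.annihilator R L) : HZ Q i (ModuleCat.of R L) := by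
  by_cases hin : n < i
  · exact hn _ _ hin
  have ih : ∀ (L : Type) [AddCommGroup L] [Module R L] [Module.Finite R L]
    (_ : Module.annihilator R N ≤ Module.annihilator R L), HZ Q (i+1) (ModuleCat.of R L) := by
    intro L _ _ _ hL
    exact hz_ann Q n c hn N hN (i+1) (by lia) L hL
  have dev : ∀ I : Ideal R, (∀ p : Ideal R, p.IsPrime → I ≤ p → HZ Q i (ModuleCat.of R (R ⧸ p))) →
    ∀ (L : Type) [AddCommGroup L] [Module R L] [Module.Finite R L]
    (_ : I ≤ Module.annihilator R L), HZ Q i (ModuleCat.of R L) := by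
    intro I hI L _ _ _ hL
    exact devissage I (HZ Q i) (fun _ h => hz_zero h) (fun _ _ f h => hz_iso f h)
      (fun S hS h1 h3 => hz₂ hS h1 h3) hI L hL
  refine dev _ ?_ L hL
  intro p
  induction p using IsWellFounded.induction (α := Ideal R) (· > ·) with
  | _ p ihp =>
    intro hp hNp
    obtain ⟨φ, hφ⟩ := exists_ne_zero_map N p hNp
    have hQ : HZ Q i (ModuleCat.of R ((R ⧸ p) ⧸ φ.range)) := by
      let J : Ideal R := φ.range.comap (Submodule.mkQ p)
      refine dev J ?_ _ ?_
      · intro q hq hJ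
        have hpJ : p < J := by
          refine lt_of_le_of_ne ?_ ?_
          · intro x hx
            change Submodule.mkQ p x ∈ φ.range
            have : Submodule.mkQ p x = 0 := by simpa using Ideal.Quotient.eq_zero_iff_mem.2 hx
            rw [this]; exact zero_mem _
          · intro h
            apply hφ
            ext x
            obtain ⟨y, hy⟩ := Submodule.mkQ_surjective p (φ x)
            have : y ∈ J := ⟨x, hy.symm⟩
            rw [← h] at this
            rw [← hy]
            simpa using Ideal.Quotient.eq_zero_iff_mem.2 this
        exact ihp q (lt_of_lt_of_le hpJ hJ) hq (hNp.trans (hpJ.le.trans hJ))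
      · intro r hr
        rw [Module.mem_annihilator]
        intro z
        obtain ⟨z, rfl⟩ := Submodule.mkQ_surjective _ z
        obtain ⟨z, rfl⟩ := Submodule.mkQ_surjective _ z
        rw [← map_smul, ← map_smul, Submodule.mkQ_apply, Submodule.Quotient.mk_eq_zero]
        have : r • z = z * r := mul_comm _ _
        rw [this]
        exact J.mul_mem_left z hr
    have hIm : HZ Q i (ModuleCat.of R φ.range) := by
      refine hz₃ (ses_ker φ.rangeRestrict φ.surjective_rangeRestrict) (ih _ ?_) (hN _ hi)
      exact LinearMap.annihilator_le_of_injective (Submodule.subtype _) (Submodule.injective_subtype _)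
    exact hz₂ (ses_sub φ.range) hIm hQ
termination_by n + 1 - i

end Support
end SeqCM


namespace SeqCM
noncomputable section Chase

open Abelian Abelian.Ext

variable {R : Type} [CommRing R]

lemma hzm_step {A B C A' B' C' W W' : Type} [AddCommGroup A] [AddCommGroup B] [AddCommGroup C]
    [AddCommGroup A'] [AddCommGroup B'] [AddCommGroup C'] [AddCommGroup W] [AddCommGroup W']
    [Module R A] [Module R B] [Module R C] [Module R A'] [Module R B'] [Module R C']
    [Module R W] [Module R W'] (Q : Ideal R) (i : ℕ)
    {a : A →ₗ[R] B} {b : B →ₗ[R] C} {ex : Function.Exact a b} (hS : (ses a b ex).ShortExact)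
    {a' : A' →ₗ[R] B'} {b' : B' →ₗ[R] C'} {ex' : Function.Exact a' b'} (hS' : (ses a' b' ex').ShortExact)
    (α : A →ₗ[R] A') (β : B →ₗ[R] B') (γ : C →ₗ[R] C') (h1 : a' ∘ₗ α = β ∘ₗ a) (h2 : b' ∘ₗ β = γ ∘ₗ b)
    (u : W →ₗ[R] A) (u' : W' →ₗ[R] A') (w : W →ₗ[R] W') (h3 : u' ∘ₗ w = α ∘ₗ u)
    (hu : Function.Surjective u) (hk : HZ Q (i+1+1) (ModuleCat.of R u.ker))
    (hw : HZm Q (i+1) (ModuleCat.ofHom w))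
    (hB : ∀ l, EZ (ModuleCat.of R (R ⧸ Q ^ l)) (ModuleCat.of R B') i) :
    HZm Q i (ModuleCat.ofHom γ) := by
  let φ : ses a b ex ⟶ ses a' b' ex' :=
    { τ₁ := ModuleCat.ofHom α
      τ₂ := ModuleCat.ofHom β
      τ₃ := ModuleCat.ofHom γ
      comm₁₂ := by
        dsimp
        rw [← ModuleCat.ofHom_comp, ← ModuleCat.ofHom_comp, h1]
      comm₂₃ := by
        dsimp
        rw [← ModuleCat.ofHom_comp, ← ModuleCat.ofHom_comp, h2] }
  have nat := ShortComplex.ShortExact.extClass_naturality hS hS' φ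
  intro l e
  let d := e.comp hS.extClass rfl
  obtain ⟨l', hl, e', he'⟩ := dz_exact₃ (ses_ker u hu) d (hk _ _)
  have key : DZ (d.comp (mk₀ (ModuleCat.ofHom α)) (add_zero (i+1))) := by
    refine DZ.of_pb hl ?_
    rw [pb_comp, he']
    have := (hw _ e').comp (mk₀ (ModuleCat.ofHom u')) (add_zero (i+1))
    rw [comp_assoc_of_second_deg_zero, mk₀_comp_mk₀, ← ModuleCat.ofHom_comp, h3,
      ModuleCat.ofHom_comp, ← mk₀_comp_mk₀, ← comp_assoc_of_second_deg_zero] at this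
    exact this
  have key2 : DZ ((e.comp (mk₀ (ModuleCat.ofHom γ)) (add_zero i)).comp hS'.extClass rfl) := by
    rw [comp_assoc_of_second_deg_zero]
    have h4 : (mk₀ (ModuleCat.ofHom γ)).comp hS'.extClass (zero_add 1) =
      hS.extClass.comp (mk₀ (ModuleCat.ofHom α)) (add_zero 1) := nat.symm
    rw [h4]
    have h5 : d.comp (mk₀ (ModuleCat.ofHom α)) (add_zero (i+1)) =
      e.comp (hS.extClass.comp (mk₀ (ModuleCat.ofHom α)) (add_zero 1)) rfl :=
      comp_assoc_of_third_deg_zero _ _ _ _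
    rw [← h5]
    exact key
  obtain ⟨l'', hl', e'', he''⟩ := dz_exact₃ hS' _ key2
  refine ⟨l'', hl', ?_⟩
  have h6 : e'' = 0 := hB l'' e''
  refine he''.trans ?_
  rw [h6, Abelian.Ext.zero_comp]

lemma ez_free_tensor (M : Type) [AddCommGroup M] [Module R M] (A : ModuleCat.{0} R) (i r : ℕ)
    (h : EZ A (ModuleCat.of R M) i) : EZ A (ModuleCat.of R (TensorProduct R (Fin r → R) M)) i := by
  intro e
  let p (j : Fin r) : TensorProduct R (Fin r → R) M →ₗ[R] M :=
    (TensorProduct.lid R M).toLinearMap ∘ₗ (LinearMap.proj j : (Fin r → R) →ₗ[R] R).rTensor M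
  let s (j : Fin r) : M →ₗ[R] TensorProduct R (Fin r → R) M :=
    TensorProduct.mk R (Fin r → R) M (Pi.single j 1)
  have hid : 𝟙 (ModuleCat.of R (TensorProduct R (Fin r → R) M)) =
      ∑ j, ModuleCat.ofHom (p j) ≫ ModuleCat.ofHom (s j) := by
    apply ModuleCat.hom_ext
    rw [ModuleCat.hom_sum]
    refine TensorProduct.ext' fun v x => ?_
    simp only [ModuleCat.hom_comp, ModuleCat.hom_ofHom, LinearMap.sum_apply, LinearMap.comp_apply, p, s,
      LinearMap.rTensor_tmul, LinearEquiv.coe_coe, TensorProduct.lid_tmul, TensorProduct.mk_apply,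
      TensorProduct.tmul_smul, LinearMap.proj_apply, ModuleCat.hom_id, LinearMap.id_apply]
    simp only [TensorProduct.smul_tmul', ← TensorProduct.sum_tmul]
    congr 1
    ext j
    simp [Finset.sum_apply, Pi.single_apply]
  have h1 : e = e.comp (mk₀ (𝟙 (ModuleCat.of R (TensorProduct R (Fin r → R) M)))) (add_zero i) := by simp
  rw [h1, hid, Ext.mk₀_sum, Ext.comp_sum]
  refine Finset.sum_eq_zero fun j _ => ?_
  rw [← mk₀_comp_mk₀, ← comp_assoc_of_second_deg_zero,
    h (e.comp (mk₀ (ModuleCat.ofHom (p j))) (add_zero i)), Abelian.Ext.zero_comp]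

/-- multiplication by elements of `Q^k` factors through a finite free module -/
def FP (Q : Ideal R) (k : ℕ) (T : Type) [AddCommGroup T] [Module R T] : Prop :=
  ∀ q ∈ Q ^ k, ∃ (r : ℕ) (a : T →ₗ[R] (Fin r → R)) (b : (Fin r → R) →ₗ[R] T), ∀ x, b (a x) = q • x

lemma fp_ker (Q : Ideal R) (k : ℕ) (T : Type) [AddCommGroup T] [Module R T] (h : FP Q k T) (r : ℕ)
    (π : (Fin r → R) →ₗ[R] T) (hπ : Function.Surjective π) (q : R) (hq : q ∈ Q ^ k) :
    ∃ b : (Fin r → R) →ₗ[R] π.ker, ∀ x : π.ker, b x = q • x := by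
  obtain ⟨r', a, b, hab⟩ := h q hq
  obtain ⟨b', hb'⟩ := Module.projective_lifting_property π b hπ
  have hm : ∀ x, ((q • LinearMap.id - b' ∘ₗ a ∘ₗ π : (Fin r → R) →ₗ[R] (Fin r → R))) x ∈ π.ker := by
    intro x
    have : π (b' (a (π x))) = b (a (π x)) := LinearMap.congr_fun hb' (a (π x))
    simp [this, hab]
  refine ⟨(q • LinearMap.id - b' ∘ₗ a ∘ₗ π).codRestrict π.ker hm, fun x => ?_⟩
  apply Subtype.ext
  simp

lemma hzm_tensor [IsNoetherianRing R] (Q : Ideal R) (i r k : ℕ)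
    (X M T T' : Type) [AddCommGroup X] [Module R X] [AddCommGroup M] [Module R M]
    [AddCommGroup T] [Module R T] [AddCommGroup T'] [Module R T'] (f : X →ₗ[R] M)
    (ι : T' →ₗ[R] (Fin r → R)) (π : (Fin r → R) →ₗ[R] T) (hex : Function.Exact ι π)
    (hπ : Function.Surjective π)
    (hFP : ∀ q ∈ Q ^ k, ∃ b : (Fin r → R) →ₗ[R] T', ∀ x, b (ι x) = q • x)
    (hW : HZm Q (i+1) (ModuleCat.ofHom (f.lTensor T')))
    (hB : ∀ l, EZ (ModuleCat.of R (R ⧸ Q ^ l)) (ModuleCat.of R (TensorProduct R (Fin r → R) M)) i) :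
    HZm Q i (ModuleCat.ofHom (f.lTensor T)) := by
  have cX : ∀ z, ι.rTensor X z ∈ (π.rTensor X).ker := fun z =>
    (rTensor_exact X hex hπ).apply_apply_eq_zero z
  have cM : ∀ z, ι.rTensor M z ∈ (π.rTensor M).ker := fun z =>
    (rTensor_exact M hex hπ).apply_apply_eq_zero z
  have comm : ∀ z, π.rTensor M (f.lTensor (Fin r → R) z) = f.lTensor T (π.rTensor X z) := fun z =>
    (LinearMap.congr_fun (LinearMap.rTensor_comp_lTensor _ π f) z).trans
      (LinearMap.congr_fun (LinearMap.lTensor_comp_rTensor _ π f) z).symm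
  refine hzm_step Q i (ses_ker (π.rTensor X) (LinearMap.rTensor_surjective X hπ))
    (ses_ker (π.rTensor M) (LinearMap.rTensor_surjective M hπ))
    (((f.lTensor (Fin r → R)) ∘ₗ (π.rTensor X).ker.subtype).codRestrict _ ?_)
    (f.lTensor _) (f.lTensor T) rfl (LinearMap.ext comm)
    ((ι.rTensor X).codRestrict _ cX) ((ι.rTensor M).codRestrict _ cM) (f.lTensor T')
    ?_ ?_ ?_ hW hB
  · intro z
    have : π.rTensor X z.1 = 0 := z.2
    change π.rTensor M (f.lTensor _ z.1) = 0
    rw [comm, this, map_zero]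
  · refine LinearMap.ext fun z => Subtype.ext ?_
    exact (LinearMap.congr_fun (LinearMap.rTensor_comp_lTensor _ ι f) z).trans
      (LinearMap.congr_fun (LinearMap.lTensor_comp_rTensor _ ι f) z).symm
  · rintro ⟨z, hz⟩
    obtain ⟨y, hy⟩ := (rTensor_exact X hex hπ z).1 hz
    exact ⟨y, Subtype.ext hy⟩
  · refine hz_of_ann Q _ k ?_ (i+1)
    intro q hq
    rw [Module.mem_annihilator]
    rintro ⟨z, hz⟩
    obtain ⟨b, hb⟩ := hFP q hq
    have hz' : ι.rTensor X z = 0 := congrArg Subtype.val hz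
    apply Subtype.ext
    change q • z = 0
    have h1 : b.rTensor X (ι.rTensor X z) = q • z := by
      rw [← LinearMap.comp_apply, ← LinearMap.rTensor_comp]
      have : b ∘ₗ ι = q • LinearMap.id := LinearMap.ext hb
      rw [this, LinearMap.rTensor_smul, LinearMap.rTensor_id]
      rfl
    rw [← h1, hz', map_zero]

lemma hzm_all [IsNoetherianRing R] (Q : Ideal R) (c : ℕ)
    (X M : Type) [AddCommGroup X] [Module R X] [Module.Finite R X] [AddCommGroup M] [Module R M]
    (f : X →ₗ[R] M)
    (hM : ∀ i ≤ c, EZ (ModuleCat.of R (R ⧸ Q)) (ModuleCat.of R M) i)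
    (hX : ∀ (L : Type) [AddCommGroup L] [Module R L] [Module.Finite R L],
      Module.annihilator R X ≤ Module.annihilator R L → HZ Q (c+1) (ModuleCat.of R L))
    (j i : ℕ) (hij : i + j = c + 1) (T : Type) [AddCommGroup T] [Module R T] [Module.Finite R T]
    (k : ℕ) (hT : FP Q k T) : HZm Q i (ModuleCat.ofHom (f.lTensor T)) := by
  induction j generalizing i T with
  | zero =>
    have : i = c + 1 := hij
    subst this
    intro l e
    refine DZ.comp (hX (TensorProduct R T X) ?_ l e) _ _
    intro r hr
    rw [Module.mem_annihilator] at hr ⊢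
    intro z
    induction z using TensorProduct.induction_on with
    | zero => simp
    | tmul t x => rw [← TensorProduct.tmul_smul, hr, TensorProduct.tmul_zero]
    | add z w hz hw => rw [smul_add, hz, hw, add_zero]
  | succ j ih =>
    obtain ⟨r, π, hπ⟩ := Module.Finite.exists_fin' R T
    let ι : π.ker →ₗ[R] (Fin r → R) := π.ker.subtype
    have hFP : FP Q k π.ker := fun q hq => by
      obtain ⟨b, hb⟩ := fp_ker Q k T hT r π hπ q hq
      exact ⟨r, ι, b, hb⟩
    refine hzm_tensor Q i r k X M T π.ker f ι π (LinearMap.exact_subtype_ker_map π) hπ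
      (fun q hq => fp_ker Q k T hT r π hπ q hq) (ih (i+1) (by lia) π.ker hFP) ?_
    intro l
    refine ez_free_tensor M _ i r ?_
    refine ez_of_pow Q _ (c+1) (fun i hi => hM i (by lia)) i (by lia) l _ ?_
    rw [Ideal.annihilator_quotient]

/-- (3), algebraic part -/
lemma mem_pow_smul [IsNoetherianRing R] (Q : Ideal R) (c : ℕ)
    (X M : Type) [AddCommGroup X] [Module R X] [Module.Finite R X] [AddCommGroup M] [Module R M]
    (f : X →ₗ[R] M)
    (hM : ∀ i ≤ c, EZ (ModuleCat.of R (R ⧸ Q)) (ModuleCat.of R M) i)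
    (hX : ∀ (L : Type) [AddCommGroup L] [Module R L] [Module.Finite R L],
      Module.annihilator R X ≤ Module.annihilator R L → HZ Q (c+1) (ModuleCat.of R L))
    (k : ℕ) (x : X) : f x ∈ (Q ^ k • ⊤ : Submodule R M) := by
  have h0 := hzm_all Q c X M f hM hX (c+1) 0 (by lia) (R ⧸ Q ^ k) k (by
    intro q hq
    refine ⟨0, 0, 0, fun x => ?_⟩
    have : q ∈ Module.annihilator R (R ⧸ Q ^ k) := by rwa [Ideal.annihilator_quotient]
    rw [Module.mem_annihilator.1 this]
    rfl)
  let v : (R ⧸ Q ^ k) →ₗ[R] TensorProduct R (R ⧸ Q ^ k) X := (TensorProduct.mk R (R ⧸ Q ^ k) X).flip x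
  obtain ⟨l, hl, hz⟩ := h0 k (mk₀ (ModuleCat.ofHom v))
  rw [mk₀_comp_mk₀] at hz
  unfold pb at hz
  rw [mk₀_comp_mk₀, mk₀_eq_zero_iff] at hz
  rw [← LinearMap.ker_tensorProductMk (R := R) (Q := M) (I := Q ^ k), LinearMap.mem_ker]
  have := congrArg (fun g => g.hom (Submodule.Quotient.mk (1:R))) hz
  exact this

end Chase
end SeqCM


namespace SeqCM
noncomputable section Grading

variable (K : Type) [Field K] (m n : ℕ) (M : Type) [AddCommGroup M] [Module (BGS K m n) M]
  (ℳ : ℕ × ℕ → AddSubgroup M)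

/-- elements whose components live in `y`-degree at least `k` -/
def gU (ℳ : ℕ × ℕ → AddSubgroup M) (k : ℕ) : AddSubgroup M := ⨆ d : {d : ℕ × ℕ // k ≤ d.2}, ℳ d.1

lemma gU_mem (k : ℕ) (d : ℕ × ℕ) (hd : k ≤ d.2) (x : M) (hx : x ∈ ℳ d) : x ∈ gU M ℳ k :=
  AddSubgroup.mem_iSup_of_mem (S := fun d : {d : ℕ × ℕ // k ≤ d.2} => ℳ d.1) ⟨d, hd⟩ hx

variable {ℳ}
lemma gU_smul (hM : IsBigrading K m n M ℳ) (k : ℕ) (s : BGS K m n) (x : M) (hx : x ∈ gU M ℳ k) : s • x ∈ gU M ℳ k := by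
  refine AddSubgroup.iSup_induction (fun d : {d : ℕ × ℕ // k ≤ d.2} => ℳ d.1)
    (C := fun x => s • x ∈ gU M ℳ k) hx ?_ ?_ ?_
  · rintro ⟨d, hd⟩ x hx
    induction s using MvPolynomial.induction_on' with
    | monomial u a =>
      exact gU_mem M ℳ k _ (by simp only [Prod.snd_add]; lia) _ (hM.smul_mem _ d _ x
        (MvPolynomial.isWeightedHomogeneous_monomial (bwt m n) u a rfl) hx)
    | add p q hp hq => rw [add_smul]; exact add_mem hp hq
  · rw [smul_zero]; exact zero_mem _
  · intro x y hx hy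
    rw [smul_add]; exact add_mem hx hy

lemma gU_X (hM : IsBigrading K m n M ℳ) (k : ℕ) (j : Fin n) (x : M) (hx : x ∈ gU M ℳ k) :
    (MvPolynomial.X (Sum.inr j) : BGS K m n) • x ∈ gU M ℳ (k+1) := by
  refine AddSubgroup.iSup_induction (fun d : {d : ℕ × ℕ // k ≤ d.2} => ℳ d.1)
    (C := fun x => (MvPolynomial.X (Sum.inr j) : BGS K m n) • x ∈ gU M ℳ (k+1)) hx ?_ ?_ ?_
  · rintro ⟨d, hd⟩ x hx
    refine gU_mem M ℳ (k+1) _ ?_ _ (hM.smul_mem _ d _ x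
        (MvPolynomial.isWeightedHomogeneous_X K (bwt m n) (Sum.inr j)) hx)
    simp only [Prod.snd_add, bwt, Sum.elim_inr]
    lia
  · rw [smul_zero]; exact zero_mem _
  · intro x y hx hy
    rw [smul_add]; exact add_mem hx hy

lemma pow_le_gU (hM : IsBigrading K m n M ℳ) (k : ℕ) (x : M) (hx : x ∈ (idealQ K m n ^ k • ⊤ : Submodule (BGS K m n) M)) :
    x ∈ gU M ℳ k := by
  let V (k : ℕ) : Submodule (BGS K m n) M :=
    { gU M ℳ k with smul_mem' := fun s x hx => gU_smul K m n M hM k s x hx }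
  suffices h : (idealQ K m n ^ k • ⊤ : Submodule (BGS K m n) M) ≤ V k from h hx
  clear hx
  induction k with
  | zero =>
    intro x hx0
    clear hx0
    obtain ⟨z, rfl⟩ := hM.internal.2 x
    induction z using DirectSum.induction_on with
    | zero => rw [map_zero]; exact zero_mem _
    | of d y =>
      rw [DirectSum.coeAddMonoidHom_of]
      exact gU_mem M ℳ 0 d (Nat.zero_le _) _ y.2
    | add y z hy hz =>
      rw [map_add]
      exact add_mem hy hz
  | succ k ih =>
    rw [pow_succ', Submodule.mul_smul, Submodule.smul_le]
    intro q hq x hx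
    have hx' : x ∈ V k := ih hx
    unfold idealQ at hq
    induction hq using Submodule.span_induction with
    | mem q h =>
      obtain ⟨j, rfl⟩ := h
      exact gU_X K m n M hM k j x hx'
    | zero => rw [zero_smul]; exact zero_mem _
    | add a b _ _ ha hb => rw [add_smul]; exact add_mem ha hb
    | smul a b _ hb => rw [smul_assoc]; exact (V (k+1)).smul_mem a hb

lemma separated (hM : IsBigrading K m n M ℳ) (x : M) (hx : ∀ k, x ∈ (idealQ K m n ^ k • ⊤ : Submodule (BGS K m n) M)) : x = 0 := by
  classical
  let _ := hM.internal.chooseDecomposition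
  have h1 : ∀ d, (DirectSum.decompose ℳ x d : M) = 0 := by
    intro d
    have h2 := pow_le_gU K m n M hM (d.2+1) x (hx _)
    refine AddSubgroup.iSup_induction (fun d' : {d' : ℕ × ℕ // d.2 + 1 ≤ d'.2} => ℳ d'.1)
      (C := fun x => (DirectSum.decompose ℳ x d : M) = 0) h2 ?_ ?_ ?_
    · rintro ⟨d', hd'⟩ y hy
      refine DirectSum.decompose_of_mem_ne ℳ hy ?_
      intro heq
      have h4 : d' = d := heq
      rw [h4] at hd'
      exact absurd hd' (by simp)
    · simp
    · intro y z hy hz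
      rw [DirectSum.decompose_add, DirectSum.add_apply, AddSubgroup.coe_add, hy, hz, add_zero]
  have h3 : DirectSum.decompose ℳ x = 0 := by
    ext d
    rw [h1]; rfl
  exact (DirectSum.decompose ℳ).injective (h3.trans (DirectSum.decompose_zero ℳ).symm)

end Grading

section Final

variable {K : Type} [Field K] {m n : ℕ}

lemma mem_ext_set {R : Type} [CommRing R] (J : Ideal R) (M : Type) [AddCommGroup M] [Module R M] (i : ℕ) :
    Nontrivial (((_root_.Ext R (ModuleCat R) i).obj (Opposite.op (ModuleCat.of R (R ⧸ J)))).obj (ModuleCat.of R M))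
      ↔ ¬ EZ (ModuleCat.of R (R ⧸ J)) (ModuleCat.of R M) i := by
  rw [old_ext_nontrivial]
  unfold EZ
  push Not
  rfl

lemma ez_lt_grade {R : Type} [CommRing R] (J : Ideal R) (M : Type) [AddCommGroup M] [Module R M] (i : ℕ)
    (hi : i < extGrade R J M) : EZ (ModuleCat.of R (R ⧸ J)) (ModuleCat.of R M) i := by
  have := Nat.notMem_of_lt_sInf hi
  rw [Set.mem_ofPred_eq, mem_ext_set, not_not] at this
  exact this

lemma grade_le {R : Type} [CommRing R] (J : Ideal R) (M : Type) [AddCommGroup M] [Module R M] (i : ℕ)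
    (hi : ¬ EZ (ModuleCat.of R (R ⧸ J)) (ModuleCat.of R M) i) : extGrade R J M ≤ i :=
  Nat.sInf_le ((mem_ext_set J M i).2 hi)

lemma le_grade {R : Type} [CommRing R] (J : Ideal R) (M : Type) [AddCommGroup M] [Module R M] (q i : ℕ)
    (hi : ¬ EZ (ModuleCat.of R (R ⧸ J)) (ModuleCat.of R M) i)
    (h : ∀ j < q, EZ (ModuleCat.of R (R ⧸ J)) (ModuleCat.of R M) j) : q ≤ extGrade R J M := by
  refine le_csInf ⟨i, (mem_ext_set J M i).2 hi⟩ ?_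
  intro b hb
  by_contra hlt
  exact (mem_ext_set J M b).1 hb (h b (by lia))

lemma hz_gt_cd (M : Type) [AddCommGroup M] [Module (BGS K m n) M] (i : ℕ)
    (hi : cohDim (BGS K m n) (idealQ K m n) M < i) : HZ (idealQ K m n) i (ModuleCat.of (BGS K m n) M) := by
  rw [← localCohomology_subsingleton]
  intro h
  have hbd : BddAbove {i : ℕ | Nontrivial ((localCohomology (idealQ K m n) i).obj
      (ModuleCat.of (BGS K m n) M))} := by
    refine ⟨n, fun j hj => ?_⟩
    by_contra hlt
    exact (localCohomology_subsingleton _ _ _).2 (hz_gt K m n _ j (by lia)) hj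
  have h2 : i ≤ cohDim (BGS K m n) (idealQ K m n) M := le_csSup hbd h
  lia

lemma cd_le (M : Type) [AddCommGroup M] [Module (BGS K m n) M] (q : ℕ)
    (h : ∀ i, q < i → HZ (idealQ K m n) i (ModuleCat.of (BGS K m n) M)) :
    cohDim (BGS K m n) (idealQ K m n) M ≤ q := by
  refine csSup_le' fun j hj => ?_
  by_contra hlt
  exact (localCohomology_subsingleton _ _ _).2 (h j (by lia)) hj

lemma ass_ext (M : Type) [AddCommGroup M] [Module (BGS K m n) M]
    (ℳ : ℕ × ℕ → AddSubgroup M) (hM : IsBigrading K m n M ℳ) (p : Ideal (BGS K m n))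
    (hp : p ∈ associatedPrimes (BGS K m n) M) :
    ∃ i ≤ cohDim (BGS K m n) (idealQ K m n) (BGS K m n ⧸ p),
      ¬ EZ (ModuleCat.of _ (BGS K m n ⧸ idealQ K m n)) (ModuleCat.of (BGS K m n) M) i := by
  by_contra! hcon
  obtain ⟨hpp, f, hf⟩ := (isAssociatedPrime_iff_exists_injective_linearMap _ _).1 hp
  have h0 : f 1 = 0 := by
    refine separated K m n M hM _ fun k => ?_
    refine mem_pow_smul (idealQ K m n) _ (BGS K m n ⧸ p) M f hcon ?_ k 1
    intro L _ _ _ hL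
    exact hz_ann (idealQ K m n) n _ (fun X i hi => hz_gt K m n X i hi) (BGS K m n ⧸ p)
      (fun i hi => hz_gt_cd _ i hi) _ (Nat.lt_succ_self _) L hL
  have h1 : (1 : BGS K m n ⧸ p) = 0 := hf (h0.trans (map_zero f).symm)
  have := Ideal.Quotient.nontrivial_iff.2 hpp.ne_top
  exact one_ne_zero h1

lemma cd_le_ass (N : Type) [AddCommGroup N] [Module (BGS K m n) N] [Module.Finite (BGS K m n) N]
    (q : ℕ) (hN : ∀ i, q < i → HZ (idealQ K m n) i (ModuleCat.of (BGS K m n) N)) (p : Ideal (BGS K m n))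
    (hp : p ∈ associatedPrimes (BGS K m n) N) :
    cohDim (BGS K m n) (idealQ K m n) (BGS K m n ⧸ p) ≤ q := by
  refine cd_le _ q fun i hi => ?_
  refine hz_ann (idealQ K m n) n q (fun X i hi => hz_gt K m n X i hi) N hN i hi _ ?_
  rw [Ideal.annihilator_quotient]
  rw [← Submodule.annihilator_top]
  exact IsAssociatedPrime.annihilator_le hp

lemma ez_zero₂ {R : Type} [CommRing R] {A B : ModuleCat.{0} R} (h : IsZero B) (i : ℕ) : EZ A B i := by
  intro e
  have : e = e.comp (Abelian.Ext.mk₀ (𝟙 B)) (add_zero i) := by simp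
  rw [this, h.eq_of_src (𝟙 B) 0]
  simp

theorem main (M : Type) [AddCommGroup M] [Module (BGS K m n) M]
    [Module.Finite (BGS K m n) M] (ℳ : ℕ × ℕ → AddSubgroup M) (hM : IsBigrading K m n M ℳ)
    (h : IsSeqCMWrtQ K m n M ℳ) : HasMaximalDepth (BGS K m n) (idealQ K m n) M := by
  obtain ⟨r, F, hmono, h0, htop, -, hCM, hinc⟩ := h
  unfold HasMaximalDepth
  rcases r with _ | r
  · have hbt : (⊥ : Submodule (BGS K m n) M) = ⊤ := h0.symm.trans htop
    have hsub : Subsingleton M := (Submodule.subsingleton_iff _).1 (subsingleton_of_bot_eq_top hbt)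
    have e1 : extGrade (BGS K m n) (idealQ K m n) M = 0 := by
      unfold extGrade
      convert Nat.sInf_empty
      rw [Set.eq_empty_iff_forall_notMem]
      intro i hi
      exact (mem_ext_set _ M i).1 hi (ez_zero₂ (isZero_of_subsingleton M) i)
    have e2 : mCohDim (BGS K m n) (idealQ K m n) M = 0 := by
      unfold mCohDim
      rw [associatedPrimes.eq_empty_of_subsingleton, Set.image_empty, Nat.sInf_empty]
    rw [e1, e2]
  have hlt : ∀ j : Fin (r+1), F j.castSucc ≤ F j.succ := fun j => (hmono (Fin.castSucc_lt_succ)).le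
  obtain ⟨q, hq⟩ : ∃ q, q = cohDim (BGS K m n) (idealQ K m n)
    (↥(F (Fin.succ 0)) ⧸ (Submodule.comap (F (Fin.succ 0)).subtype (F (Fin.castSucc (0 : Fin (r+1)))))) := ⟨_, rfl⟩
  have hbot : Submodule.comap (F (Fin.succ 0)).subtype (F (Fin.castSucc (0 : Fin (r+1)))) = ⊥ := by
    rw [Fin.castSucc_zero, h0, Submodule.comap_bot, Submodule.ker_subtype]
  -- associated primes of the first step
  have hne : Nontrivial (F (Fin.succ (0 : Fin (r+1)))) := by
    rw [Submodule.nontrivial_iff_ne_bot]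
    have := hmono (Fin.castSucc_lt_succ (i := (0 : Fin (r+1))))
    rw [Fin.castSucc_zero, h0] at this
    exact this.ne'
  obtain ⟨p, hp⟩ := associatedPrimes.nonempty (BGS K m n) (F (Fin.succ (0 : Fin (r+1))))
  have hpM : p ∈ associatedPrimes (BGS K m n) M :=
    associatedPrimes.subset_of_injective (Submodule.injective_subtype _) hp
  have hcp : cohDim (BGS K m n) (idealQ K m n) (BGS K m n ⧸ p) ≤ q := by
    refine cd_le_ass (F (Fin.succ (0 : Fin (r+1)))) q (fun i hi => ?_) p hp
    exact hz_iso (Submodule.quotEquivOfEqBot _ hbot).toModuleIso (hz_gt_cd _ i (hq ▸ hi))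
  have hfil : ∀ j : Fin (r+1+1), ∀ i < q, EZ (ModuleCat.of _ (BGS K m n ⧸ idealQ K m n))
      (ModuleCat.of (BGS K m n) (F j)) i := by
    intro j i hi
    induction j using Fin.induction with
    | zero =>
      have : Subsingleton (F 0) := by rw [h0]; infer_instance
      exact ez_zero₂ (isZero_of_subsingleton _) i
    | succ j ih =>
      refine ez_cov₂ (ses_sub (Submodule.comap (F j.succ).subtype (F j.castSucc))) ?_ ?_
      · exact ez_iso₂ (Submodule.comapSubtypeEquivOfLe (hlt j)).symm.toModuleIso ih
      · refine ez_lt_grade _ _ i ?_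
        have h1 := hCM j
        unfold IsCMWrt at h1
        rw [h1]
        refine lt_of_lt_of_le hi ?_
        rw [hq]
        rcases eq_or_ne j 0 with rfl | hj
        · exact le_rfl
        · exact (hinc 0 j (Fin.pos_of_ne_zero hj)).le
  have hMz : ∀ i < q, EZ (ModuleCat.of _ (BGS K m n ⧸ idealQ K m n)) (ModuleCat.of (BGS K m n) M) i :=
    fun i hi => ez_iso₂ (LinearEquiv.ofTop _ htop).toModuleIso (hfil _ i hi)
  apply le_antisymm
  · unfold mCohDim
    refine le_csInf ⟨_, p, hpM, rfl⟩ ?_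
    rintro _ ⟨p', hp', rfl⟩
    obtain ⟨i, hi, hE⟩ := ass_ext M ℳ hM p' hp'
    exact (grade_le _ M i hE).trans hi
  · obtain ⟨i, hi, hE⟩ := ass_ext M ℳ hM p hpM
    have h1 : mCohDim (BGS K m n) (idealQ K m n) M ≤ q :=
      (Nat.sInf_le (Set.mem_image_of_mem (fun p => cohDim (BGS K m n) (idealQ K m n) (BGS K m n ⧸ p)) hpM)).trans hcp
    exact h1.trans (le_grade _ M q i hE hMz)

end Final
end SeqCM

theorem seqCM_implies_maximalDepth
    (K : Type) [Field K] (m n : ℕ)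
    (M : Type) [AddCommGroup M] [Module (BGS K m n) M] [Module.Finite (BGS K m n) M]
    (ℳ : ℕ × ℕ → AddSubgroup M) (hM : IsBigrading K m n M ℳ)
    (h : IsSeqCMWrtQ K m n M ℳ) :
    HasMaximalDepth (BGS K m n) (idealQ K m n) M := SeqCM.main M ℳ hM h
end
end

section
/- Suppose grade(Q, M) > 0 and K is infinite. If M has maximal depth with respect to Q, then there exists a bihomogeneous M-regular element y ∈ Q of degree (0,1) such that M/yM has maximal depth with respect to Q. -/
open CategoryTheory MvPolynomial

noncomputable section

section
open Limits Opposite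

section bridge
variable {R : Type} [CommRing R]

def GRel (C : ChainComplex (ModuleCat.{0} R)ᵒᵖ ℕ) (n : ℕ) {H : (ModuleCat.{0} R)ᵒᵖ}
    (i : H ≅ C.homology n) (f : (C.X n).unop) (e : H.unop) : Prop :=
  ∃ c : (C.opcycles n).unop, (C.pOpcycles n).unop.hom c = f ∧ i.hom.unop.hom ((C.homologyι n).unop.hom c) = e

section generic
variable (C : ChainComplex (ModuleCat.{0} R)ᵒᵖ ℕ) (n : ℕ) {H : (ModuleCat.{0} R)ᵒᵖ}
    (i : H ≅ C.homology n)

lemma grel_exists (e : H.unop) : ∃ f, GRel C n i f e := by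
  have h1 : Epi (C.homologyι n).unop := inferInstance
  have h2 : Epi i.hom.unop := inferInstance
  obtain ⟨a, ha⟩ := (ModuleCat.epi_iff_surjective _).1 h2 e
  obtain ⟨c, hc⟩ := (ModuleCat.epi_iff_surjective _).1 h1 a
  exact ⟨_, c, rfl, by rw [← ha, ← hc]⟩

lemma grel_cocycle {f} {e} (h : GRel C n i f e) (m : ℕ) : (C.d m n).unop.hom f = 0 := by
  obtain ⟨c, rfl, rfl⟩ := h
  have h1 : C.d m n ≫ C.pOpcycles n = 0 := by simp
  exact congrArg (fun g => g.unop.hom c) h1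

lemma grel_of_cocycle (f : (C.X n).unop) (h : (C.d (n+1) n).unop.hom f = 0) :
    ∃ e, GRel C n i f e := by
  have hk := C.opcyclesIsCokernel (n+1) n (by simp)
  have hex : (ShortComplex.mk _ _ (C.d_pOpcycles (n+1) n)).Exact :=
    ShortComplex.exact_of_g_is_cokernel _ hk
  have h2 := hex.unop
  rw [ShortComplex.moduleCat_exact_iff] at h2
  obtain ⟨c, hc⟩ := h2 f (by exact h)
  exact ⟨_, c, hc, rfl⟩

lemma grel_zero_iff {f} {e} (h : GRel C n i f e) :
    e = 0 ↔ ∃ g : (C.X ((ComplexShape.down ℕ).next n)).unop, (C.d n _).unop.hom g = f := by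
  obtain ⟨c, rfl, rfl⟩ := h
  have hk := C.homologyIsKernel n _ rfl
  have hex : (ShortComplex.mk _ _ (C.homologyι_comp_fromOpcycles n
    ((ComplexShape.down ℕ).next n))).Exact :=
    ShortComplex.exact_of_f_is_kernel _ hk
  have h2 := hex.unop
  rw [ShortComplex.moduleCat_exact_iff] at h2
  have hpf : C.pOpcycles n ≫ C.fromOpcycles n
    ((ComplexShape.down ℕ).next n) = C.d n _ := by simp
  have hm1 : Mono (C.pOpcycles n).unop := inferInstance
  have hm2 : Mono i.hom.unop := inferInstance
  have hinj := (ModuleCat.mono_iff_injective _).1 hm1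
  have hinj2 := (ModuleCat.mono_iff_injective _).1 hm2
  have key : ∀ g : (C.X ((ComplexShape.down ℕ).next n)).unop,
      (C.pOpcycles n).unop.hom (((C.fromOpcycles n ((ComplexShape.down ℕ).next n)).unop).hom g)
       = (C.d n _).unop.hom g := by
    intro g
    exact congrArg (fun q => q.unop.hom g) hpf
  constructor
  · intro h0
    have : (C.homologyι n).unop.hom c = 0 := by
      apply hinj2
      exact h0.trans (map_zero i.hom.unop.hom).symm
    obtain ⟨g, hg⟩ := h2 c this
    exact ⟨g, (key g).symm.trans (congrArg _ hg)⟩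
  · rintro ⟨g, hg⟩
    rw [← key] at hg
    have := hinj hg
    subst this
    have h3 : (C.homologyι n).unop.hom (((C.fromOpcycles n ((ComplexShape.down ℕ).next n)).unop).hom g) = 0 := by
      exact congrArg (fun q => q.unop.hom g) (C.homologyι_comp_fromOpcycles n
        ((ComplexShape.down ℕ).next n))
    rw [h3, map_zero]

lemma grel_map {C' : ChainComplex (ModuleCat.{0} R)ᵒᵖ ℕ} {H' : (ModuleCat.{0} R)ᵒᵖ}
    (i' : H' ≅ C'.homology n) (Φ : C' ⟶ C) (η : H' ⟶ H)
    (hη : η ≫ i.hom = i'.hom ≫ HomologicalComplex.homologyMap Φ n)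
    {f} {e} (h : GRel C n i f e) :
    GRel C' n i' ((Φ.f n).unop.hom f) (η.unop.hom e) := by
  obtain ⟨c, rfl, rfl⟩ := h
  refine ⟨(HomologicalComplex.opcyclesMap Φ n).unop.hom c, ?_, ?_⟩
  · exact congrArg (fun q => q.unop.hom c) (HomologicalComplex.p_opcyclesMap Φ n)
  · have h4 : i'.hom ≫ C'.homologyι n ≫ HomologicalComplex.opcyclesMap Φ n =
        η ≫ i.hom ≫ C.homologyι n := by
      rw [← HomologicalComplex.homologyι_naturality, reassoc_of% hη]
    exact congrArg (fun q => q.unop.hom c) h4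
end generic

/-- the chain complex in the opposite category computing the old `Ext` -/
abbrev oldCx {X : ModuleCat.{0} R} (P : ProjectiveResolution X) (Y : ModuleCat.{0} R) :
    ChainComplex (ModuleCat.{0} R)ᵒᵖ ℕ :=
  ((((linearYoneda R (ModuleCat.{0} R)).obj Y).rightOp).mapHomologicalComplex _).obj P.complex

abbrev OldExt (n : ℕ) (X Y : ModuleCat.{0} R) : ModuleCat.{0} R :=
  ((Ext R (ModuleCat.{0} R) n).obj (op X)).obj Y

def ExtRel {X : ModuleCat.{0} R} (P : ProjectiveResolution X) (Y : ModuleCat.{0} R) (n : ℕ)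
    (f : P.complex.X n ⟶ Y) (e : OldExt n X Y) : Prop :=
  GRel (oldCx P Y) n (P.isoLeftDerivedObj ((linearYoneda R (ModuleCat.{0} R)).obj Y).rightOp n) f e

variable {X : ModuleCat.{0} R} (P : ProjectiveResolution X) (Y : ModuleCat.{0} R) (n : ℕ)

lemma rel_exists (e : OldExt n X Y) : ∃ f, ExtRel P Y n f e :=
  grel_exists (oldCx P Y) n _ e

lemma rel_cocycle {f} {e} (h : ExtRel P Y n f e) (m : ℕ) : P.complex.d m n ≫ f = 0 :=
  grel_cocycle (oldCx P Y) n _ h m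

lemma rel_of_cocycle (f : P.complex.X n ⟶ Y) (h : P.complex.d (n+1) n ≫ f = 0) :
    ∃ e, ExtRel P Y n f e :=
  grel_of_cocycle (oldCx P Y) n _ f h

lemma rel_zero_iff {f} {e} (h : ExtRel P Y n f e) :
    e = 0 ↔ ∃ g : P.complex.X ((ComplexShape.down ℕ).next n) ⟶ Y,
      P.complex.d n _ ≫ g = f :=
  grel_zero_iff (oldCx P Y) n _ h

lemma rel_map {X' : ModuleCat.{0} R} (P' : ProjectiveResolution X') (g : X' ⟶ X)
    (φ : ProjectiveResolution.Hom P' P g) {f} {e} (h : ExtRel P Y n f e) :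
    ExtRel P' Y n (φ.hom.f n ≫ f)
      ((((Ext R (ModuleCat.{0} R) n).map g.op).app Y).hom e) := by
  have h1 := ProjectiveResolution.isoLeftDerivedObj_hom_naturality g P' P φ.hom
      (by simpa using φ.hom_f_zero_comp_π_f_zero) ((linearYoneda R (ModuleCat.{0} R)).obj Y).rightOp n
  exact grel_map (oldCx P Y) n _ _ (((((linearYoneda R (ModuleCat.{0} R)).obj Y).rightOp).mapHomologicalComplex _).map φ.hom)
    _ h1 h

lemma next_zero' : (ComplexShape.down ℕ).next 0 = 0 := by simp
lemma next_succ' (n : ℕ) : (ComplexShape.down ℕ).next (n+1) = n := by simp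

/-- compatible pairs of classes in the two models of Ext. -/
def OldNew (n : ℕ) (X Y : ModuleCat.{0} R) (e : OldExt n X Y) (e' : Abelian.Ext X Y n) : Prop :=
  ∃ (f : (projectiveResolution X).complex.X n ⟶ Y) (hf : (projectiveResolution X).complex.d (n+1) n ≫ f = 0),
    ExtRel (projectiveResolution X) Y n f e ∧ (projectiveResolution X).extMk f (n+1) rfl hf = e'

lemma extMk_zero_iff_zero (P : ProjectiveResolution X) (f : P.complex.X 0 ⟶ Y)
    (hf : P.complex.d 1 0 ≫ f = 0) : P.extMk f 1 rfl hf = 0 ↔ f = 0 := by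
  constructor
  · intro h
    simp only [← P.extEquivCohomologyClass.apply_eq_iff_eq,
      ProjectiveResolution.extEquivCohomologyClass_extMk, ProjectiveResolution.extEquivCohomologyClass_zero,
      CochainComplex.HomComplex.CohomologyClass.mk_eq_zero_iff] at h
    rw [CochainComplex.HomComplex.Cocycle.toSingleMk_mem_coboundaries_iff _ _ _ _ _ 1 (by lia)] at h
    obtain ⟨g, hg⟩ := h
    have h0 : IsZero (P.cochainComplex.X 1) := by
      exact P.cochainComplex.isZero_of_isStrictlyLE 0 1 (by lia)
    rw [h0.eq_of_src g 0, comp_zero] at hg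
    rw [← cancel_epi (P.cochainComplexXIso (-((0:ℕ):ℤ)) 0 rfl).hom, ← hg, comp_zero]
  · rintro rfl; simp

lemma extMk_zero_iff_any (P : ProjectiveResolution X) (f : P.complex.X n ⟶ Y)
    (hf : P.complex.d (n+1) n ≫ f = 0) : P.extMk f (n+1) rfl hf = 0 ↔
    ∃ g : P.complex.X ((ComplexShape.down ℕ).next n) ⟶ Y,
      P.complex.d n _ ≫ g = f := by
  cases n with
  | zero =>
    rw [extMk_zero_iff_zero]
    constructor
    · rintro rfl
      exact ⟨0, by simp⟩
    · rintro ⟨g, rfl⟩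
      rw [P.complex.shape _ _ (by simp), zero_comp]
  | succ k =>
    rw [next_succ']
    exact P.extMk_eq_zero_iff f _ rfl hf k rfl

lemma OldNew.zero_iff {e : OldExt n X Y} {e' : Abelian.Ext X Y n} (h : OldNew n X Y e e') :
    e = 0 ↔ e' = 0 := by
  obtain ⟨f, hf, h1, rfl⟩ := h
  rw [rel_zero_iff _ _ _ h1, extMk_zero_iff_any]

lemma OldNew.exists_new (e : OldExt n X Y) : ∃ e', OldNew n X Y e e' := by
  obtain ⟨f, hf⟩ := rel_exists (projectiveResolution X) Y n e
  exact ⟨_, f, rel_cocycle _ _ _ hf _, hf, rfl⟩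

lemma OldNew.exists_old (e' : Abelian.Ext X Y n) : ∃ e, OldNew n X Y e e' := by
  obtain ⟨f, hf, h⟩ := (projectiveResolution X).extMk_surjective e' (n+1) rfl
  obtain ⟨e, he⟩ := rel_of_cocycle _ Y n f hf
  exact ⟨e, f, hf, he, h⟩

variable {Y n} in
lemma OldNew.map {X' : ModuleCat.{0} R} (g : X' ⟶ X) {e : OldExt n X Y} {e' : Abelian.Ext X Y n}
    (h : OldNew n X Y e e') : OldNew n X' Y ((((Ext R (ModuleCat.{0} R) n).map g.op).app Y).hom e)
      ((Abelian.Ext.mk₀ g).comp e' (zero_add n)) := by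
  obtain ⟨f, hf, h1, rfl⟩ := h
  let φ : ProjectiveResolution.Hom (projectiveResolution X') (projectiveResolution X) g :=
    { hom := ProjectiveResolution.lift g _ _ 
      hom_f_zero_comp_π_f_zero := by
        have := ProjectiveResolution.lift_commutes_zero g (projectiveResolution X') (projectiveResolution X)
        exact this }
  have h2 := rel_map _ _ _ _ g φ h1
  refine ⟨_, rel_cocycle _ _ _ h2 _, h2, ?_⟩
  rw [ProjectiveResolution.mk₀_comp_extMk _ _ _ _ φ]

lemma nontrivial_old_iff : Nontrivial (OldExt n X Y) ↔ Nontrivial (Abelian.Ext X Y n) := by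
  rw [nontrivial_iff_exists_ne 0, nontrivial_iff_exists_ne 0]
  constructor
  · rintro ⟨e, he⟩
    obtain ⟨e', h⟩ := OldNew.exists_new Y n e
    exact ⟨e', fun h' => he (h.zero_iff.2 h')⟩
  · rintro ⟨e, he⟩
    obtain ⟨e', h⟩ := OldNew.exists_old Y n e
    exact ⟨e', fun h' => he (h.zero_iff.1 h')⟩

end bridge

end

section
open Limits Opposite

section bridge2
variable {R : Type} [CommRing R]

lemma subsingleton_colim_iff {J : Type} [SmallCategory J] [IsFiltered J] (F : J ⥤ ModuleCat.{0} R)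
    (D : Cocone F) (hD : IsColimit D) :
    Subsingleton D.pt ↔ ∀ j (x : F.obj j), ∃ k, ∃ f : j ⟶ k, (F.map f).hom x = 0 := by
  constructor
  · intro h j x
    obtain ⟨k, f, g, hfg⟩ := Concrete.isColimit_exists_of_rep_eq F (i := j) (j := j) hD x 0 (Subsingleton.elim (α := D.pt) _ _)
    exact ⟨k, f, hfg.trans (map_zero _)⟩
  · intro h
    refine subsingleton_of_forall_eq 0 fun x => ?_
    obtain ⟨j, y, rfl⟩ := Concrete.isColimit_exists_rep F hD x
    obtain ⟨k, f, hf⟩ := h j y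
    have := congrArg (fun q => q.hom y) (D.w f)
    refine this.symm.trans ?_
    change (D.ι.app k).hom ((F.map f).hom y) = 0
    rw [hf, map_zero]

/-- projection `R/J^s → R/J^t` for `t ≤ s`. -/
def prj (J : Ideal R) {t s : ℕ} (h : t ≤ s) :
    ModuleCat.of R (R ⧸ J^s) ⟶ ModuleCat.of R (R ⧸ J^t) :=
  ModuleCat.ofHom (Submodule.mapQ (J^s) (J^t) LinearMap.id (Ideal.pow_le_pow_right h))

/-- vanishing of local cohomology, in terms of Abelian.Ext. -/
def LV (J : Ideal R) (L : Type) [AddCommGroup L] [Module R L] (i : ℕ) : Prop :=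
  ∀ t, ∀ e : Abelian.Ext (ModuleCat.of R (R ⧸ J^t)) (ModuleCat.of R L) i,
    ∃ s, ∃ h : t ≤ s, (Abelian.Ext.mk₀ (prj J h)).comp e (zero_add i) = 0

lemma nontrivial_lc_iff (J : Ideal R) (L : Type) [AddCommGroup L] [Module R L] (i : ℕ) :
    Nontrivial ((localCohomology J i).obj (ModuleCat.of R L)) ↔ ¬ LV J L i := by
  rw [← not_subsingleton_iff_nontrivial, not_iff_not]
  let Y := ModuleCat.of R L
  let F := localCohomology.diagram (localCohomology.idealPowersDiagram J) i
  have hc : HasColimit F := localCohomology.hasColimitDiagram.{0,0} _ i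
  let D := ((evaluation _ (ModuleCat.{0} R)).obj Y).mapCocone (colimit.cocone F)
  have hD : IsColimit D := isColimitOfPreserves _ (colimit.isColimit F)
  have h1 := subsingleton_colim_iff _ D hD
  refine (show _ ↔ Subsingleton D.pt from Iff.rfl).trans (h1.trans ?_)
  constructor
  · intro h t e
    obtain ⟨e', he'⟩ := OldNew.exists_old _ _ e
    obtain ⟨k, f, hk⟩ := h (op (op t)) e'
    have hle : t ≤ k.unop.unop := f.unop.unop.down.down
    refine ⟨k.unop.unop, hle, ?_⟩
    have h2 := OldNew.map (prj J hle) he'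
    exact h2.zero_iff.1 hk
  · intro h j x
    obtain ⟨e', he'⟩ := OldNew.exists_new _ _ x
    obtain ⟨s, hs, h2⟩ := h j.unop.unop e'
    have h3 := OldNew.map (prj J hs) he'
    have h4 := h3.zero_iff.2 h2
    exact ⟨op (op s), (homOfLE hs).op.op, h4⟩

end bridge2

end

section
open Limits Opposite

section LVsec
variable {R : Type} [CommRing R]

def LVc (J : Ideal R) (Y : ModuleCat.{0} R) (i : ℕ) : Prop :=
  ∀ t, ∀ e : Abelian.Ext (ModuleCat.of R (R ⧸ J^t)) Y i,
    ∃ s, ∃ h : t ≤ s, (Abelian.Ext.mk₀ (prj J h)).comp e (zero_add i) = 0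

lemma prj_comp (J : Ideal R) {t s r : ℕ} (h : t ≤ s) (h' : s ≤ r) :
    prj J h' ≫ prj J h = prj J (h.trans h') := by
  ext x
  rfl

lemma pull_pull (J : Ideal R) {Y : ModuleCat.{0} R} {i t s r : ℕ} (h : t ≤ s) (h' : s ≤ r)
    (e : Abelian.Ext (ModuleCat.of R (R ⧸ J^t)) Y i) :
    (Abelian.Ext.mk₀ (prj J h')).comp ((Abelian.Ext.mk₀ (prj J h)).comp e (zero_add i)) (zero_add i)
     = (Abelian.Ext.mk₀ (prj J (h.trans h'))).comp e (zero_add i) := by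
  rw [Abelian.Ext.mk₀_comp_mk₀_assoc, prj_comp]

lemma pull_comp {A A' B C : ModuleCat.{0} R} (f : A' ⟶ A) {i j k : ℕ} (e : Abelian.Ext A B i)
    (e' : Abelian.Ext B C j) (hk : i + j = k) :
    (Abelian.Ext.mk₀ f).comp (e.comp e' hk) (zero_add k) =
     ((Abelian.Ext.mk₀ f).comp e (zero_add i)).comp e' hk := by
  rw [Abelian.Ext.comp_assoc _ _ _ (zero_add i) hk (by lia)]

variable {J : Ideal R} {S : ShortComplex (ModuleCat.{0} R)} 

lemma LVc_mid (hS : S.ShortExact) {i : ℕ} (h1 : LVc J S.X₁ i) (h3 : LVc J S.X₃ i) : LVc J S.X₂ i := by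
  intro t e
  obtain ⟨s, hs, h⟩ := h3 t (e.comp (Abelian.Ext.mk₀ S.g) (add_zero i))
  rw [pull_comp] at h
  obtain ⟨a, ha⟩ := Abelian.Ext.covariant_sequence_exact₂ _ hS _ h
  obtain ⟨r, hr, h'⟩ := h1 s a
  refine ⟨r, hs.trans hr, ?_⟩
  rw [← pull_pull J hs hr, ← ha, pull_comp, h', Abelian.Ext.zero_comp]

lemma LVc_right (hS : S.ShortExact) {i : ℕ} (h2 : LVc J S.X₂ i) (h1 : LVc J S.X₁ (i+1)) : LVc J S.X₃ i := by
  intro t e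
  obtain ⟨s, hs, h⟩ := h1 t (e.comp hS.extClass rfl)
  rw [pull_comp] at h
  obtain ⟨a, ha⟩ := Abelian.Ext.covariant_sequence_exact₃ _ hS _ _ h
  obtain ⟨r, hr, h'⟩ := h2 s a
  refine ⟨r, hs.trans hr, ?_⟩
  rw [← pull_pull J hs hr, ← ha, pull_comp, h', Abelian.Ext.zero_comp]

lemma LVc_left (hS : S.ShortExact) {i : ℕ} (h3 : LVc J S.X₃ i) (h2 : LVc J S.X₂ (i+1)) : LVc J S.X₁ (i+1) := by
  intro t e
  obtain ⟨s, hs, h⟩ := h2 t (e.comp (Abelian.Ext.mk₀ S.f) (add_zero _))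
  rw [pull_comp] at h
  obtain ⟨a, ha⟩ := Abelian.Ext.covariant_sequence_exact₁ _ hS _ h rfl
  obtain ⟨r, hr, h'⟩ := h3 s a
  refine ⟨r, hs.trans hr, ?_⟩
  rw [← pull_pull J hs hr, ← ha, pull_comp, h', Abelian.Ext.zero_comp]

section mods
variable {A B C : Type} [AddCommGroup A] [Module R A] [AddCommGroup B] [Module R B]
  [AddCommGroup C] [Module R C] (f : A →ₗ[R] B) (g : B →ₗ[R] C)

def sesOf (hfg : Function.Exact f g) : ShortComplex (ModuleCat.{0} R) :=
  ShortComplex.mk (ModuleCat.ofHom f) (ModuleCat.ofHom g) (by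
    ext x; exact hfg.apply_apply_eq_zero x)

lemma sesOf_shortExact (hf : Function.Injective f)
    (hg : Function.Surjective g) (hfg : Function.Exact f g) : (sesOf f g hfg).ShortExact :=
  ModuleCat.shortComplex_shortExact _ hfg hf hg

lemma LV_mid (hf : Function.Injective f)
    (hg : Function.Surjective g) (hfg : Function.Exact f g) {i : ℕ} (h1 : LV J A i) (h3 : LV J C i) : LV J B i :=
  LVc_mid (sesOf_shortExact f g hf hg hfg) h1 h3

lemma LV_right (hf : Function.Injective f)
    (hg : Function.Surjective g) (hfg : Function.Exact f g) {i : ℕ} (h2 : LV J B i) (h1 : LV J A (i+1)) : LV J C i :=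
  LVc_right (sesOf_shortExact f g hf hg hfg) h2 h1

lemma LV_left (hf : Function.Injective f)
    (hg : Function.Surjective g) (hfg : Function.Exact f g) {i : ℕ} (h3 : LV J C i) (h2 : LV J B (i+1)) : LV J A (i+1) :=
  LVc_left (sesOf_shortExact f g hf hg hfg) h3 h2
end mods

lemma ext_smul_zero {r : R} {A B : ModuleCat.{0} R} (h : ∀ a : A, r • a = 0) {i : ℕ}
    (e : Abelian.Ext A B i) : r • e = 0 := by
  have : r • 𝟙 A = 0 := by
    ext a
    exact h a
  rw [← Abelian.Ext.mk₀_id_comp e, ← Abelian.Ext.smul_comp, ← Abelian.Ext.mk₀_smul, this]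
  simp

/-- if `z ∈ J` acts bijectively then all LV vanish -/
lemma LV_of_bijective {L : Type} [AddCommGroup L] [Module R L] {z : R} (hz : z ∈ J)
    (hb : Function.Bijective (fun l : L => z • l)) (i : ℕ) : LV J L i := by
  intro t e
  refine ⟨t, le_rfl, ?_⟩
  have h0 : z ^ t • e = 0 := by
    refine ext_smul_zero (fun a => ?_) e
    obtain ⟨a, rfl⟩ := Ideal.Quotient.mk_surjective a
    change Ideal.Quotient.mk _ (z ^ t * a) = 0
    rw [Ideal.Quotient.eq_zero_iff_mem]
    exact Ideal.mul_mem_right _ _ (Ideal.pow_mem_pow hz t)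
  suffices e = 0 by rw [this, Abelian.Ext.comp_zero]
  have hb' : Function.Bijective (fun l : L => z ^ t • l) := by
    have : (fun l : L => z ^ t • l) = (fun l : L => z • l)^[t] := by
      rw [smul_iterate]
    rw [this]; exact hb.iterate t
  let q : ModuleCat.of R L ⟶ ModuleCat.of R L := z ^ t • 𝟙 _
  have hq : IsIso q := by
    rw [ConcreteCategory.isIso_iff_bijective]
    exact hb'
  rw [Abelian.Ext.smul_eq_comp_mk₀] at h0
  have h1 := congrArg (fun e => Abelian.Ext.comp e (Abelian.Ext.mk₀ (inv q)) (add_zero i)) h0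
  simpa [q] using h1

end LVsec

end

section
open Limits Opposite

section Tors
variable {R : Type} [CommRing R]

/-- `J`-power torsion submodule -/
def tors (J : Ideal R) (L : Type) [AddCommGroup L] [Module R L] : Submodule R L where
  carrier := {l | ∃ k, ∀ r ∈ J^k, r • l = 0}
  zero_mem' := ⟨0, fun r _ => smul_zero r⟩
  add_mem' := by
    rintro a b ⟨k, hk⟩ ⟨l, hl⟩
    refine ⟨k + l, fun r hr => ?_⟩
    rw [smul_add, hk r (Ideal.pow_le_pow_right (by lia) hr),
      hl r (Ideal.pow_le_pow_right (by lia) hr), add_zero]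
  smul_mem' := by
    rintro c a ⟨k, hk⟩
    exact ⟨k, fun r hr => by rw [smul_comm, hk r hr, smul_zero]⟩

lemma mem_tors {J : Ideal R} {L : Type} [AddCommGroup L] [Module R L] {l : L} :
    l ∈ tors J L ↔ ∃ k, ∀ r ∈ J^k, r • l = 0 := Iff.rfl

lemma fg_tors {J : Ideal R} {L : Type} [AddCommGroup L] [Module R L] {N : Submodule R L}
    (hN : N.FG) (h : N ≤ tors J L) : ∃ k, ∀ x ∈ N, ∀ r ∈ J^k, r • x = 0 := by
  induction N, hN using Submodule.fg_induction with
  | singleton x =>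
    obtain ⟨k, hk⟩ := h (Submodule.mem_span_singleton_self x)
    refine ⟨k, fun y hy r hr => ?_⟩
    obtain ⟨c, rfl⟩ := Submodule.mem_span_singleton.1 hy
    rw [smul_comm, hk r hr, smul_zero]
  | sup N₁ N₂ _ _ h₁ h₂ =>
    obtain ⟨k, hk⟩ := h₁ (le_sup_left.trans h)
    obtain ⟨l, hl⟩ := h₂ (le_sup_right.trans h)
    refine ⟨k + l, fun y hy r hr => ?_⟩
    obtain ⟨a, ha, b, hb, rfl⟩ := Submodule.mem_sup.1 hy
    rw [smul_add, hk a ha r (Ideal.pow_le_pow_right (by lia) hr),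
      hl b hb r (Ideal.pow_le_pow_right (by lia) hr), add_zero]

lemma tors_baer [IsNoetherianRing R] (J : Ideal R) (E : Type) [AddCommGroup E] [Module R E]
    [hE : Module.Injective R E] : Module.Baer R (tors J E) := by
  intro I g
  obtain ⟨k, hk⟩ := fg_tors (J := J) (N := LinearMap.range ((tors J E).subtype.comp g))
    (by
      have : IsNoetherian R I := inferInstance
      exact (Module.Finite.fg_top (R := R) (M := I)).map _ |> (by rw [LinearMap.range_eq_map]; exact ·))
    (by rintro _ ⟨x, rfl⟩; exact (g x).2)
  obtain ⟨c, hc⟩ := Ideal.exists_pow_inf_eq_pow_smul (M := R) J I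
  have hker : ∀ x : I, (x : R) ∈ J ^ (k + c) → g x = 0 := by
    intro x hx
    have h1 : (x : R) ∈ J ^ (k+c) • (⊤ : Submodule R R) ⊓ I := ⟨by simpa using hx, x.2⟩
    rw [hc (k+c) (by lia)] at h1
    have h2 : (x : R) ∈ J ^ k • I := by
      refine Submodule.smul_mono ?_ inf_le_right h1
      simp
    have h3 : ∀ y, y ∈ J ^ k • I → ∃ hy : y ∈ I, g ⟨y, hy⟩ = 0 := by
      intro y hy
      refine Submodule.smul_induction_on (p := fun y => ∃ hy : y ∈ I, g ⟨y, hy⟩ = 0) hy ?_ ?_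
      · intro r hr n hn
        refine ⟨I.smul_mem r hn, ?_⟩
        have : (⟨r • n, I.smul_mem r hn⟩ : I) = r • ⟨n, hn⟩ := rfl
        rw [this, map_smul]
        apply Subtype.ext
        exact hk _ ⟨⟨n, hn⟩, rfl⟩ r hr
      · rintro a b ⟨ha, iha⟩ ⟨hb, ihb⟩
        refine ⟨I.add_mem ha hb, ?_⟩
        have : (⟨a + b, I.add_mem ha hb⟩ : I) = ⟨a, ha⟩ + ⟨b, hb⟩ := rfl
        rw [this, map_add, iha, ihb, add_zero]
    exact (h3 x h2).2
  let q : I →ₗ[R] (R ⧸ J^(k+c)) := (Submodule.mkQ (J^(k+c))).comp I.subtype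
  have hq : LinearMap.ker q ≤ LinearMap.ker ((tors J E).subtype.comp g) := by
    intro x hx
    have : (x : R) ∈ J^(k+c) := by
      rw [← Ideal.Quotient.eq_zero_iff_mem]; exact hx
    simp [hker x this]
  obtain ⟨h, hh⟩ := hE.out ((LinearMap.ker q).liftQ q le_rfl)
    (by rw [← LinearMap.ker_eq_bot]; exact Submodule.ker_liftQ_eq_bot _ _ _ le_rfl)
    ((LinearMap.ker q).liftQ _ hq)
  refine ⟨LinearMap.codRestrict (tors J E) (h.comp (Submodule.mkQ (J^(k+c)))) ?_, ?_⟩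
  · intro c'
    refine ⟨k + c, fun r hr => ?_⟩
    rw [← map_smul]
    have : (Submodule.mkQ (J^(k+c))) (r • c') = 0 := by
      exact Ideal.Quotient.eq_zero_iff_mem.2 (Ideal.mul_mem_right c' _ hr)
    rw [LinearMap.comp_apply, this, map_zero]
  · intro x hx
    apply Subtype.ext
    exact hh (Submodule.Quotient.mk ⟨x, hx⟩)

lemma exists_tors_emb [IsNoetherianRing R] (J : Ideal R) (L : Type) [AddCommGroup L] [Module R L]
    (h : tors J L = ⊤) : ∃ (G : Type) (_ : AddCommGroup G) (_ : Module R G) (f : L →ₗ[R] G),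
      Function.Injective f ∧ tors J G = ⊤ ∧ Module.Injective R G := by
  let E : ModuleCat.{0} R := Injective.under (ModuleCat.of R L)
  let ι : ModuleCat.of R L ⟶ E := Injective.ι _
  have hE : Module.Injective R E := by
    have : Injective (ModuleCat.of R E) := inferInstanceAs (Injective (Injective.under (ModuleCat.of R L)))
    exact Module.injective_module_of_injective_object R E
  have hι : Function.Injective ι.hom := (ModuleCat.mono_iff_injective ι).1 inferInstance
  refine ⟨tors J E, inferInstance, inferInstance, LinearMap.codRestrict _ ι.hom ?_, ?_, ?_, ?_⟩
  · intro c
    have : c ∈ tors J L := h ▸ Submodule.mem_top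
    obtain ⟨k, hk⟩ := this
    exact ⟨k, fun r hr => by rw [← map_smul]; erw [hk r hr]; exact map_zero _⟩
  · intro a b hab
    exact hι (congrArg Subtype.val hab)
  · rw [eq_top_iff]
    rintro ⟨x, k, hk⟩ -
    exact ⟨k, fun r hr => Subtype.ext (hk r hr)⟩
  · exact (tors_baer J E).injective

lemma LV_of_injective {J : Ideal R} {G : Type} [AddCommGroup G] [Module R G] [h : Module.Injective R G]
    (i : ℕ) : LV J G (i+1) := by
  have : Injective (ModuleCat.of R G) := Module.injective_object_of_injective_module R G
  intro t e
  exact ⟨t, le_rfl, Abelian.Ext.eq_zero_of_injective _⟩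

lemma LVc_left' {J : Ideal R} {S : ShortComplex (ModuleCat.{0} R)} (hS : S.ShortExact)
    (h3 : ∀ (t : ℕ) (φ : ModuleCat.of R (R ⧸ J^t) ⟶ S.X₃), ∃ s, ∃ h : t ≤ s,
      ∃ ψ : ModuleCat.of R (R ⧸ J^s) ⟶ S.X₂, ψ ≫ S.g = prj J h ≫ φ)
    (h2 : LVc J S.X₂ 1) : LVc J S.X₁ 1 := by
  intro t e
  obtain ⟨s, hs, h⟩ := h2 t (e.comp (Abelian.Ext.mk₀ S.f) (add_zero _))
  rw [pull_comp] at h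
  obtain ⟨a, ha⟩ := Abelian.Ext.covariant_sequence_exact₁ _ hS _ h (zero_add 1)
  obtain ⟨φ, rfl⟩ := Abelian.Ext.homEquiv₀.symm.surjective a
  change Abelian.Ext.comp (Abelian.Ext.mk₀ φ) _ _ = _ at ha
  obtain ⟨r, hr, ψ, hψ⟩ := h3 s φ
  refine ⟨r, hs.trans hr, ?_⟩
  rw [← pull_pull J hs hr, ← ha, pull_comp, Abelian.Ext.mk₀_comp_mk₀, ← hψ,
    ← Abelian.Ext.mk₀_comp_mk₀,
    Abelian.Ext.comp_assoc_of_second_deg_zero, hS.comp_extClass, Abelian.Ext.comp_zero]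

/-- Torsion modules are acyclic -/
lemma LV_of_tors [IsNoetherianRing R] {J : Ideal R} {L : Type} [AddCommGroup L] [Module R L]
    (h : tors J L = ⊤) (i : ℕ) : LV J L (i+1) := by
  induction i generalizing L with
  | zero =>
    obtain ⟨G, _, _, f, hf, hG, hinj⟩ := exists_tors_emb J L h
    let g := (LinearMap.range f).mkQ
    have hg : Function.Surjective g := Submodule.mkQ_surjective _
    have hfg : Function.Exact f g := by
      rw [LinearMap.exact_iff]; simp [g]
    refine LVc_left' (sesOf_shortExact f g hf hg hfg) ?_ (LV_of_injective (G := G) 0)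
    intro t φ
    obtain ⟨x, hx⟩ := hg (φ.hom (Ideal.Quotient.mk (J^t) 1))
    have : x ∈ tors J G := hG ▸ Submodule.mem_top
    obtain ⟨s, hs⟩ := this
    have hs' : ∀ r ∈ J^(t+s), r • x = 0 := fun r hr => hs r (Ideal.pow_le_pow_right (by lia) hr)
    refine ⟨t + s, by lia, ModuleCat.ofHom (Submodule.liftQ (J^(t+s)) (LinearMap.toSpanSingleton R G x) (by
        intro r hr; simpa using hs' r hr)), ?_⟩
    apply ModuleCat.hom_ext
    apply LinearMap.ext
    intro y
    obtain ⟨y, rfl⟩ := Ideal.Quotient.mk_surjective y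
    have h1 : φ.hom (y • (Ideal.Quotient.mk (J^t) 1)) = y • φ.hom (Ideal.Quotient.mk (J^t) 1) := map_smul _ _ _
    have h2 : y • (Ideal.Quotient.mk (J^t) 1) = Ideal.Quotient.mk (J^t) y := by
      change Ideal.Quotient.mk (J^t) (y * 1) = _
      rw [mul_one]
    rw [h2] at h1
    exact ((map_smul g y x).trans (congrArg (y • ·) hx)).trans h1.symm
  | succ i ih =>
    obtain ⟨G, _, _, f, hf, hG, hinj⟩ := exists_tors_emb J L h
    let g := (LinearMap.range f).mkQ
    have hg : Function.Surjective g := Submodule.mkQ_surjective _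
    have hfg : Function.Exact f g := by
      rw [LinearMap.exact_iff]; simp [g]
    refine LV_left f g hf hg hfg (ih ?_) (LV_of_injective _)
    rw [eq_top_iff]
    rintro y -
    obtain ⟨x, rfl⟩ := hg y
    have : x ∈ tors J G := hG ▸ Submodule.mem_top
    obtain ⟨s, hs⟩ := this
    exact ⟨s, fun r hr => by rw [← map_smul, hs r hr, map_zero]⟩

lemma tors_LV_zero {J : Ideal R} {L : Type} [AddCommGroup L] [Module R L]
    (h : tors J L = ⊤) (h0 : LV J L 0) (l : L) : l = 0 := by
  have : l ∈ tors J L := h ▸ Submodule.mem_top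
  obtain ⟨t, ht⟩ := this
  let φ : ModuleCat.of R (R ⧸ J^t) ⟶ ModuleCat.of R L :=
      ModuleCat.ofHom (Submodule.liftQ (J^t) (LinearMap.toSpanSingleton R L l) (by
        intro r hr; simpa using ht r hr))
  obtain ⟨s, hs, h1⟩ := h0 t (Abelian.Ext.mk₀ φ)
  rw [Abelian.Ext.mk₀_comp_mk₀, Abelian.Ext.mk₀_eq_zero_iff] at h1
  have h2 := congrArg (fun q => q.hom (Ideal.Quotient.mk (J^s) 1)) h1
  change (1:R) • l = 0 at h2
  simpa using h2

end Tors

end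

section
open Limits Opposite

section Key
variable {R : Type} [CommRing R]

def Cnd (J : Ideal R) (zs : List R) (L : Type) [AddCommGroup L] [Module R L] : Prop :=
  ∀ l : L, J ≤ (Ideal.torsionOf R L l ⊔ Ideal.span {z | z ∈ zs}).radical

def TT (zs : List R) (L : Type) [AddCommGroup L] [Module R L] : Prop :=
  ∀ (l : L) (t : ℕ), ∃ k, (zs.prod)^k • l ∈ Ideal.span {w | ∃ z ∈ zs, w = z^(k+t)} • (⊤ : Submodule R L)

lemma cnd_aux {J A : Ideal R} {z : R} {zs : List R} {k : ℕ} (hz : z^k ∈ A)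
    (h : J ≤ (A ⊔ Ideal.span {w | w ∈ z :: zs}).radical) :
    J ≤ (A ⊔ Ideal.span {w | w ∈ zs}).radical := by
  refine h.trans ?_
  rw [Ideal.radical_le_radical_iff]
  refine sup_le (le_sup_left.trans Ideal.le_radical) ?_
  rw [Ideal.span_le]
  intro w hw
  rcases List.mem_cons.1 hw with rfl | hw
  · exact ⟨k, Ideal.mem_sup_left hz⟩
  · exact Ideal.le_radical (Ideal.mem_sup_right (Ideal.subset_span hw))

variable {L : Type} [AddCommGroup L] [Module R L]

lemma cnd_mono {J A B C : Ideal R} (hAB : A ≤ B) (h : J ≤ (A ⊔ C).radical) : J ≤ (B ⊔ C).radical :=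
  h.trans (Ideal.radical_mono (sup_le_sup_right hAB _))

section loc
variable (z : R) {Lz : Type} [AddCommGroup Lz] [Module R Lz] (ι : L →ₗ[R] Lz)
  [hloc : IsLocalizedModule (Submonoid.powers z) ι]

lemma loc_bij (ι : L →ₗ[R] Lz) [hloc : IsLocalizedModule (Submonoid.powers z) ι] : Function.Bijective (fun x : Lz => z • x) := by
  have h := IsLocalizedModule.map_units ι (⟨z, Submonoid.mem_powers z⟩ : Submonoid.powers z)
  exact (Module.End.isUnit_iff _).1 h

lemma loc_surj (x : Lz) : ∃ (N : ℕ) (l : L), z^N • x = ι l := by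
  obtain ⟨⟨l, s⟩, h⟩ := IsLocalizedModule.surj (Submonoid.powers z) ι x
  obtain ⟨N, hN⟩ := s.2
  refine ⟨N, l, ?_⟩
  exact (congrArg (· • x) hN).trans h

lemma loc_eq_zero {l : L} (h : ι l = 0) : ∃ M : ℕ, z^M • l = 0 := by
  obtain ⟨s, hs⟩ := (IsLocalizedModule.eq_zero_iff (Submonoid.powers z) ι).1 h
  obtain ⟨N, hN⟩ := s.2
  refine ⟨N, ?_⟩
  exact (congrArg (· • l) hN).trans hs

lemma loc_ker_iff {l : L} : ι l = 0 ↔ ∃ M : ℕ, z^M • l = 0 := by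
  refine ⟨loc_eq_zero z ι, ?_⟩
  rintro ⟨M, hM⟩
  exact (IsLocalizedModule.eq_zero_iff (Submonoid.powers z) ι).2 ⟨⟨z^M, M, rfl⟩, hM⟩

lemma loc_pow_inj (ι : L →ₗ[R] Lz) [hloc : IsLocalizedModule (Submonoid.powers z) ι] {x : Lz} {N : ℕ} (h : z^N • x = 0) : x = 0 := by
  induction N with
  | zero => simpa using h
  | succ N ih =>
    apply ih
    apply (loc_bij z ι).1
    simp only [smul_zero]
    rw [smul_smul, ← pow_succ', h]

lemma loc_div (ι : L →ₗ[R] Lz) [hloc : IsLocalizedModule (Submonoid.powers z) ι] (x : Lz) (N : ℕ) : ∃ y, z^N • y = x := by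
  induction N generalizing x with
  | zero => exact ⟨x, by simp⟩
  | succ N ih =>
    obtain ⟨y, hy⟩ := (loc_bij z ι).2 x
    obtain ⟨w, hw⟩ := ih y
    exact ⟨w, by rw [pow_succ', mul_smul, hw]; exact hy⟩

lemma loc_smul_top (I : Ideal R) (w : Lz) (hw : w ∈ I • (⊤ : Submodule R Lz)) :
    ∃ (N : ℕ), ∃ l ∈ I • (⊤ : Submodule R L), z^N • w = ι l := by
  induction hw using Submodule.smul_induction_on' with
  | smul r hr n hn =>
    obtain ⟨N, l, h⟩ := loc_surj z ι n
    refine ⟨N, r • l, Submodule.smul_mem_smul hr trivial, ?_⟩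
    rw [smul_comm, h, map_smul]
  | add a ha b hb iha ihb =>
    obtain ⟨N, l, hl, h⟩ := iha
    obtain ⟨N', l', hl', h'⟩ := ihb
    refine ⟨N + N', z^N' • l + z^N • l', Submodule.add_mem _ (Submodule.smul_mem _ _ hl)
      (Submodule.smul_mem _ _ hl'), ?_⟩
    rw [map_add, map_smul, map_smul, ← h, ← h', smul_add, smul_smul, smul_smul, ← pow_add,
      ← pow_add, add_comm N' N]

lemma prod_mem_span (zs : List R) (k t n : ℕ) (x : R) (hx : x ∈ Ideal.span {w | ∃ z ∈ zs, w = z^(k+t)}) :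
    zs.prod ^ n * x ∈ Ideal.span {w | ∃ z ∈ zs, w = z^(n+k+t)} := by
  induction hx using Submodule.span_induction with
  | mem x h =>
    obtain ⟨z, hz, rfl⟩ := h
    obtain ⟨c, hc⟩ := List.dvd_prod hz
    rw [hc, show (z * c)^n * z^(k+t) = c^n * z^(n+k+t) by ring]
    exact Ideal.mul_mem_left _ _ (Ideal.subset_span ⟨z, hz, rfl⟩)
  | zero => simp
  | add x y _ _ hx hy => rw [mul_add]; exact Ideal.add_mem _ hx hy
  | smul a x _ hx =>
    rw [smul_eq_mul, mul_left_comm]; exact Ideal.mul_mem_left _ _ hx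

lemma TT_step (zs : List R) (h : TT zs (Lz ⧸ LinearMap.range ι)) : TT (z :: zs) L := by
  intro l t
  obtain ⟨y, hy⟩ := loc_div z ι (ι l) t
  obtain ⟨k, hk⟩ := h (Submodule.Quotient.mk y) t
  rw [← Submodule.Quotient.mk_smul, ← Submodule.range_mkQ (LinearMap.range ι), LinearMap.range_eq_map (Submodule.mkQ _),
    ← Submodule.map_smul''] at hk
  obtain ⟨w, hw, hwy⟩ := hk
  rw [Submodule.mkQ_apply, Submodule.Quotient.eq] at hwy
  obtain ⟨l2, hl2⟩ := hwy
  obtain ⟨N, l1, hl1, hN⟩ := loc_smul_top z ι _ w hw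
  have e1 : ι (z^N • zs.prod^k • l - z^t • l1 + z^(N+t) • l2) = 0 := by
    rw [map_add, map_sub, map_smul, map_smul, map_smul, map_smul, hl2, ← hN, ← hy, smul_sub]
    simp only [smul_smul]
    have a1 : z ^ N * (zs.prod ^ k * z ^ t) = z^(N+t) * zs.prod ^ k := by ring
    have a2 : z ^ t * z ^ N = z ^ (N+t) := by ring
    rw [a1, a2]
    abel
  obtain ⟨M, hM⟩ := loc_eq_zero z ι e1
  refine ⟨M + N + k, ?_⟩
  have e2 : (z :: zs).prod ^ (M+N+k) • l = (z^(M+t+k) * zs.prod^(M+N)) • l1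
      - (z ^(M+N+k+t) * zs.prod^(M+N)) • l2 := by
    have h3 := congrArg (fun q => (z^k * zs.prod^(M+N)) • q) hM
    simp only [smul_zero, smul_add, smul_sub, smul_smul] at h3
    rw [List.prod_cons]
    have a1 : (z * zs.prod)^(M+N+k) = z ^ k * zs.prod ^ (M + N) * z ^ M * z ^ N * zs.prod ^ k := by ring
    have a2 : z^(M+t+k) * zs.prod^(M+N) = z ^ k * zs.prod ^ (M + N) * z ^ M * z ^ t := by ring
    have a3 : z ^(M+N+k+t) * zs.prod^(M+N) = z ^ k * zs.prod ^ (M + N) * z ^ M * z ^ (N + t) := by ring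
    rw [a1, a2, a3]
    simp only [mul_assoc] at h3 ⊢
    rw [← sub_eq_zero]
    rw [← h3]; abel
  rw [e2]
  refine Submodule.sub_mem _ ?_ ?_
  · rw [mul_smul]
    refine Submodule.smul_mem _ _ ?_
    have : ∀ q ∈ Ideal.span {w | ∃ z ∈ zs, w = z^(k+t)} • (⊤ : Submodule R L),
        zs.prod^(M+N) • q ∈ Ideal.span {w | ∃ z' ∈ z :: zs, w = z'^(M+N+k+t)} • (⊤ : Submodule R L) := by
      intro q hq
      induction hq using Submodule.smul_induction_on' with
      | smul r hr n hn =>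
        rw [smul_smul]
        refine Submodule.smul_mem_smul ?_ trivial
        refine Ideal.span_mono ?_ (prod_mem_span zs k t (M+N) r hr)
        rintro _ ⟨z', hz', rfl⟩
        exact ⟨z', List.mem_cons_of_mem _ hz', rfl⟩
      | add a ha b hb iha ihb => rw [smul_add]; exact Submodule.add_mem _ iha ihb
    exact this l1 hl1
  · rw [mul_smul]
    exact Submodule.smul_mem_smul (Ideal.subset_span ⟨z, List.mem_cons_self, rfl⟩) trivial
end loc

theorem LV_key [IsNoetherianRing R] (J : Ideal R) (zs : List R) (hzs : ∀ z ∈ zs, z ∈ J)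
    (L : Type) [AddCommGroup L] [Module R L] (hL : Cnd J zs L) :
    (∀ i > zs.length, LV J L i) ∧ (LV J L zs.length → TT zs L) := by
  induction zs generalizing L with
  | nil =>
    have ht : tors J L = ⊤ := by
      rw [eq_top_iff]
      rintro l -
      have h := hL l
      obtain ⟨k, hk⟩ := Ideal.exists_pow_le_of_le_radical_of_fg h (IsNoetherian.noetherian J)
      refine ⟨k, fun r hr => ?_⟩
      have := hk hr
      simpa using this
    refine ⟨fun i hi => ?_, fun h l t => ⟨0, ?_⟩⟩
    · obtain ⟨j, rfl⟩ : ∃ j, i = j + 1 := ⟨i - 1, by simp at hi; lia⟩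
      exact LV_of_tors ht j
    · rw [tors_LV_zero ht h l, smul_zero]
      exact Submodule.zero_mem _
  | cons z zs ih =>
    let Lz := LocalizedModule (Submonoid.powers z) L
    let ι : L →ₗ[R] Lz := LocalizedModule.mkLinearMap _ L
    have hzJ : z ∈ J := hzs z List.mem_cons_self
    have ih' := ih (fun w hw => hzs w (List.mem_cons_of_mem _ hw))
    have hΓ : Cnd J zs (LinearMap.ker ι) := by
      intro l
      obtain ⟨M, hM⟩ := loc_eq_zero z ι (show ι l.1 = 0 from l.2)
      refine cnd_aux (k := M) ?_ (cnd_mono ?_ (hL l.1))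
      · exact Subtype.ext hM
      · intro r hr
        exact Subtype.ext hr
    have hC : Cnd J zs (Lz ⧸ LinearMap.range ι) := by
      intro c
      obtain ⟨y, rfl⟩ := Submodule.mkQ_surjective _ c
      obtain ⟨N, l, hl⟩ := loc_surj z ι y
      refine cnd_aux (k := N) ?_ (cnd_mono ?_ (hL l))
      · rw [Ideal.mem_torsionOf_iff, ← map_smul, hl, Submodule.mkQ_apply, Submodule.Quotient.mk_eq_zero]
        exact ⟨l, rfl⟩
      · intro r hr
        rw [Ideal.mem_torsionOf_iff] at hr ⊢
        have : r • y = 0 := by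
          apply loc_pow_inj z ι (N := N)
          rw [smul_comm, hl, ← map_smul, hr, map_zero]
        rw [← map_smul, this, map_zero]
    have e1 : Function.Exact (LinearMap.ker ι).subtype ι.rangeRestrict := by
      rw [LinearMap.exact_iff]; simp
    have e2 : Function.Exact (LinearMap.range ι).subtype (LinearMap.range ι).mkQ := by
      rw [LinearMap.exact_iff]; simp
    have i1 := Submodule.injective_subtype (LinearMap.ker ι)
    have i2 := Submodule.injective_subtype (LinearMap.range ι)
    have s1 : Function.Surjective ι.rangeRestrict := ι.surjective_rangeRestrict
    have s2 := Submodule.mkQ_surjective (LinearMap.range ι)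
    have hlz : ∀ i, LV J Lz i := LV_of_bijective hzJ (loc_bij z ι)
    obtain ⟨a1, a2⟩ := ih' _ hΓ
    obtain ⟨b1, b2⟩ := ih' _ hC
    refine ⟨fun i hi => ?_, fun h => ?_⟩
    · rw [List.length_cons] at hi
      obtain ⟨j, rfl⟩ : ∃ j, i = j + 1 := ⟨i - 1, by lia⟩
      refine LV_mid _ _ i1 s1 e1 (a1 _ (by lia)) ?_
      exact LV_left _ _ i2 s2 e2 (b1 _ (by lia)) (hlz _)
    · rw [List.length_cons] at h
      have h1 : LV J (LinearMap.range ι) (zs.length + 1) :=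
        LV_right _ _ i1 s1 e1 h (a1 _ (by lia))
      have h2 := LV_right _ _ i2 s2 e2 (hlz _) h1
      exact TT_step z ι zs (b2 h2)

end Key

end

section
open Limits Opposite

section Grade
variable {R : Type} [CommRing R] {J : Ideal R} {M : Type} [AddCommGroup M] [Module R M]

lemma extGrade_eq : extGrade R J M = sInf {i : ℕ | Nontrivial
    (Abelian.Ext (ModuleCat.of R (R ⧸ J)) (ModuleCat.of R M) i)} := by
  unfold extGrade
  congr 1
  ext i
  exact nontrivial_old_iff _ _

lemma extGrade_pos_kill (h : 0 < extGrade R J M) {m : M} (hm : ∀ r ∈ J, r • m = 0) : m = 0 := by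
  rw [extGrade_eq] at h
  have h0 : 0 ∉ {i : ℕ | Nontrivial
    (Abelian.Ext (ModuleCat.of R (R ⧸ J)) (ModuleCat.of R M) i)} := Nat.notMem_of_lt_sInf h
  rw [Set.mem_ofPred_eq, not_nontrivial_iff_subsingleton] at h0
  let φ : ModuleCat.of R (R ⧸ J) ⟶ ModuleCat.of R M :=
      ModuleCat.ofHom (Submodule.liftQ J (LinearMap.toSpanSingleton R M m) (by
        intro r hr; simpa using hm r hr))
  have h1 : Abelian.Ext.mk₀ φ = 0 := Subsingleton.elim _ _
  rw [Abelian.Ext.mk₀_eq_zero_iff] at h1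
  have h2 := congrArg (fun q => q.hom (Ideal.Quotient.mk J 1)) h1
  change (1:R) • m = 0 at h2
  simpa using h2

lemma mem_span_singleton_smul_top {y : R} {m : M} :
    m ∈ Ideal.span {y} • (⊤ : Submodule R M) ↔ ∃ n, y • n = m := by
  constructor
  · intro h
    rw [Submodule.ideal_span_singleton_smul] at h
    obtain ⟨n, _, hn⟩ := h
    exact ⟨n, hn⟩
  · rintro ⟨n, rfl⟩
    exact Submodule.smul_mem_smul (Ideal.mem_span_singleton_self y) trivial

lemma ext_extGrade_quot_aux {S : ShortComplex (ModuleCat.{0} R)} (hS : S.ShortExact) (A : ModuleCat.{0} R)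
    (h0 : ∀ i, ∀ e : Abelian.Ext A S.X₁ i, e.comp (Abelian.Ext.mk₀ S.f) (add_zero i) = 0)
    (h : 0 < sInf {i : ℕ | Nontrivial (Abelian.Ext A S.X₁ i)})
    (h12 : ∀ i, Subsingleton (Abelian.Ext A S.X₁ i) → Subsingleton (Abelian.Ext A S.X₂ i)) :
    sInf {i : ℕ | Nontrivial (Abelian.Ext A S.X₃ i)} + 1 = sInf {i : ℕ | Nontrivial (Abelian.Ext A S.X₁ i)} := by
  set g := sInf {i : ℕ | Nontrivial (Abelian.Ext A S.X₁ i)} with hg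
  have hne : {i : ℕ | Nontrivial (Abelian.Ext A S.X₁ i)}.Nonempty := Nat.nonempty_of_pos_sInf h
  have hgm : Nontrivial (Abelian.Ext A S.X₁ g) := Nat.sInf_mem hne
  have hlt : ∀ i < g, Subsingleton (Abelian.Ext A S.X₁ i) := fun i hi =>
    not_nontrivial_iff_subsingleton.1 (Nat.notMem_of_lt_sInf (s := {i : ℕ | Nontrivial (Abelian.Ext A S.X₁ i)}) hi)
  obtain ⟨k, hk⟩ : ∃ k, g = k + 1 := ⟨g - 1, by lia⟩
  suffices sInf {i : ℕ | Nontrivial (Abelian.Ext A S.X₃ i)} = k by rw [this, hk]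
  have hkm : k ∈ {i : ℕ | Nontrivial (Abelian.Ext A S.X₃ i)} := by
    obtain ⟨e, he⟩ := exists_ne (0 : Abelian.Ext A S.X₁ g)
    obtain ⟨x, hx⟩ := Abelian.Ext.covariant_sequence_exact₁ _ hS e (h0 _ e) hk.symm
    refine nontrivial_of_ne x 0 ?_
    rintro rfl
    exact he (by rw [← hx, Abelian.Ext.zero_comp])
  refine le_antisymm (Nat.sInf_le hkm) ?_
  refine le_csInf ⟨k, hkm⟩ fun i hi => ?_
  by_contra hlt'
  push Not at hlt'
  apply not_nontrivial_iff_subsingleton.2 _ hi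
  refine ⟨fun a b => ?_⟩
  have h1 := hlt (i+1) (by lia)
  have h2 := h12 i (hlt i (by lia))
  obtain ⟨a', rfl⟩ := Abelian.Ext.covariant_sequence_exact₃ _ hS a rfl (Subsingleton.elim _ _)
  obtain ⟨b', rfl⟩ := Abelian.Ext.covariant_sequence_exact₃ _ hS b rfl (Subsingleton.elim _ _)
  rw [Subsingleton.elim a' b']

lemma extGrade_quot {y : R} (hy : y ∈ J) (hreg : IsSMulRegular M y) (h : 0 < extGrade R J M) :
    extGrade R J (M ⧸ (Ideal.span {y} • (⊤ : Submodule R M))) + 1 = extGrade R J M := by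
  have hex : Function.Exact (LinearMap.lsmul R M y) (Ideal.span {y} • (⊤ : Submodule R M)).mkQ := by
    intro m
    rw [Submodule.mkQ_apply, Submodule.Quotient.mk_eq_zero, mem_span_singleton_smul_top]
    rfl
  rw [extGrade_eq] at h ⊢
  rw [extGrade_eq]
  refine ext_extGrade_quot_aux (sesOf_shortExact (LinearMap.lsmul R M y) (Submodule.mkQ _)
    (show Function.Injective _ from hreg) (Submodule.mkQ_surjective _) hex)
    (ModuleCat.of R (R ⧸ J)) ?_ h (fun i hi => hi)
  intro i e
  have h1 : y • e = 0 := by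
    refine ext_smul_zero (fun a => ?_) e
    obtain ⟨a, rfl⟩ := Ideal.Quotient.mk_surjective a
    change Ideal.Quotient.mk _ (y * a) = 0
    rw [Ideal.Quotient.eq_zero_iff_mem]
    exact Ideal.mul_mem_right _ _ hy
  rw [Abelian.Ext.smul_eq_comp_mk₀] at h1
  exact h1

end Grade

end

section
open Limits Opposite

section Gradings
variable {K : Type} [Field K] {σ : Type} {M : Type} [AddCommGroup M] [Module (MvPolynomial σ K) M]

/-- a coarse grading on `M` given by its component maps -/
structure IsWGr (w : σ → ℕ) (π : ℕ → M →+ M) : Prop where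
  fin : ∀ m, ∃ N, (∀ j, N ≤ j → π j m = 0) ∧ m = ∑ j ∈ Finset.range N, π j m
  smul : ∀ (s : MvPolynomial σ K) (d : ℕ), IsWeightedHomogeneous w s d → ∀ j m,
    π j (s • m) = if d ≤ j then s • π (j - d) m else 0

lemma IsWGr.quot {w : σ → ℕ} {π : ℕ → M →+ M} (h : IsWGr (K := K) w π) {y : MvPolynomial σ K} {d : ℕ}
    (hy : IsWeightedHomogeneous w y d) :
    ∃ π' : ℕ → (M ⧸ (Ideal.span {y} • (⊤ : Submodule (MvPolynomial σ K) M))) →+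
      (M ⧸ (Ideal.span {y} • (⊤ : Submodule (MvPolynomial σ K) M))), IsWGr (K := K) w π' := by
  set N := (Ideal.span {y} • (⊤ : Submodule (MvPolynomial σ K) M)) with hN
  let π' : ℕ → (M ⧸ N) →+ (M ⧸ N) := fun j =>
    QuotientAddGroup.lift N.toAddSubgroup (N.mkQ.toAddMonoidHom.comp (π j)) (by
      intro x hx
      obtain ⟨n, rfl⟩ := mem_span_singleton_smul_top.1 (show x ∈ N from hx)
      change N.mkQ (π j (y • n)) = 0
      rw [h.smul y d hy, Submodule.mkQ_apply, Submodule.Quotient.mk_eq_zero]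
      split_ifs
      · exact mem_span_singleton_smul_top.2 ⟨_, rfl⟩
      · exact zero_mem _)
  have hπ : ∀ j m, π' j (N.mkQ m) = N.mkQ (π j m) := fun j m => rfl
  refine ⟨π', ?_, ?_⟩
  · intro m
    obtain ⟨m, rfl⟩ := N.mkQ_surjective m
    obtain ⟨B, h1, h2⟩ := h.fin m
    refine ⟨B, fun j hj => by rw [hπ, h1 j hj, map_zero], ?_⟩
    conv_lhs => rw [h2]
    rw [map_sum]
    rfl
  · intro s e hs j m
    obtain ⟨m, rfl⟩ := N.mkQ_surjective m
    rw [← map_smul, hπ, h.smul s e hs]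
    split_ifs
    · rw [map_smul, hπ]
    · rw [map_zero]

lemma IsWGr.ass {w : σ → ℕ} {π : ℕ → M →+ M} (h : IsWGr (K := K) w π) {m : M} {p : Ideal (MvPolynomial σ K)}
    (hp : p.IsPrime) (hm : ∀ f, f ∈ p ↔ f • m = 0) (f : MvPolynomial σ K) (hf : f ∈ p) (a : ℕ) :
    weightedHomogeneousComponent w a f ∈ p := by
  -- a family version
  have key : ∀ (F : ℕ → MvPolynomial σ K) (N a0 : ℕ), (∀ a, IsWeightedHomogeneous w (F a) a) →
      (∀ a < a0, F a = 0) → (∑ a ∈ Finset.range N, F a) ∈ p → (∀ a, N ≤ a → F a = 0) → F a0 ∈ p := by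
    intro F N a0 hF h0 hs hN
    have hs' := (hm _).1 hs
    have hcomp : ∀ j, ∑ a ∈ Finset.range N, (if a ≤ j then F a • π (j - a) m else 0) = 0 := by
      intro j
      have := congrArg (π j) hs'
      rw [Finset.sum_smul, map_sum, map_zero] at this
      refine Eq.trans ?_ this
      exact Finset.sum_congr rfl fun a _ => (h.smul _ _ (hF a) j m).symm
    have hk : ∀ j, F a0 ^ (j+1) • π j m = 0 := by
      intro j
      induction j using Nat.strong_induction_on with
      | _ j ih =>
        by_cases ha : a0 < N
        · have h1 := congrArg (fun q => F a0 ^ j • q) (hcomp (a0 + j))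
          simp only [smul_zero, Finset.smul_sum] at h1
          rw [Finset.sum_eq_single a0] at h1
          · rw [if_pos (by lia), Nat.add_sub_cancel_left, smul_smul, ← pow_succ] at h1
            exact h1
          · intro a _ hne
            split_ifs with hle
            · rcases lt_or_gt_of_ne hne with hlt | hlt
              · rw [h0 a hlt, zero_smul, smul_zero]
              · have h2 := ih (a0 + j - a) (by lia)
                rw [smul_comm]
                have : F a0 ^ j = F a0 ^ (j - (a0 + j - a + 1)) * F a0 ^ (a0 + j - a + 1) := by
                  rw [← pow_add]; congr 1; lia
                rw [this, mul_smul, h2, smul_zero, smul_zero]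
            · rw [smul_zero]
          · intro hn; exact absurd (Finset.mem_range.2 ha) hn
        · rw [hN a0 (by lia), pow_succ, mul_zero, zero_smul]
    obtain ⟨B, -, hB⟩ := h.fin m
    have : F a0 ^ (B + 1) ∈ p := by
      rw [hm, hB, Finset.smul_sum]
      refine Finset.sum_eq_zero fun j hj => ?_
      have hj' := Finset.mem_range.1 hj
      have : F a0 ^ (B+1) = F a0 ^ (B - j) * F a0 ^ (j + 1) := by
        rw [← pow_add]; congr 1; lia
      rw [this, mul_smul, hk, smul_zero]
    exact hp.mem_of_pow_mem _ this
  obtain ⟨N, hN1, hN2⟩ : ∃ N, (∀ a, N ≤ a → weightedHomogeneousComponent w a f = 0) ∧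
      ∑ a ∈ Finset.range N, weightedHomogeneousComponent w a f = f := by
    have hfin := weightedHomogeneousComponent_finsupp (w := w) f
    obtain ⟨B, hB⟩ := hfin.bddAbove
    have hz : ∀ a, B + 1 ≤ a → weightedHomogeneousComponent w a f = 0 := by
      intro a ha
      by_contra hne
      have := hB (show a ∈ Function.support _ from hne)
      lia
    refine ⟨B + 1, hz, ?_⟩
    conv_rhs => rw [← sum_weightedHomogeneousComponent w f]
    rw [finsum_eq_sum_of_support_subset]
    intro a ha
    simp only [Finset.coe_range, Set.mem_Iio]
    by_contra hh
    exact ha (hz a (by lia))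
  induction a using Nat.strong_induction_on with
  | _ a ih =>
    let F : ℕ → MvPolynomial σ K := fun b => if b < a then 0 else weightedHomogeneousComponent w b f
    have := key F N a (fun b => ?_) (fun b hb => if_pos hb) ?_ (fun b hb => ?_)
    · simpa [F] using this
    · simp only [F]; split_ifs
      · exact isWeightedHomogeneous_zero _ _ _
      · exact weightedHomogeneousComponent_isWeightedHomogeneous _ _
    · have : ∑ b ∈ Finset.range N, F b = f - ∑ b ∈ Finset.range N, (if b < a then weightedHomogeneousComponent w b f else 0) := by
        rw [eq_sub_iff_add_eq, ← Finset.sum_add_distrib]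
        conv_rhs => rw [← hN2]
        refine Finset.sum_congr rfl fun b _ => ?_
        simp only [F]; split_ifs <;> simp
      rw [this]
      refine p.sub_mem hf (p.sum_mem fun b _ => ?_)
      split_ifs with hb
      · exact ih b hb
      · exact p.zero_mem
    · simp only [F]; split_ifs
      · rfl
      · exact hN1 b hb

end Gradings

section Bigr
variable {K : Type} [Field K] {m n : ℕ} {M : Type} [AddCommGroup M] [Module (BGS K m n) M]

lemma IsBigrading.exists_wgr {ℳ : ℕ × ℕ → AddSubgroup M} (hM : IsBigrading K m n M ℳ) (u : ℕ × ℕ →+ ℕ) :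
    ∃ π : ℕ → M →+ M, IsWGr (K := K) (fun i => u (bwt m n i)) π := by
  classical
  let _ := hM.internal.chooseDecomposition
  let π : ℕ → M →+ M := fun j =>
    (DirectSum.toAddMonoid (fun e => if u e = j then (ℳ e).subtype else 0)).comp
      (DirectSum.decomposeAddEquiv ℳ).toAddMonoidHom
  have hπ : ∀ j e x, x ∈ ℳ e → π j x = if u e = j then x else 0 := by
    intro j e x hx
    simp only [π, AddMonoidHom.comp_apply]
    change DirectSum.toAddMonoid _ (DirectSum.decompose ℳ x) = _
    rw [DirectSum.decompose_of_mem ℳ hx, DirectSum.toAddMonoid_of]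
    split_ifs <;> rfl
  refine ⟨π, ?_, ?_⟩
  · intro x
    induction x using DirectSum.Decomposition.inductionOn ℳ with
    | zero => exact ⟨0, by simp⟩
    | @homogeneous e x =>
      refine ⟨u e + 1, fun j hj => ?_, ?_⟩
      · rw [hπ j e x x.2, if_neg (by lia)]
      · rw [Finset.sum_eq_single (u e)]
        · rw [hπ _ e x x.2, if_pos rfl]
        · intro b _ hb
          rw [hπ _ e x x.2, if_neg (Ne.symm hb)]
        · simp
    | add x y hx hy =>
      obtain ⟨A, hA, hA'⟩ := hx
      obtain ⟨B, hB, hB'⟩ := hy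
      refine ⟨A + B, fun j hj => by rw [map_add, hA j (by lia), hB j (by lia), add_zero], ?_⟩
      simp only [map_add, Finset.sum_add_distrib]
      congr 1
      · conv_lhs => rw [hA']
        apply Finset.sum_subset (by intro; simp; lia)
        intro j _ hj; exact hA j (by simpa using hj)
      · conv_lhs => rw [hB']
        apply Finset.sum_subset (by intro; simp; lia)
        intro j _ hj; exact hB j (by simpa using hj)
  · intro s d hs j x
    rw [s.as_sum]
    simp only [Finset.sum_smul, map_sum]
    have : (if d ≤ j then ∑ v ∈ s.support, (monomial v (coeff v s)) • π (j - d) x else 0)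
      = ∑ v ∈ s.support, if d ≤ j then (monomial v (coeff v s)) • π (j - d) x else 0 := by
      split_ifs <;> simp
    rw [this]
    clear this
    refine Finset.sum_congr rfl fun v hv => ?_
    have hv' := hs (mem_support_iff.1 hv)
    have hwt : u (Finsupp.weight (bwt m n) v) = d := by
      rw [← hv', Finsupp.weight_apply, Finsupp.weight_apply, Finsupp.sum, Finsupp.sum, map_sum]
      simp only [map_nsmul]
    have hmon := isWeightedHomogeneous_monomial (bwt m n) v (coeff v s) rfl
    induction x using DirectSum.Decomposition.inductionOn ℳ with
    | zero => simp
    | @homogeneous e x =>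
      rw [hπ _ _ _ (hM.smul_mem _ _ _ _ hmon x.2), hπ _ _ _ x.2, map_add, hwt]
      by_cases h1 : d ≤ j
      · rw [if_pos h1]
        by_cases h2 : u e = j - d
        · rw [if_pos h2, if_pos (by lia)]
        · rw [if_neg h2, if_neg (by lia), smul_zero]
      · rw [if_neg h1, if_neg (by lia)]
    | add x y hx hy =>
      rw [smul_add, map_add, hx, hy]
      split_ifs <;> simp

end Bigr

end

section
open Limits Opposite

section Poly
variable {K : Type} [Field K] {m n : ℕ}

/-- setting the `x`-variables to zero -/
def rhoMap (K : Type) [Field K] (m n : ℕ) : BGS K m n →ₐ[K] BGS K m n :=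
  aeval (Sum.elim (fun _ => 0) (fun j => X (Sum.inr j)))

/-- the irrelevant ideal -/
def idealM (K : Type) [Field K] (m n : ℕ) : Ideal (BGS K m n) :=
  RingHom.ker (constantCoeff : BGS K m n →+* K)

instance idealM_max : (idealM K m n).IsMaximal :=
  RingHom.ker_isMaximal_of_surjective _ (fun c => ⟨C c, by simp⟩)

lemma X_mem_idealM (i) : (X i : BGS K m n) ∈ idealM K m n := by
  simp [idealM, RingHom.mem_ker]

lemma idealP_le_idealM : idealP K m n ≤ idealM K m n :=
  Ideal.span_le.2 (by rintro _ ⟨i, rfl⟩; exact X_mem_idealM _)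

lemma idealQ_le_idealM : idealQ K m n ≤ idealM K m n :=
  Ideal.span_le.2 (by rintro _ ⟨i, rfl⟩; exact X_mem_idealM _)

lemma idealM_le {I : Ideal (BGS K m n)} (hP : idealP K m n ≤ I) (hQ : idealQ K m n ≤ I) : idealM K m n ≤ I := by
  intro f hf
  have h1 : f ∈ Ideal.span (X '' (Set.univ : Set (Fin m ⊕ Fin n))) := by
    rw [mem_ideal_span_X_image]
    intro v hv
    by_contra hne
    push Not at hne
    have : v = 0 := by ext i; simpa using hne i trivial
    subst this
    exact (mem_support_iff.1 hv) hf
  refine Ideal.span_le.2 ?_ h1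
  rintro _ ⟨i | j, -, rfl⟩
  · exact hP (Ideal.subset_span ⟨i, rfl⟩)
  · exact hQ (Ideal.subset_span ⟨j, rfl⟩)

lemma rho_sub_mem (f : BGS K m n) : rhoMap K m n f - f ∈ idealP K m n := by
  rw [← Ideal.Quotient.eq]
  have : (Ideal.Quotient.mkₐ K (idealP K m n)).comp (rhoMap K m n) = Ideal.Quotient.mkₐ K (idealP K m n) := by
    apply algHom_ext
    rintro (i | j)
    · simp only [AlgHom.comp_apply, rhoMap, aeval_X, Sum.elim_inl, map_zero]
      symm
      exact Ideal.Quotient.eq_zero_iff_mem.2 (Ideal.subset_span ⟨i, rfl⟩)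
    · simp [rhoMap]
  exact DFunLike.congr_fun this f

lemma rho_idealP {f : BGS K m n} (hf : f ∈ idealP K m n) : rhoMap K m n f = 0 := by
  have : idealP K m n ≤ RingHom.ker (rhoMap K m n) := Ideal.span_le.2 (by
    rintro _ ⟨i, rfl⟩; simp [rhoMap, RingHom.mem_ker])
  exact this hf

lemma rho_eq_comp (f : BGS K m n) :
    rhoMap K m n f = weightedHomogeneousComponent (fun i => (bwt m n i).1) 0 f := by
  classical
  have : (rhoMap K m n).toLinearMap = weightedHomogeneousComponent (fun i => (bwt m n i).1) 0 := by
    apply MvPolynomial.linearMap_ext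
    intro v
    ext
    simp only [LinearMap.comp_apply, AlgHom.toLinearMap_apply, rhoMap, aeval_monomial, map_one, one_mul]
    have hmon := isWeightedHomogeneous_monomial (R := K) (fun i => (bwt m n i).1) v 1 rfl
    by_cases hz : Finsupp.weight (fun i => (bwt m n i).1) v = 0
    · rw [weightedHomogeneousComponent_eq_self (hz ▸ hmon), monomial_eq, C_1, one_mul]
      refine congrArg _ (Finsupp.prod_congr fun i hi => ?_)
      rcases i with i | j
      · exfalso
        rw [Finsupp.weight_apply, Finsupp.sum, Finset.sum_eq_zero_iff] at hz
        have := hz _ hi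
        simp [bwt] at this
        simp [this] at hi
      · rfl
    · rw [hmon.weightedHomogeneousComponent_ne _ (Ne.symm hz)]
      have : ∃ i : Fin m, v (Sum.inl i) ≠ 0 := by
        by_contra hcon
        push Not at hcon
        apply hz
        rw [Finsupp.weight_apply, Finsupp.sum, Finset.sum_eq_zero_iff]
        rintro (i | j) -
        · simp [hcon]
        · simp [bwt]
      obtain ⟨i, hi⟩ := this
      rw [Finsupp.prod, Finset.prod_eq_zero (i := Sum.inl i) (by simpa using hi) (by simp [hi])]
  exact DFunLike.congr_fun this f

/-- linear forms in the `y` -/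
def IsYLin (y : BGS K m n) : Prop := y ∈ Submodule.span K (Set.range fun j : Fin n => (X (Sum.inr j) : BGS K m n))

lemma IsYLin.mem_Q {y : BGS K m n} (h : IsYLin y) : y ∈ idealQ K m n := by
  have : Submodule.span K (Set.range fun j : Fin n => (X (Sum.inr j) : BGS K m n)) ≤
    (idealQ K m n).restrictScalars K := Submodule.span_le.2 (fun x hx => Ideal.subset_span hx)
  exact this h

lemma IsYLin.wh {y : BGS K m n} (h : IsYLin y) : IsWeightedHomogeneous (bwt m n) y (0, 1) := by
  have : Submodule.span K (Set.range fun j : Fin n => (X (Sum.inr j) : BGS K m n)) ≤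
    weightedHomogeneousSubmodule K (bwt m n) (0, 1) := Submodule.span_le.2 (by
      rintro _ ⟨j, rfl⟩; exact isWeightedHomogeneous_X K (bwt m n) (Sum.inr j))
  exact this h

lemma IsYLin.hom {y : BGS K m n} (h : IsYLin y) : y ∈ homogeneousSubmodule (Fin m ⊕ Fin n) K 1 := by
  have : Submodule.span K (Set.range fun j : Fin n => (X (Sum.inr j) : BGS K m n)) ≤
    homogeneousSubmodule (Fin m ⊕ Fin n) K 1 := Submodule.span_le.2 (by
      rintro _ ⟨j, rfl⟩; exact isHomogeneous_X K (Sum.inr j))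
  exact this h

lemma IsYLin.rho {y : BGS K m n} (h : IsYLin y) : rhoMap K m n y = y := by
  have : Submodule.span K (Set.range fun j : Fin n => (X (Sum.inr j) : BGS K m n)) ≤
    LinearMap.eqLocus (rhoMap K m n).toLinearMap LinearMap.id := Submodule.span_le.2 (by
      rintro _ ⟨j, rfl⟩; simp [rhoMap])
  exact this h

lemma exists_ylin_avoid [Infinite K] (T : Set (Ideal (BGS K m n))) (hT : T.Finite)
    (hQ : ∀ q ∈ T, ¬ idealQ K m n ≤ q) : ∃ y : BGS K m n, IsYLin y ∧ ∀ q ∈ T, y ∉ q := by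
  let V := Submodule.span K (Set.range fun j : Fin n => (X (Sum.inr j) : BGS K m n))
  have := hT.to_subtype
  by_contra hcon
  push Not at hcon
  obtain ⟨⟨q, hq⟩, hqt⟩ := Subspace.exists_eq_top_of_iUnion_eq_univ
    (p := fun q : T => (q.1.restrictScalars K).comap V.subtype) (by
      rw [Set.eq_univ_iff_forall]
      rintro ⟨v, hv⟩
      obtain ⟨q, hq, h⟩ := hcon v hv
      exact Set.mem_iUnion.2 ⟨⟨q, hq⟩, h⟩)
  apply hQ q hq
  refine Ideal.span_le.2 ?_
  rintro _ ⟨j, rfl⟩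
  have : (⟨X (Sum.inr j), Submodule.subset_span ⟨j, rfl⟩⟩ : V) ∈ (q.restrictScalars K).comap V.subtype := by
    rw [hqt]; trivial
  exact this

attribute [local instance] MvPolynomial.gradedAlgebra

/-- good primes -/
structure BH (p : Ideal (BGS K m n)) : Prop where
  prime : p.IsPrime
  rho : ∀ f ∈ p, rhoMap K m n f ∈ p
  hom : p.IsHomogeneous (homogeneousSubmodule (Fin m ⊕ Fin n) K)

lemma isHomogeneous_of_comp {p : Ideal (BGS K m n)} (h : ∀ f ∈ p, ∀ a, homogeneousComponent a f ∈ p) :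
    p.IsHomogeneous (homogeneousSubmodule (Fin m ⊕ Fin n) K) := by
  intro a f hf
  have h1 := decomposition.decompose'_apply f a
  have h2 := h f hf a
  rw [← h1] at h2
  exact h2

lemma comp_of_isHomogeneous {p : Ideal (BGS K m n)} (h : p.IsHomogeneous (homogeneousSubmodule (Fin m ⊕ Fin n) K)) :
    ∀ f ∈ p, ∀ a, homogeneousComponent a f ∈ p := by
  intro f hf a
  exact (mem_iff_homogeneousComponent_mem h f).1 hf a

lemma le_idealM_of_hom {p : Ideal (BGS K m n)} (hp : p ≠ ⊤)
    (h : p.IsHomogeneous (homogeneousSubmodule (Fin m ⊕ Fin n) K)) : p ≤ idealM K m n := by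
  intro f hf
  have := comp_of_isHomogeneous h f hf 0
  rw [homogeneousComponent_zero] at this
  by_contra hne
  apply hp
  refine Ideal.eq_top_of_isUnit_mem _ this ?_
  exact (IsUnit.mk0 (coeff 0 f) hne).map C

lemma BH.comap_eq {p : Ideal (BGS K m n)} (h : BH p) : p.comap (rhoMap K m n) = p ⊔ idealP K m n := by
  apply le_antisymm
  · intro f hf
    have h1 := rho_sub_mem f
    rw [show f = rhoMap K m n f - (rhoMap K m n f - f) by ring]
    exact sub_mem (Ideal.mem_sup_left hf) (Ideal.mem_sup_right h1)
  · refine sup_le (fun f hf => h.rho f hf) (fun f hf => ?_)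
    rw [Ideal.mem_comap, rho_idealP hf]; exact p.zero_mem

lemma BH.comap_hom {p : Ideal (BGS K m n)} (h : BH p) :
    (p.comap (rhoMap K m n)).IsHomogeneous (homogeneousSubmodule (Fin m ⊕ Fin n) K) := by
  rw [h.comap_eq]
  refine h.hom.sup (Ideal.homogeneous_span _ _ ?_)
  rintro _ ⟨i, rfl⟩
  exact ⟨1, isHomogeneous_X _ _⟩

end Poly

end

section
open Limits Opposite

section Zlem
variable {K : Type} [Field K] {m n : ℕ}
attribute [local instance] MvPolynomial.gradedAlgebra

/-- Carries the two gradings -/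
structure GoodMod (K : Type) [Field K] (m n : ℕ) (M : Type) [AddCommGroup M] [Module (BGS K m n) M] : Prop where
  x : ∃ π : ℕ → M →+ M, IsWGr (K := K) (fun i => (bwt m n i).1) π
  t : ∃ π : ℕ → M →+ M, IsWGr (K := K) (1 : Fin m ⊕ Fin n → ℕ) π

lemma IsBigrading.good {M : Type} [AddCommGroup M] [Module (BGS K m n) M] {ℳ : ℕ × ℕ → AddSubgroup M}
    (hM : IsBigrading K m n M ℳ) : GoodMod K m n M := by
  refine ⟨hM.exists_wgr (AddMonoidHom.fst ℕ ℕ), ?_⟩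
  obtain ⟨π, hπ⟩ := hM.exists_wgr (AddMonoidHom.fst ℕ ℕ + AddMonoidHom.snd ℕ ℕ)
  refine ⟨π, ?_⟩
  have : (1 : Fin m ⊕ Fin n → ℕ) = fun i => (AddMonoidHom.fst ℕ ℕ + AddMonoidHom.snd ℕ ℕ) (bwt m n i) := by
    funext i
    rcases i with i | j <;> simp [bwt]
  rw [this]; exact hπ

lemma IsYLin.wx {y : BGS K m n} (h : IsYLin y) : IsWeightedHomogeneous (fun i => (bwt m n i).1) y 0 := by
  have : Submodule.span K (Set.range fun j : Fin n => (X (Sum.inr j) : BGS K m n)) ≤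
    weightedHomogeneousSubmodule K (fun i => (bwt m n i).1) 0 := Submodule.span_le.2 (by
      rintro _ ⟨j, rfl⟩; exact isWeightedHomogeneous_X K (fun i => (bwt m n i).1) (Sum.inr j))
  exact this h

lemma GoodMod.quot {M : Type} [AddCommGroup M] [Module (BGS K m n) M] (h : GoodMod K m n M) {y : BGS K m n}
    (hy : IsYLin y) : GoodMod K m n (M ⧸ (Ideal.span {y} • (⊤ : Submodule (BGS K m n) M))) := by
  obtain ⟨⟨π, hπ⟩, ⟨τ, hτ⟩⟩ := h
  exact ⟨hπ.quot hy.wx, hτ.quot (d := 1) hy.hom⟩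

lemma exists_of_ass {R M : Type} [CommRing R] [IsNoetherianRing R] [AddCommGroup M] [Module R M] {p : Ideal R}
    (hp : p ∈ associatedPrimes R M) : p.IsPrime ∧ ∃ m : M, ∀ f, f ∈ p ↔ f • m = 0 := by
  obtain ⟨h1, m, hm⟩ := isAssociatedPrime_iff.1 hp
  refine ⟨h1, m, fun f => ?_⟩
  rw [hm]; simp [Submodule.mem_colon_singleton]

lemma GoodMod.bh {M : Type} [AddCommGroup M] [Module (BGS K m n) M] (h : GoodMod K m n M)
    {p : Ideal (BGS K m n)} (hp : p ∈ associatedPrimes (BGS K m n) M) : BH p := by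
  obtain ⟨h1, x, hx⟩ := exists_of_ass hp
  obtain ⟨⟨π, hπ⟩, ⟨τ, hτ⟩⟩ := h
  refine ⟨h1, fun f hf => ?_, isHomogeneous_of_comp fun f hf a => hτ.ass h1 hx f hf a⟩
  rw [rho_eq_comp]
  exact hπ.ass h1 hx f hf 0

lemma minimal_hom {I q : Ideal (BGS K m n)} (hI : I.IsHomogeneous (homogeneousSubmodule (Fin m ⊕ Fin n) K))
    (hq : q ∈ I.minimalPrimes) : q.IsHomogeneous (homogeneousSubmodule (Fin m ⊕ Fin n) K) := by
  have h1 := hq.1.1.homogeneousCore (𝒜 := homogeneousSubmodule (Fin m ⊕ Fin n) K)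
  have h2 := Ideal.toIdeal_homogeneousCore_le (homogeneousSubmodule (Fin m ⊕ Fin n) K) q
  have h3 : I ≤ (q.homogeneousCore (homogeneousSubmodule (Fin m ⊕ Fin n) K)).toIdeal :=
    hI.toIdeal_homogeneousCore_eq_self.symm.trans_le (Ideal.homogeneousCore_mono _ hq.1.2)
  have h4 := hq.2 ⟨h1, h3⟩ h2
  rw [le_antisymm h4 h2]
  exact HomogeneousIdeal.isHomogeneous _

lemma zlemma [Infinite K] (d : ℕ) : ∀ I : Ideal (BGS K m n),
    I.IsHomogeneous (homogeneousSubmodule (Fin m ⊕ Fin n) K) → idealP K m n ≤ I →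
    (∀ q : PrimeSpectrum (BGS K m n), I ≤ q.asIdeal → Order.coheight q ≤ d) →
    ∃ zs : List (BGS K m n), zs.length = d ∧ (∀ z ∈ zs, IsYLin z) ∧
      idealM K m n ≤ (I ⊔ Ideal.span {z | z ∈ zs}).radical := by
  induction d with
  | zero =>
    intro I hI _ hd
    refine ⟨[], rfl, by simp, ?_⟩
    refine le_trans ?_ (Ideal.radical_mono le_sup_left)
    rw [← Ideal.sInf_minimalPrimes]
    refine le_sInf fun q hq => ?_
    have h1 := le_idealM_of_hom hq.1.1.ne_top (minimal_hom hI hq)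
    have h2 := hd ⟨q, hq.1.1⟩ hq.1.2
    have h3 : IsMax (⟨q, hq.1.1⟩ : PrimeSpectrum (BGS K m n)) := Order.coheight_eq_zero.1 (by simpa using h2)
    exact h3 (b := ⟨idealM K m n, idealM_max.isPrime⟩) h1
  | succ d ih =>
    intro I hI hP hd
    obtain ⟨z, hz, hza⟩ := exists_ylin_avoid {q | q ∈ I.minimalPrimes ∧ ¬ idealQ K m n ≤ q}
      ((Ideal.finite_minimalPrimes_of_isNoetherianRing _ I).subset fun q hq => hq.1) (fun q hq => hq.2)
    obtain ⟨zs, h1, h2, h3⟩ := ih (I ⊔ Ideal.span {z}) (hI.sup (Ideal.homogeneous_span _ _ (by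
      rintro _ rfl; exact ⟨1, hz.hom⟩))) (hP.trans le_sup_left) (by
        intro q0 hq0
        have hI0 : I ≤ q0.asIdeal := le_sup_left.trans hq0
        have hz0 : z ∈ q0.asIdeal := hq0 (Ideal.mem_sup_right (Ideal.mem_span_singleton_self z))
        obtain ⟨q, hq, hqq⟩ := Ideal.exists_minimalPrimes_le hI0
        by_cases hQ : idealQ K m n ≤ q
        · have h5 := (idealM_le (hP.trans hq.1.2) hQ).trans hqq
          have : IsMax q0 := by
            intro b hb
            have h6 := idealM_max.eq_of_le b.2.ne_top (h5.trans hb)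
            have : b.asIdeal ≤ q0.asIdeal := by rw [← h6]; exact h5
            exact this
          rw [Order.coheight_eq_zero.2 this]
          exact zero_le
        · have hlt : (⟨q, hq.1.1⟩ : PrimeSpectrum (BGS K m n)) < q0 := by
            refine lt_of_le_of_ne hqq ?_
            rintro rfl
            exact hza q ⟨hq, hQ⟩ hz0
          have h5 := (Order.coheight_add_one_le hlt).trans (hd ⟨q, hq.1.1⟩ hq.1.2)
          push_cast at h5
          exact (ENat.add_le_add_iff_right (by simp)).1 h5)
    refine ⟨z :: zs, by simp [h1], by simpa [hz] using h2, h3.trans (Ideal.radical_mono ?_)⟩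
    rw [sup_assoc]
    refine sup_le_sup_left (sup_le (Ideal.span_mono ?_) (Ideal.span_mono ?_)) _
    · rintro _ rfl; simp
    · intro w hw; exact List.mem_cons_of_mem _ hw

/-- a regular linear form -/
lemma exists_regular [Infinite K] {M : Type} [AddCommGroup M] [Module (BGS K m n) M] [Module.Finite (BGS K m n) M]
    (hg : 0 < extGrade (BGS K m n) (idealQ K m n) M) : ∃ y : BGS K m n, IsYLin y ∧ IsSMulRegular M y := by
  obtain ⟨y, hy, hya⟩ := exists_ylin_avoid (associatedPrimes (BGS K m n) M) (associatedPrimes.finite _ _) (by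
    intro q hq hle
    obtain ⟨h1, x, hx⟩ := exists_of_ass hq
    have : x = 0 := extGrade_pos_kill hg (fun r hr => (hx r).1 (hle hr))
    subst this
    exact h1.ne_top (Ideal.eq_top_iff_one _ |>.2 ((hx 1).2 (by simp))))
  refine ⟨y, hy, ?_⟩
  have h1 : y ∉ ⋃ p ∈ associatedPrimes (BGS K m n) M, (p : Set (BGS K m n)) := by
    simpa using hya
  rw [biUnion_associatedPrimes_eq_zero_divisors] at h1
  rw [isSMulRegular_iff_right_eq_zero_of_smul]
  intro x hx
  by_contra hne
  exact h1 ⟨x, hne, hx⟩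

/-- lifting associated primes -/
lemma exists_ass_quot {M : Type} [AddCommGroup M] [Module (BGS K m n) M] [Module.Finite (BGS K m n) M]
    {y : BGS K m n} (hy : IsYLin y) (hreg : IsSMulRegular M y) {p : Ideal (BGS K m n)} (hpM : p ≤ idealM K m n)
    (hp : p ∈ associatedPrimes (BGS K m n) M) :
    ∃ q ∈ associatedPrimes (BGS K m n) (M ⧸ (Ideal.span {y} • (⊤ : Submodule (BGS K m n) M))), p ≤ q ∧ y ∈ q := by
  obtain ⟨h1, x, hx⟩ := exists_of_ass hp
  let N : Submodule (BGS K m n) M := Submodule.torsionBySet (BGS K m n) M p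
  have hmemN : ∀ z, z ∈ N ↔ ∀ r ∈ p, r • z = 0 := by
    intro z; simp [N, Submodule.mem_torsionBySet_iff]
  have hxN : x ∈ N := (hmemN x).2 fun r hr => (hx r).1 hr
  have hNfg : N.FG := IsNoetherian.noetherian N
  -- some element of N not in yM
  obtain ⟨z, hzN, hz⟩ : ∃ z ∈ N, z ∉ Ideal.span {y} • (⊤ : Submodule (BGS K m n) M) := by
    by_contra hcon
    push Not at hcon
    have hle : N ≤ Ideal.span {y} • N := by
      intro z hz
      obtain ⟨w, hw⟩ := mem_span_singleton_smul_top.1 (hcon z hz)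
      have hwN : w ∈ N := by
        rw [hmemN] at hz ⊢
        intro r hr
        apply hreg.right_eq_zero_of_smul
        rw [smul_comm, hw, hz r hr]
      rw [← hw]
      exact Submodule.smul_mem_smul (Ideal.mem_span_singleton_self y) hwN
    obtain ⟨r, hr1, hr2⟩ := Submodule.exists_sub_one_mem_and_smul_eq_zero_of_fg_of_le_smul _ N hNfg hle
    have h5 : r ∈ p := (hx r).2 (hr2 x hxN)
    have h6 : r - 1 ∈ idealM K m n :=
      (Ideal.span_singleton_le_iff_mem _ |>.2 (idealQ_le_idealM hy.mem_Q)) hr1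
    apply (idealM_max (K := K) (m := m) (n := n)).ne_top
    rw [Ideal.eq_top_iff_one]
    have := sub_mem (hpM h5) h6
    simpa using this
  have hne : (Submodule.Quotient.mk z : M ⧸ (Ideal.span {y} • (⊤ : Submodule (BGS K m n) M))) ≠ 0 := by
    rwa [Ne, Submodule.Quotient.mk_eq_zero]
  obtain ⟨q, hq, hle⟩ := exists_le_isAssociatedPrime_of_isNoetherianRing (BGS K m n) _ hne
  refine ⟨q, hq, ?_, ?_⟩
  · intro r hr
    apply hle
    rw [Submodule.mem_colon_singleton, ← Submodule.Quotient.mk_smul, (hmemN z).1 hzN r hr]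
    simp
  · apply hle
    rw [Submodule.mem_colon_singleton, ← Submodule.Quotient.mk_smul, Submodule.mem_bot,
      Submodule.Quotient.mk_eq_zero, mem_span_singleton_smul_top]
    exact ⟨z, rfl⟩

end Zlem

end

section
open Limits Opposite

section Gen

lemma exists_functional {B A : Type} [CommRing B] [IsDomain B] [CommRing A] [IsDomain A] [Algebra B A]
    [Module.Finite B A] (hinj : Function.Injective (algebraMap B A)) : ∃ φ : A →ₗ[B] B, φ 1 ≠ 0 := by
  classical
  have : FaithfulSMul B A := (faithfulSMul_iff_algebraMap_injective B A).2 hinj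
  have : FaithfulSMul B (FractionRing A) := by
    rw [faithfulSMul_iff_algebraMap_injective, IsScalarTower.algebraMap_eq B A (FractionRing A)]
    exact (IsFractionRing.injective A (FractionRing A)).comp hinj
  let _ := FractionRing.liftAlgebra B (FractionRing A)
  have := FractionRing.isScalarTower_liftAlgebra B (FractionRing A)
  obtain ⟨lam, hl⟩ : ∃ lam : Module.Dual (FractionRing B) (FractionRing A), lam 1 ≠ 0 := by
    by_contra hcon
    push Not at hcon
    exact one_ne_zero ((Module.forall_dual_apply_eq_zero_iff (FractionRing B) (1 : FractionRing A)).1 hcon)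
  let ψ : A →ₗ[B] FractionRing B := (lam.restrictScalars B).comp (Algebra.linearMap A (FractionRing A) |>.restrictScalars B)
  obtain ⟨s, hs⟩ := (Module.Finite.fg_top : (⊤ : Submodule B A).FG)
  obtain ⟨b, hb⟩ := IsLocalization.exist_integer_multiples_of_finset (nonZeroDivisors B) (s.image ψ)
  let ι : B →ₗ[B] FractionRing B := Algebra.linearMap B (FractionRing B)
  have hι : Function.Injective ι := IsFractionRing.injective B (FractionRing B)
  have hr : ∀ a, ((b : B) • ψ) a ∈ LinearMap.range ι := by
    have : (⊤ : Submodule B A) ≤ (LinearMap.range ι).comap ((b : B) • ψ) := by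
      rw [← hs, Submodule.span_le]
      intro a ha
      obtain ⟨c, hc⟩ := hb (ψ a) (Finset.mem_image_of_mem _ ha)
      exact ⟨c, hc⟩
    intro a
    exact this trivial
  let e := LinearEquiv.ofInjective ι hι
  let φ : A →ₗ[B] B := e.symm.toLinearMap.comp (((b : B) • ψ).codRestrict _ hr)
  refine ⟨φ, fun h0 => ?_⟩
  have h1 : ((b : B) • ψ).codRestrict _ hr 1 = 0 := by
    apply e.symm.injective
    rw [map_zero]; exact h0
  have h2 : (b : B) • ψ 1 = 0 := congrArg Subtype.val h1
  rw [smul_eq_zero] at h2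
  rcases h2 with h2 | h2
  · exact nonZeroDivisors.ne_zero b.2 h2
  · apply hl
    have : ψ 1 = lam 1 := by simp [ψ]
    rw [← this, h2]

lemma inj_of_dim {K : Type} [Field K] {d : ℕ} {A : Type} [CommRing A] [Algebra (MvPolynomial (Fin d) K) A]
    [Module.Finite (MvPolynomial (Fin d) K) A] (hd : ringKrullDim A = d) :
    Function.Injective (algebraMap (MvPolynomial (Fin d) K) A) := by
  rw [injective_iff_map_eq_zero]
  intro r hr
  by_contra hne
  have h1 := ringKrullDim_quotient_succ_le_of_nonZeroDivisor (mem_nonZeroDivisors_of_ne_zero hne)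
  rw [ringKrullDim_quotient, MvPolynomial.ringKrullDim_of_isNoetherianRing, ringKrullDim_eq_zero_of_field] at h1
  have h2 : ringKrullDim A ≤ Order.krullDim (PrimeSpectrum.zeroLocus
      (R := MvPolynomial (Fin d) K) (Ideal.span {r} : Ideal (MvPolynomial (Fin d) K))) := by
    refine Order.krullDim_le_of_strictMono (fun q : PrimeSpectrum A =>
      ⟨PrimeSpectrum.comap (algebraMap (MvPolynomial (Fin d) K) A) q, ?_⟩) ?_
    · rw [PrimeSpectrum.mem_zeroLocus, SetLike.coe_subset_coe, Ideal.span_singleton_le_iff_mem]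
      change algebraMap _ A r ∈ q.asIdeal
      rw [hr]; exact zero_mem _
    · intro q q' hlt
      have := q.2
      exact Ideal.IsIntegral.comap_lt_comap (R := MvPolynomial (Fin d) K) (I := q.asIdeal) (J := q'.asIdeal) hlt
  rw [hd] at h2
  have h3 := (add_le_add_left h2 1).trans h1
  simp only [Nat.card_eq_fintype_card, Fintype.card_fin, zero_add] at h3
  have : ((d + 1 : ℕ) : WithBot ℕ∞) ≤ (d : ℕ) := by push_cast; exact h3
  have := Nat.cast_le.1 this
  lia

lemma monomial_absurd {K : Type} [Field K] {d : ℕ} (b : MvPolynomial (Fin d) K) (hb : b ≠ 0) (t : ℕ)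
    (ht : b.totalDegree < t) (k : ℕ)
    (h : (∏ i, (X i : MvPolynomial (Fin d) K)) ^ k * b ∈ Ideal.span (Set.range fun i => (X i : MvPolynomial (Fin d) K) ^ (k + t))) :
    False := by
  classical
  have e1 : (Set.range fun i => (X i : MvPolynomial (Fin d) K) ^ (k + t)) =
      (fun s => monomial s (1 : K)) '' (Set.range fun i => Finsupp.single i (k + t)) := by
    rw [← Set.range_comp]
    congr 1; funext i
    simp [X_pow_eq_monomial]
  rw [e1, mem_ideal_span_monomial_image] at h
  obtain ⟨v, hv⟩ := Finset.nonempty_iff_ne_empty.2 (fun h => hb (support_eq_empty.1 h))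
  let w : Fin d →₀ ℕ := Finsupp.equivFunOnFinite.symm (fun _ => k)
  have e2 : (∏ i, (X i : MvPolynomial (Fin d) K)) ^ k = monomial w 1 := by
    rw [monomial_eq, C_1, one_mul, Finsupp.prod_fintype _ _ (by simp), ← Finset.prod_pow]
    rfl
  obtain ⟨_, ⟨i, rfl⟩, hi⟩ := h (w + v) (by
    rw [mem_support_iff, e2, coeff_monomial_mul, one_mul]
    exact mem_support_iff.1 hv)
  have h1 : k + t ≤ k + v i := by simpa [w] using hi i
  have h2 : v i ≤ b.totalDegree := by
    refine le_trans ?_ (le_totalDegree hv)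
    by_cases hz : v i = 0
    · simp [hz]
    · exact Finset.single_le_sum (f := fun j => v j) (by simp) (by simpa using hz)
  lia

end Gen

end

section
open Limits Opposite

section CD
variable {K : Type} [Field K] {m n : ℕ}
attribute [local instance] MvPolynomial.gradedAlgebra

lemma comp_mul_lin {σ : Type} (c z : MvPolynomial σ K) (hz : z.IsHomogeneous 1) (k : ℕ) :
    homogeneousComponent (k+1) (c * z) = homogeneousComponent k c * z := by
  have h1 : c * z = ∑ i ∈ Finset.range (c.totalDegree + 1), homogeneousComponent i c * z := by
    rw [← Finset.sum_mul, sum_homogeneousComponent]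
  have h2 : ∀ i, homogeneousComponent (k+1) (homogeneousComponent i c * z) =
      if i = k then homogeneousComponent i c * z else 0 := by
    intro i
    rw [homogeneousComponent_of_mem (n := i + 1) ((homogeneousComponent_isHomogeneous i c).mul hz)]
    congr 1
    simp [eq_comm]
  rw [h1, map_sum, Finset.sum_congr rfl (fun i _ => h2 i), Finset.sum_ite_eq']
  split_ifs with h
  · rfl
  · rw [homogeneousComponent_eq_zero, zero_mul]
    simpa using h

lemma finite_of_sop_aux {σ A : Type} [Finite σ] [CommRing A] {d : ℕ} (π : MvPolynomial σ K →+* A)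
    (hπ : Function.Surjective π) (g : MvPolynomial (Fin d) K →+* A)
    (z : Fin d → MvPolynomial σ K) (hz : ∀ i, (z i).IsHomogeneous 1)
    (hgX : ∀ i, g (X i) = π (z i)) (hgC : ∀ c, g (C c) = π (C c))
    (I : Ideal (MvPolynomial σ K)) (hIπ : ∀ a ∈ I, π a = 0)
    (hI : ∀ f ∈ I, ∀ a, homogeneousComponent a f ∈ I)
    (N : ℕ) (hN : idealOfVars σ K ^ N ≤ I ⊔ Ideal.span (Set.range z)) : g.Finite := by
  classical
  algebraize [g]
  have hX : ∀ i (a : A), (X i : MvPolynomial (Fin d) K) • a = π (z i) * a := by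
    intro i a
    rw [Algebra.smul_def]
    congr 1
    exact hgX i
  have hC : ∀ (c : K) (f : MvPolynomial σ K), π (C c * f) =
      (C c : MvPolynomial (Fin d) K) • π f := by
    intro c f
    rw [Algebra.smul_def, map_mul]
    congr 1
    exact (hgC c).symm
  let T : Set (σ →₀ ℕ) := {v | v.degree < N + 1}
  have hT : T.Finite := Finsupp.finite_of_degree_le N |>.subset (by intro v hv; exact Nat.lt_succ_iff.1 hv)
  let W : Submodule (MvPolynomial (Fin d) K) A :=
    Submodule.span _ ((fun v => π (monomial v 1)) '' T)
  have key : ∀ e, ∀ f : MvPolynomial σ K, f.IsHomogeneous e → π f ∈ W := by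
    intro e
    induction e using Nat.strong_induction_on with
    | _ e ih =>
      intro f hf
      by_cases he : e < N + 1
      · rw [f.as_sum, map_sum]
        refine W.sum_mem fun v hv => ?_
        have : monomial v (coeff v f) = C (coeff v f) * monomial v 1 := by rw [C_mul_monomial, mul_one]
        rw [this, hC]
        refine W.smul_mem _ (Submodule.subset_span ⟨v, ?_, rfl⟩)
        have hv' := hf (mem_support_iff.1 hv)
        change v.degree < N + 1
        rw [Finsupp.degree_eq_weight_one]
        rw [← hv'] at he; exact he
      · obtain ⟨k, rfl⟩ : ∃ k, e = k + 1 := ⟨e - 1, by lia⟩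
        have hfm : f ∈ idealOfVars σ K ^ N := by
          rw [mem_pow_idealOfVars_iff]
          intro v hv
          have hv' := hf (mem_support_iff.1 hv)
          rw [Finsupp.degree_eq_weight_one]
          have : Finsupp.weight (fun _ : σ => 1) v = k + 1 := hv'
          rw [this]
          lia
        obtain ⟨a, ha, b, hb, hab⟩ := Submodule.mem_sup.1 (hN hfm)
        obtain ⟨c, hc⟩ := (Submodule.mem_span_range_iff_exists_fun _).1 hb
        have h1 : f = homogeneousComponent (k+1) a + ∑ i, homogeneousComponent k (c i) * z i := by
          conv_lhs => rw [← homogeneousComponent_eq_self hf, ← hab, ← hc, map_add, map_sum]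
          simp only [smul_eq_mul, comp_mul_lin _ _ (hz _)]
        rw [h1, map_add, hIπ _ (hI a ha _), zero_add, map_sum]
        refine W.sum_mem fun i _ => ?_
        rw [map_mul, mul_comm, ← hX]
        exact W.smul_mem _ (ih k (by lia) _ (homogeneousComponent_isHomogeneous _ _))
  have hW : W = ⊤ := by
    rw [eq_top_iff]
    rintro a -
    obtain ⟨f, rfl⟩ := hπ a
    rw [← sum_homogeneousComponent f, map_sum]
    exact W.sum_mem fun i _ => key i _ (homogeneousComponent_isHomogeneous _ _)
  change Module.Finite _ _
  exact ⟨hW ▸ Submodule.fg_span (hT.image _)⟩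

lemma finite_of_sop {σ : Type} [Finite σ] {d : ℕ} (z : Fin d → MvPolynomial σ K) (hz : ∀ i, (z i).IsHomogeneous 1)
    (I : Ideal (MvPolynomial σ K)) (hI : ∀ f ∈ I, ∀ a, homogeneousComponent a f ∈ I)
    (N : ℕ) (hN : idealOfVars σ K ^ N ≤ I ⊔ Ideal.span (Set.range z)) :
    ((aeval (fun i => Ideal.Quotient.mk I (z i)) : MvPolynomial (Fin d) K →ₐ[K] (MvPolynomial σ K ⧸ I)) :
      MvPolynomial (Fin d) K →+* (MvPolynomial σ K ⧸ I)).Finite :=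
  finite_of_sop_aux (Ideal.Quotient.mk I) Ideal.Quotient.mk_surjective _ z hz
    (fun i => aeval_X _ i) (fun c => aeval_C _ c) I
    (fun _ ha => Ideal.Quotient.eq_zero_iff_mem.2 ha) hI N hN

/-- The point of the spectrum attached to a good prime -/
def BH.pt {p : Ideal (BGS K m n)} (h : BH p) : PrimeSpectrum (BGS K m n) :=
  ⟨p.comap (rhoMap K m n), h.prime.comap _⟩

lemma BH.pt_fin {p : Ideal (BGS K m n)} (h : BH p) : ∃ d : ℕ, Order.coheight h.pt = d := by
  have h1 := Order.coheight_le_krullDim h.pt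
  have h2 : Order.krullDim (PrimeSpectrum (BGS K m n)) = ((m + n : ℕ) : WithBot ℕ∞) := by
    change ringKrullDim (BGS K m n) = _
    rw [MvPolynomial.ringKrullDim_of_isNoetherianRing, ringKrullDim_eq_zero_of_field]
    simp
  rw [h2] at h1
  have h3 : Order.coheight h.pt ≤ ((m + n : ℕ) : ℕ∞) := by exact_mod_cast h1
  exact ⟨_, (ENat.natCast_toNat (ne_top_of_le_ne_top (ENat.natCast_ne_top _) h3)).symm⟩

lemma dim_eq_coheight {R : Type} [CommRing R] (q : PrimeSpectrum R) :
    ringKrullDim (R ⧸ q.asIdeal) = (Order.coheight q : WithBot ℕ∞) := by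
  rw [ringKrullDim_quotient, Order.coheight_eq_krullDim_Ici]
  congr 1

lemma mem_sup_of_smul_one {R : Type} [CommRing R] {p J : Ideal R} {r : R}
    (hk : r • (1 : R ⧸ p) ∈ J • (⊤ : Submodule R (R ⧸ p))) : r ∈ p ⊔ J := by
  have key : J • (⊤ : Submodule R (R ⧸ p)) ≤ Submodule.map (Submodule.mkQ p) (p ⊔ J) := by
    refine Submodule.smul_le.2 fun a ha x _ => ?_
    obtain ⟨s, rfl⟩ := Ideal.Quotient.mk_surjective x
    exact ⟨a * s, Ideal.mem_sup_right (J.mul_mem_right _ ha), rfl⟩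
  obtain ⟨u, hu, hu'⟩ := key hk
  have h1 : Ideal.Quotient.mk p u = Ideal.Quotient.mk p r := by
    have : r • (1 : R ⧸ p) = Ideal.Quotient.mk p r := by
      rw [Algebra.smul_def, mul_one]; rfl
    rw [← this]; exact hu'
  rw [Ideal.Quotient.eq] at h1
  rw [show r = u - (u - r) by ring]
  exact sub_mem hu (Ideal.mem_sup_left h1)

lemma tt_absurd {p : Ideal (BGS K m n)} (h : BH p) (zs : List (BGS K m n)) (hzs : ∀ z ∈ zs, IsYLin z)
    (hd : Order.coheight h.pt = zs.length)
    (hrad : idealM K m n ≤ (p.comap (rhoMap K m n) ⊔ Ideal.span {z | z ∈ zs}).radical)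
    (hTT : TT zs (BGS K m n ⧸ p)) : False := by
  classical
  set 𝔭 : Ideal (BGS K m n) := p.comap (rhoMap K m n) with h𝔭
  have hprime : 𝔭.IsPrime := h.pt.2
  have hle : p ≤ 𝔭 := by rw [h𝔭, h.comap_eq]; exact le_sup_left
  obtain ⟨N, hN⟩ := Ideal.exists_pow_le_of_le_radical_of_fg hrad (IsNoetherian.noetherian _)
  let z : Fin zs.length → BGS K m n := zs.get
  have hrange : Set.range z = {z | z ∈ zs} := by ext w; simp [z, List.mem_iff_get]
  have hfin := finite_of_sop z (fun i => (hzs _ (List.get_mem _ _)).hom) 𝔭 (comp_of_isHomogeneous h.comap_hom) N (by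
    rw [hrange]
    refine le_trans (Ideal.pow_right_mono ?_ N) hN
    exact Ideal.span_le.2 (by rintro _ ⟨i, rfl⟩; exact X_mem_idealM _))
  set g : MvPolynomial (Fin zs.length) K →+* (BGS K m n ⧸ 𝔭) :=
    ((aeval (fun i => Ideal.Quotient.mk 𝔭 (z i)) : MvPolynomial (Fin zs.length) K →ₐ[K] (BGS K m n ⧸ 𝔭)) :
      MvPolynomial (Fin zs.length) K →+* (BGS K m n ⧸ 𝔭)) with hg
  have hgX : ∀ i, g (X i) = Ideal.Quotient.mk 𝔭 (z i) := fun i => aeval_X _ i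
  algebraize [g]
  have hdim : ringKrullDim (BGS K m n ⧸ 𝔭) = (zs.length : WithBot ℕ∞) := by
    have := dim_eq_coheight h.pt
    rw [hd] at this
    exact this
  have hinj := inj_of_dim (K := K) hdim
  obtain ⟨φ, hφ⟩ := exists_functional hinj
  obtain ⟨k, hk⟩ := hTT 1 ((φ 1).totalDegree + 1)
  refine monomial_absurd (φ 1) hφ _ (Nat.lt_succ_self _) k ?_
  set t := (φ 1).totalDegree + 1
  -- transport to the quotient by 𝔭
  have h1 : (zs.prod) ^ k ∈ 𝔭 ⊔ Ideal.span (Set.range fun i => z i ^ (k + t)) := by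
    have e0 : {w | ∃ z ∈ zs, w = z ^ (k + t)} = Set.range fun i => z i ^ (k + t) := by
      ext w
      constructor
      · rintro ⟨u, hu, rfl⟩
        obtain ⟨i, rfl⟩ := List.mem_iff_get.1 hu
        exact ⟨i, rfl⟩
      · rintro ⟨i, rfl⟩; exact ⟨_, List.get_mem _ _, rfl⟩
    rw [e0] at hk
    exact sup_le_sup_right hle _ (mem_sup_of_smul_one hk)
  obtain ⟨a, ha, b, hb, hab⟩ := Submodule.mem_sup.1 h1
  obtain ⟨c, hc⟩ := (Submodule.mem_span_range_iff_exists_fun _).1 hb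
  have h2 : (∏ i, (X i : MvPolynomial (Fin zs.length) K)) ^ k • (1 : BGS K m n ⧸ 𝔭) =
      ∑ i, (X i : MvPolynomial (Fin zs.length) K) ^ (k + t) • Ideal.Quotient.mk 𝔭 (c i) := by
    have e1 : Ideal.Quotient.mk 𝔭 (zs.prod ^ k) = Ideal.Quotient.mk 𝔭 b := by
      rw [← hab, map_add, Ideal.Quotient.eq_zero_iff_mem.2 ha, zero_add]
    have e2 : zs.prod = ∏ i, z i := by
      conv_lhs => rw [← List.ofFn_get zs]
      rw [List.prod_ofFn]
    rw [← hc, e2, map_pow, map_prod, map_sum] at e1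
    simp only [Algebra.smul_def, mul_one]
    change g _ = ∑ i, g _ * _
    rw [map_pow, map_prod]
    simp only [map_pow, hgX]
    rw [e1]
    refine Finset.sum_congr rfl fun i _ => ?_
    rw [smul_eq_mul, map_mul, map_pow, mul_comm]
  have h3 := congrArg φ h2
  rw [map_smul, map_sum] at h3
  rw [← smul_eq_mul, h3]
  refine Ideal.sum_mem _ fun i _ => ?_
  rw [map_smul, smul_eq_mul]
  exact Ideal.mul_mem_right _ _ (Ideal.subset_span ⟨i, rfl⟩)

theorem cohDim_BH [Infinite K] {p : Ideal (BGS K m n)} (h : BH p) :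
    (cohDim (BGS K m n) (idealQ K m n) (BGS K m n ⧸ p) : ℕ∞) = Order.coheight h.pt := by
  obtain ⟨d, hd⟩ := h.pt_fin
  obtain ⟨zs, hlen, hlin, hrad⟩ := zlemma d (p.comap (rhoMap K m n)) h.comap_hom
    (by rw [h.comap_eq]; exact le_sup_right) (fun q hq => hd ▸ Order.coheight_anti (show h.pt ≤ q from hq))
  have hQ : idealQ K m n ≤ (p ⊔ Ideal.span {z | z ∈ zs}).radical := by
    refine Ideal.span_le.2 ?_
    rintro _ ⟨j, rfl⟩
    obtain ⟨k, hk⟩ := hrad (X_mem_idealM (Sum.inr j))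
    refine ⟨k, ?_⟩
    obtain ⟨a, ha, b, hb, hab⟩ := Submodule.mem_sup.1 hk
    have h1 := congrArg (rhoMap K m n) hab
    have h2 : rhoMap K m n (X (Sum.inr j) ^ k) = X (Sum.inr j) ^ k := by simp [rhoMap]
    rw [h2, map_add] at h1
    change (X (Sum.inr j) : BGS K m n) ^ k ∈ p ⊔ Ideal.span {z | z ∈ zs}
    rw [← h1]
    refine add_mem (Ideal.mem_sup_left ha) (Ideal.mem_sup_right ?_)
    have : Ideal.span {z | z ∈ zs} ≤ (Ideal.span {z | z ∈ zs}).comap (rhoMap K m n) := by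
      refine Ideal.span_le.2 fun w hw => ?_
      change rhoMap K m n w ∈ Ideal.span {z | z ∈ zs}
      rw [(hlin w hw).rho]
      exact Ideal.subset_span hw
    exact this hb
  have hC : Cnd (idealQ K m n) zs (BGS K m n ⧸ p) := by
    intro l
    refine hQ.trans (Ideal.radical_mono (sup_le_sup_right ?_ _))
    intro f hf
    obtain ⟨s, rfl⟩ := Ideal.Quotient.mk_surjective l
    rw [Ideal.mem_torsionOf_iff]
    change Ideal.Quotient.mk p (f * s) = 0
    exact Ideal.Quotient.eq_zero_iff_mem.2 (Ideal.mul_mem_right _ _ hf)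
  obtain ⟨hv, hnv⟩ := LV_key (idealQ K m n) zs (fun z hz => (hlin z hz).mem_Q) _ hC
  rw [hd]
  congr 1
  refine IsGreatest.csSup_eq ⟨?_, ?_⟩
  · refine (nontrivial_lc_iff _ _ _).2 fun hLV => ?_
    rw [← hlen] at hLV hd
    exact tt_absurd h zs hlin hd hrad (hnv hLV)
  · intro i hi
    by_contra hlt
    exact (nontrivial_lc_iff _ _ _).1 hi (hv i (by lia))

end CD

end

section Final
variable {K : Type} [Field K] {m n : ℕ}

lemma cohDim_drop [Infinite K] {M : Type} [AddCommGroup M] [Module (BGS K m n) M]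
    {y : BGS K m n} (hy : IsYLin y) (hreg : IsSMulRegular M y) {p q : Ideal (BGS K m n)}
    (hp : BH p) (hpM : p ∈ associatedPrimes (BGS K m n) M) (hq : BH q) (hpq : p ≤ q) (hyq : y ∈ q) :
    cohDim (BGS K m n) (idealQ K m n) (BGS K m n ⧸ q) + 1 ≤
      cohDim (BGS K m n) (idealQ K m n) (BGS K m n ⧸ p) := by
  have hyp : y ∉ p := by
    intro hmem
    obtain ⟨h1, x, hx⟩ := exists_of_ass hpM
    have h2 : y • x = y • (0 : M) := by rw [smul_zero]; exact (hx y).1 hmem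
    have h3 : x = 0 := hreg h2
    exact h1.ne_top ((Ideal.eq_top_iff_one _).2 ((hx 1).2 (by rw [h3, smul_zero])))
  have hlt : hp.pt < hq.pt := by
    refine lt_of_le_of_ne (show p.comap (rhoMap K m n) ≤ q.comap (rhoMap K m n) from Ideal.comap_mono hpq) ?_
    intro he
    have h1 : y ∈ q.comap (rhoMap K m n) := by rw [Ideal.mem_comap, hy.rho]; exact hyq
    have h2 : p.comap (rhoMap K m n) = q.comap (rhoMap K m n) := congrArg PrimeSpectrum.asIdeal he
    rw [← h2, Ideal.mem_comap, hy.rho] at h1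
    exact hyp h1
  have := Order.coheight_add_one_le hlt
  rw [← cohDim_BH hp, ← cohDim_BH hq] at this
  exact_mod_cast this

lemma extGrade_le_cohDim [Infinite K] (g : ℕ) : ∀ (M : Type) [AddCommGroup M] [Module (BGS K m n) M]
    [Module.Finite (BGS K m n) M], GoodMod K m n M →
    extGrade (BGS K m n) (idealQ K m n) M = g → ∀ p ∈ associatedPrimes (BGS K m n) M,
    g ≤ cohDim (BGS K m n) (idealQ K m n) (BGS K m n ⧸ p) := by
  induction g with
  | zero => intros; exact Nat.zero_le _
  | succ g ih =>
    intro M _ _ _ hM hg p hp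
    have hpos : 0 < extGrade (BGS K m n) (idealQ K m n) M := by rw [hg]; exact Nat.succ_pos _
    obtain ⟨y, hy, hreg⟩ := exists_regular hpos
    have hq := extGrade_quot hy.mem_Q hreg hpos
    have hbp := hM.bh hp
    obtain ⟨q, hqA, hpq, hyq⟩ := exists_ass_quot hy hreg
      (le_idealM_of_hom hbp.prime.ne_top hbp.hom) hp
    have h1 := ih _ (hM.quot hy) (by lia) q hqA
    have h2 := cohDim_drop hy hreg hbp hp ((hM.quot hy).bh hqA) hpq hyq
    lia

end Final

theorem exists_bihomogeneous_regular_element_maximalDepth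
    (K : Type) [Field K] [Infinite K] (m n : ℕ)
    (M : Type) [AddCommGroup M] [Module (BGS K m n) M] [Module.Finite (BGS K m n) M]
    (ℳ : ℕ × ℕ → AddSubgroup M) (hM : IsBigrading K m n M ℳ)
    (hg : 0 < extGrade (BGS K m n) (idealQ K m n) M)
    (hmax : HasMaximalDepth (BGS K m n) (idealQ K m n) M) :
    ∃ y : BGS K m n, y ∈ idealQ K m n ∧ IsWeightedHomogeneous (bwt m n) y (0, 1) ∧
      IsSMulRegular M y ∧
      HasMaximalDepth (BGS K m n) (idealQ K m n)
        (M ⧸ (Ideal.span {y} • (⊤ : Submodule (BGS K m n) M))) := by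
  have hG := hM.good
  obtain ⟨y, hy, hreg⟩ := exists_regular hg
  refine ⟨y, hy.mem_Q, hy.wh, hreg, ?_⟩
  have hq := extGrade_quot hy.mem_Q hreg hg
  have hmax' : extGrade (BGS K m n) (idealQ K m n) M =
    sInf ((fun p => cohDim (BGS K m n) (idealQ K m n) (BGS K m n ⧸ p)) '' associatedPrimes (BGS K m n) M) := hmax
  have hne := Nat.nonempty_of_pos_sInf (hmax' ▸ hg)
  obtain ⟨p, hp, hpe⟩ := Nat.sInf_mem hne
  rw [← hmax'] at hpe
  have hbp := hG.bh hp
  obtain ⟨q, hqA, hpq, hyq⟩ := exists_ass_quot hy hreg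
    (le_idealM_of_hom hbp.prime.ne_top hbp.hom) hp
  have h2 := cohDim_drop hy hreg hbp hp ((hG.quot hy).bh hqA) hpq hyq
  refine le_antisymm ?_ ?_
  · refine le_csInf ⟨_, q, hqA, rfl⟩ ?_
    rintro _ ⟨r, hr, rfl⟩
    exact extGrade_le_cohDim _ _ (hG.quot hy) rfl r hr
  · refine (Nat.sInf_le (Set.mem_image_of_mem
      (fun p => cohDim (BGS K m n) (idealQ K m n) (BGS K m n ⧸ p)) hqA)).trans ?_
    simp only at hpe ⊢
    lia
end
end
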